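/- Suppose r ≥ 1 and the action is effective. Then for every i the singular homology group H_i(X_z; ℤ) is a finitely generated free abelian group, and for every i ≥ 1 the rank of H_i(X_z; ℤ) equals the coefficient of t^i in the polynomial t^{r−1} · Σ_{A ⊆ Fin n} (−1)^{r − rk(A)} (t² − 1)^{|A| − rk(A)} (which is t^{r−1} · T(M_z; 0, t²), where T is the Tutte polynomial of the column matroid M_z of z, written via its corank–nullity expansion). -/

import Mathlib

open scoped BigOperators

noncomputable section

/-- The sphere `S^{2n-1}`, realized as the unit sphere of `ℂ^n`. -/
abbrev Sph (n : ℕ) : Type := Metric.sphere (0 : EuclideanSpace ℂ (Fin n)) 1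

/-- The element of the circle by which `t ∈ T^r = (Fin r → Circle)` acts on the `j`-th
coordinate of `ℂ^n`, namely `∏ i, (t i) ^ (z i j)`. -/
def weightProd {n r : ℕ} (z : Fin r → Fin n → ℤ) (t : Fin r → Circle) (j : Fin n) : Circle :=
  ∏ i, t i ^ z i j

/-- The orbit equivalence relation on `S^{2n-1}` for the linear torus action with weight
matrix `z`:  `x ≈ y` iff some `t ∈ T^r` moves `x` to `y`, where `(t • x) j = (∏ i, (t i)^(z i j)) • (x j)`. -/
def orbitSetoid {n r : ℕ} (z : Fin r → Fin n → ℤ) : Setoid (Sph n) where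
  r x y := ∃ t : Fin r → Circle,
    ∀ j, (weightProd z t j : ℂ) * (x : EuclideanSpace ℂ (Fin n)) j
      = (y : EuclideanSpace ℂ (Fin n)) j
  iseqv := by
    constructor
    · intro x
      exact ⟨1, fun j => by simp [weightProd]⟩
    · rintro x y ⟨t, ht⟩
      refine ⟨fun i => (t i)⁻¹, fun j => ?_⟩
      have h : weightProd z (fun i => (t i)⁻¹) j = (weightProd z t j)⁻¹ := by
        simp only [weightProd, inv_zpow]
        exact Finset.prod_inv_distrib _
      rw [h, ← ht j, Circle.coe_inv, inv_mul_cancel_left₀ (Circle.coe_ne_zero _)]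
    · rintro x y zz ⟨t, ht⟩ ⟨s, hs⟩
      refine ⟨t * s, fun j => ?_⟩
      have h : weightProd z (t * s) j = weightProd z t j * weightProd z s j := by
        simp [weightProd, mul_zpow, Finset.prod_mul_distrib]
      rw [h, ← hs j, ← ht j]
      push_cast
      ring

/-- The orbit space `X_z = S^{2n-1}/T^r` of the linear torus action with weight matrix `z`,
equipped with the quotient topology. -/
abbrev OrbitSpace {n r : ℕ} (z : Fin r → Fin n → ℤ) : Type := Quotient (orbitSetoid z)

open CategoryTheory AlgebraicTopology

/-- The singular chain complex functor with integer coefficients: the composition of the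
singular simplicial set functor, the free abelian group functor applied levelwise, and the
alternating face map complex. -/
def singularChainComplexFunctor : TopCat.{0} ⥤ ChainComplex AddCommGrpCat ℕ :=
  TopCat.toSSet ⋙ ((SimplicialObject.whiskering _ _).obj AddCommGrpCat.free) ⋙
    alternatingFaceMapComplex AddCommGrpCat

/-- The `i`-th singular homology functor with integer coefficients. -/
def singularHomologyFunctor (i : ℕ) : TopCat.{0} ⥤ AddCommGrpCat :=
  _root_.singularChainComplexFunctor ⋙ HomologicalComplex.homologyFunctor _ _ i

/-- `H_i(X; ℤ)`, the `i`-th singular homology group of `X` with integer coefficients. -/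
abbrev SingularHomology (X : Type) [TopologicalSpace X] (i : ℕ) : Type :=
  (singularHomologyFunctor i).obj (TopCat.of X)

/-- The `i`-th reduced singular homology group `H̃_i(X; ℤ)`, realized as the kernel of the
map induced on `H_i` by the constant map from `X` to a one-point space. -/
def ReducedHomology (X : Type) [TopologicalSpace X] (i : ℕ) :
    AddSubgroup (SingularHomology X i) :=
  AddMonoidHom.ker ((singularHomologyFunctor i).map
    (TopCat.ofHom (ContinuousMap.const X PUnit.unit) : TopCat.of X ⟶ TopCat.of PUnit)).hom

/-- `colRank z A` is the ℚ-dimension of the span in `Fin r → ℚ` of the columns of `z`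
indexed by `A`. -/
def colRank {n r : ℕ} (z : Fin r → Fin n → ℤ) (A : Set (Fin n)) : ℕ :=
  Module.finrank ℚ (Submodule.span ℚ ((fun j => fun i => (z i j : ℚ)) '' A))

namespace OSH

/-! ### Tuple chains -/
abbrev E (V : Type) (n : ℕ) : Type := (Fin n → V) →₀ ℤ

def cone {V : Type} {n : ℕ} (a : V) : E V n →ₗ[ℤ] E V (n + 1) :=
  Finsupp.lmapDomain ℤ ℤ (Fin.cons (α := fun _ => V) a)

def emap {V W : Type} {n : ℕ} (f : V → W) : E V n →ₗ[ℤ] E W n :=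
  Finsupp.lmapDomain ℤ ℤ (fun w => f ∘ w)

lemma cone_single {V : Type} {n : ℕ} (a : V) (w : Fin n → V) (c : ℤ) :
    cone a (Finsupp.single w c) = Finsupp.single (Fin.cons (α := fun _ => V) a w) c := by
  simp [cone]

lemma emap_single {V W : Type} {n : ℕ} (f : V → W) (w : Fin n → V) (c : ℤ) :
    emap f (Finsupp.single w c) = Finsupp.single (f ∘ w) c := by
  simp [emap]

lemma cons_comp {V W : Type} {n : ℕ} (f : V → W) (a : V) (w : Fin n → V) :
    f ∘ (Fin.cons (α := fun _ => V) a w) = Fin.cons (α := fun _ => W) (f a) (f ∘ w) := by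
  funext i
  refine Fin.cases ?_ (fun j => ?_) i <;> simp

lemma single_eq_cone {V : Type} {n : ℕ} (w : Fin (n + 1) → V) :
    (Finsupp.single w 1 : E V (n + 1)) = cone (w 0) (Finsupp.single (Fin.tail w) 1) := by
  rw [cone_single, Fin.cons_self_tail]

lemma ext_single {V M : Type} [AddCommGroup M] {n : ℕ} {f g : E V n →ₗ[ℤ] M}
    (h : ∀ w, f (Finsupp.single w 1) = g (Finsupp.single w 1)) : f = g := by
  apply Finsupp.lhom_ext'
  intro w
  ext
  simpa using h w

lemma ext_cone {V M : Type} [AddCommGroup M] {n : ℕ} {f g : E V (n + 1) →ₗ[ℤ] M}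
    (h : ∀ a x, f (cone a x) = g (cone a x)) : f = g :=
  ext_single fun w => by rw [single_eq_cone]; exact h _ _

lemma emap_cone {V W : Type} {n : ℕ} (f : V → W) (a : V) (x : E V n) :
    emap f (cone a x) = cone (f a) (emap f x) := by
  have : (emap f).comp (cone a) = (cone (f a)).comp (emap f (n := n)) := by
    apply ext_single
    intro w
    simp [cone_single, emap_single, cons_comp]
  exact LinearMap.congr_fun this x

def dE {V : Type} : ∀ n, E V (n + 1) →ₗ[ℤ] E V n
  | 0 => Finsupp.lmapDomain ℤ ℤ (fun _ => Fin.elim0)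
  | n + 1 => Finsupp.linearCombination ℤ (fun w : Fin (n + 2) → V =>
      (Finsupp.single (Fin.tail w) 1 : E V (n + 1))
        - cone (w 0) (dE n (Finsupp.single (Fin.tail w) 1)))

lemma dE_cone_zero {V : Type} (a : V) (x : E V 0) : dE 0 (cone a x) = x := by
  have : (dE 0).comp (cone a) = (LinearMap.id : E V 0 →ₗ[ℤ] E V 0) := by
    apply ext_single
    intro w
    simp only [LinearMap.comp_apply, cone_single, dE, LinearMap.id_apply]
    simp only [Finsupp.lmapDomain_apply, Finsupp.mapDomain_single]
    congr 1
    exact Subsingleton.elim _ _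
  exact LinearMap.congr_fun this x

lemma dE_cone {V : Type} {n : ℕ} (a : V) (x : E V (n + 1)) :
    dE (n + 1) (cone a x) = x - cone a (dE n x) := by
  have : (dE (n + 1)).comp (cone a) =
      (LinearMap.id - (cone a).comp (dE n) : E V (n + 1) →ₗ[ℤ] E V (n + 1)) := by
    apply ext_single
    intro w
    simp [cone_single, dE]
  exact LinearMap.congr_fun this x

lemma dE_dE {V : Type} (n : ℕ) : ∀ (x : E V (n + 2)), dE n (dE (n + 1) x) = 0 := by
  induction n with
  | zero =>
    intro x
    suffices h : (dE 0).comp (dE 1) = (0 : E V 2 →ₗ[ℤ] E V 0) from LinearMap.congr_fun h x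
    apply ext_cone
    intro a x
    simp only [LinearMap.comp_apply, dE_cone, LinearMap.zero_apply, map_sub, dE_cone_zero, sub_self]
  | succ n ih =>
    intro x
    suffices h : (dE (n + 1)).comp (dE (n + 2)) = (0 : E V (n + 3) →ₗ[ℤ] E V (n + 1)) from
      LinearMap.congr_fun h x
    apply ext_cone
    intro a x
    simp only [LinearMap.comp_apply, dE_cone, LinearMap.zero_apply, map_sub, ih, map_zero, sub_zero,
      sub_self]

lemma dE_emap {V W : Type} (f : V → W) (n : ℕ) (x : E V (n + 1)) :
    dE n (emap f x) = emap f (dE n x) := by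
  induction n with
  | zero =>
    suffices h : (dE 0).comp (emap f) = (emap f).comp (dE 0) from LinearMap.congr_fun h x
    apply ext_cone
    intro a y
    simp [emap_cone, dE_cone_zero]
  | succ n ih =>
    suffices h : (dE (n + 1)).comp (emap f) = (emap f).comp (dE (n + 1)) from
      LinearMap.congr_fun h x
    apply ext_cone
    intro a y
    simp [emap_cone, dE_cone, ih]

/-! ### Subdivision -/
section subdiv
variable {V : Type} (β : ∀ n, (Fin (n + 1) → V) → V)

def sdE : ∀ n, E V n →ₗ[ℤ] E V n
  | 0 => LinearMap.id
  | n + 1 => Finsupp.linearCombination ℤ (fun w : Fin (n + 1) → V =>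
      cone (β n w) (sdE n (dE n (Finsupp.single w 1))))

lemma sdE_single (n : ℕ) (w : Fin (n + 1) → V) :
    sdE β (n + 1) (Finsupp.single w 1) = cone (β n w) (sdE β n (dE n (Finsupp.single w 1))) := by
  simp [sdE]

lemma dE_sdE : ∀ (n : ℕ) (x : E V (n + 1)), dE n (sdE β (n + 1) x) = sdE β n (dE n x) := by
  intro n
  induction n with
  | zero =>
    intro x
    suffices h : (dE 0).comp (sdE β 1) = (sdE β 0).comp (dE 0) from LinearMap.congr_fun h x
    apply ext_single
    intro w
    simp only [LinearMap.comp_apply, sdE_single, dE_cone_zero]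
  | succ n ih =>
    intro x
    suffices h : (dE (n + 1)).comp (sdE β (n + 2)) = (sdE β (n + 1)).comp (dE (n + 1)) from
      LinearMap.congr_fun h x
    apply ext_single
    intro w
    simp only [LinearMap.comp_apply, sdE_single, dE_cone, ih, dE_dE]
    simp

def tE : ∀ n, E V n →ₗ[ℤ] E V (n + 1)
  | 0 => 0
  | n + 1 => Finsupp.linearCombination ℤ (fun w : Fin (n + 1) → V =>
      cone (β n w) (Finsupp.single w 1 - tE n (dE n (Finsupp.single w 1))))

lemma tE_single (n : ℕ) (w : Fin (n + 1) → V) :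
    tE β (n + 1) (Finsupp.single w 1) =
      cone (β n w) (Finsupp.single w 1 - tE β n (dE n (Finsupp.single w 1))) := by
  simp [tE]

lemma tE_homotopy_zero (x : E V 0) : dE 0 (tE β 0 x) = x - sdE β 0 x := by
  simp [tE, sdE]

lemma tE_homotopy : ∀ (n : ℕ) (x : E V (n + 1)),
    dE (n + 1) (tE β (n + 1) x) + tE β n (dE n x) = x - sdE β (n + 1) x := by
  intro n
  induction n with
  | zero =>
    intro x
    suffices h : (dE 1).comp (tE β 1) + (tE β 0).comp (dE 0) = LinearMap.id - (sdE β 1) from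
      LinearMap.congr_fun h x
    apply ext_single
    intro w
    simp only [LinearMap.comp_apply, LinearMap.add_apply, LinearMap.sub_apply, LinearMap.id_apply,
      tE_single, sdE_single, dE_cone, map_sub, tE_homotopy_zero]
    abel
  | succ n ih =>
    intro x
    suffices h : (dE (n + 2)).comp (tE β (n + 2)) + (tE β (n + 1)).comp (dE (n + 1)) =
        LinearMap.id - (sdE β (n + 2)) from
      LinearMap.congr_fun h x
    apply ext_single
    intro w
    have h2 := ih (dE (n + 1) (Finsupp.single w 1))
    rw [dE_dE, map_zero, add_zero] at h2
    simp only [LinearMap.comp_apply, LinearMap.add_apply, LinearMap.sub_apply, LinearMap.id_apply,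
      tE_single, sdE_single, dE_cone, map_sub, h2]
    abel
end subdiv

section nat
variable {V W : Type} (β : ∀ n, (Fin (n + 1) → V) → V) (γ : ∀ n, (Fin (n + 1) → W) → W)
  (f : V → W)

lemma sdE_emap (hf : ∀ n w, f (β n w) = γ n (f ∘ w)) : ∀ (n : ℕ) (x : E V n), sdE γ n (emap f x) = emap f (sdE β n x) := by
  intro n
  induction n with
  | zero => intro x; rfl
  | succ n ih =>
    intro x
    suffices h : (sdE γ (n + 1)).comp (emap f) = (emap f).comp (sdE β (n + 1)) from
      LinearMap.congr_fun h x
    apply ext_single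
    intro w
    simp only [LinearMap.comp_apply, emap_single, sdE_single, emap_cone, hf, ← ih, ← dE_emap]

lemma tE_emap (hf : ∀ n w, f (β n w) = γ n (f ∘ w)) : ∀ (n : ℕ) (x : E V n), tE γ n (emap f x) = emap f (tE β n x) := by
  intro n
  induction n with
  | zero => intro x; simp [tE]
  | succ n ih =>
    intro x
    suffices h : (tE γ (n + 1)).comp (emap f) = (emap f).comp (tE β (n + 1)) from
      LinearMap.congr_fun h x
    apply ext_single
    intro w
    simp only [LinearMap.comp_apply, emap_single, tE_single, emap_cone, hf, map_sub, ← ih,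
      ← dE_emap]
end nat

/-! ### Prism -/
def prE {V : Type} : ∀ n, E V n →ₗ[ℤ] E (V × Bool) (n + 1)
  | 0 => 0
  | n + 1 => Finsupp.linearCombination ℤ (fun w : Fin (n + 1) → V =>
      cone (w 0, false) (cone (w 0, true) (emap (fun v => (v, true)) (Finsupp.single (Fin.tail w) 1)))
      - cone (w 0, false) (prE n (Finsupp.single (Fin.tail w) 1)))

lemma prE_cone {V : Type} (n : ℕ) (a : V) (x : E V n) :
    prE (n + 1) (cone a x) = cone (a, false) (cone (a, true) (emap (fun v => (v, true)) x))
      - cone (a, false) (prE n x) := by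
  suffices h : (prE (n + 1)).comp (cone a) =
      (cone (a, false)).comp ((cone (a, true)).comp (emap (fun v => (v, true)))) -
      (cone (a, false)).comp (prE n) from LinearMap.congr_fun h x
  apply ext_single
  intro w
  simp [prE, cone_single]

lemma prE_homotopy {V : Type} : ∀ (n : ℕ) (x : E V (n + 1)),
    dE (n + 1) (prE (n + 1) x) + prE n (dE n x) =
      emap (fun v => (v, true)) x - emap (fun v => (v, false)) x := by
  intro n
  induction n with
  | zero =>
    intro x
    suffices h : (dE 1).comp (prE 1) + (prE 0).comp (dE 0) =
        emap (fun v : V => (v, true)) - emap (fun v : V => (v, false)) from LinearMap.congr_fun h x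
    apply ext_cone
    intro a y
    have : (emap (fun v : V => (v, true)) y) = emap (fun v : V => (v, false)) y := by
      congr 1
      simp only [emap]
      congr 1
      funext w
      exact Subsingleton.elim _ _
    simp only [LinearMap.comp_apply, LinearMap.add_apply, LinearMap.sub_apply, prE_cone, dE_cone,
      dE_cone_zero, emap_cone, map_sub, this]
    simp [prE]
  | succ n ih =>
    intro x
    suffices h : (dE (n + 2)).comp (prE (n + 2)) + (prE (n + 1)).comp (dE (n + 1)) =
        emap (fun v : V => (v, true)) - emap (fun v : V => (v, false)) from LinearMap.congr_fun h x
    apply ext_cone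
    intro a y
    have h2 := ih y
    rw [← eq_sub_iff_add_eq] at h2
    simp only [LinearMap.comp_apply, LinearMap.add_apply, LinearMap.sub_apply, prE_cone, dE_cone,
      map_sub, emap_cone, h2, dE_emap]
    abel

lemma prE_emap {V W : Type} (f : V → W) : ∀ (n : ℕ) (x : E V n),
    prE n (emap f x) = emap (Prod.map f id) (prE n x) := by
  intro n
  induction n with
  | zero => intro x; simp [prE]
  | succ n ih =>
    intro x
    suffices h : (prE (n + 1)).comp (emap f) = (emap (Prod.map f id)).comp (prE (n + 1)) from
      LinearMap.congr_fun h x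
    apply ext_cone
    intro a x
    have h3 : emap (fun v => (v, true)) (emap f x) = emap (Prod.map f id) (emap (fun v => (v, true)) x) := by
      simp only [emap, Finsupp.lmapDomain_apply, ← Finsupp.mapDomain_comp]
      rfl
    simp only [LinearMap.comp_apply, emap_cone, prE_cone, ih, map_sub, h3]
    rfl

end OSH

namespace OSH

/-! ### Complexes and homology -/
structure Cx where
  C : ℕ → Type
  [ac : ∀ n, AddCommGroup (C n)]
  d : ∀ n, C (n + 1) →ₗ[ℤ] C n
  dd : ∀ n x, d n (d (n + 1) x) = 0

attribute [instance] Cx.ac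

def Cx.Z (K : Cx) : ∀ n, Submodule ℤ (K.C n)
  | 0 => ⊤
  | n + 1 => LinearMap.ker (K.d n)

def Cx.B (K : Cx) (n : ℕ) : Submodule ℤ (K.Z n) := (LinearMap.range (K.d n)).comap (K.Z n).subtype

abbrev Cx.H (K : Cx) (n : ℕ) : Type := K.Z n ⧸ K.B n

lemma Cx.d_mem (K : Cx) (n : ℕ) (x : K.C (n + 1)) : K.d n x ∈ K.Z n := by
  cases n with
  | zero => exact Submodule.mem_top
  | succ n => exact K.dd n x

def Cx.cl (K : Cx) {n : ℕ} (x : K.C n) (hx : x ∈ K.Z n) : K.H n := (K.B n).mkQ ⟨x, hx⟩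

lemma Cx.cl_eq_zero (K : Cx) {n : ℕ} (x : K.C n) (hx : x ∈ K.Z n) :
    K.cl x hx = 0 ↔ ∃ y, K.d n y = x := by
  simp only [Cx.cl, Submodule.mkQ_apply, Submodule.Quotient.mk_eq_zero]
  rfl

lemma Cx.cl_eq_cl (K : Cx) {n : ℕ} {x x' : K.C n} {hx : x ∈ K.Z n} {hx' : x' ∈ K.Z n} :
    K.cl x hx = K.cl x' hx' ↔ ∃ y, K.d n y = x - x' := by
  rw [← K.cl_eq_zero _ (sub_mem hx hx'), ← sub_eq_zero]
  rfl

lemma Cx.cl_surj (K : Cx) {n : ℕ} (a : K.H n) : ∃ x hx, K.cl x hx = a := by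
  obtain ⟨⟨x, hx⟩, h⟩ := (K.B n).mkQ_surjective a
  exact ⟨x, hx, h⟩

lemma Cx.cl_add (K : Cx) {n : ℕ} (x y : K.C n) (hx : x ∈ K.Z n) (hy : y ∈ K.Z n) :
    K.cl x hx + K.cl y hy = K.cl (x + y) (add_mem hx hy) := rfl

lemma Cx.cl_smul (K : Cx) {n : ℕ} (c : ℤ) (x : K.C n) (hx : x ∈ K.Z n) :
    c • K.cl x hx = K.cl (c • x) (Submodule.smul_mem _ c hx) := rfl

structure CHom (K L : Cx) where
  f : ∀ n, K.C n →ₗ[ℤ] L.C n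
  comm : ∀ n x, L.d n (f (n + 1) x) = f n (K.d n x)

lemma CHom.mem_Z {K L : Cx} (φ : CHom K L) {n : ℕ} {x : K.C n} (hx : x ∈ K.Z n) :
    φ.f n x ∈ L.Z n := by
  cases n with
  | zero => exact Submodule.mem_top
  | succ n =>
    have hx : K.d n x = 0 := hx
    change L.d n _ = 0
    rw [φ.comm, hx, map_zero]

def CHom.H {K L : Cx} (φ : CHom K L) (n : ℕ) : K.H n →ₗ[ℤ] L.H n :=
  (K.B n).mapQ (L.B n) ((φ.f n).restrict (fun _ hx => φ.mem_Z hx)) (by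
    rintro ⟨x, hx⟩ ⟨y, hy⟩
    exact ⟨φ.f _ y, by rw [φ.comm, hy]; rfl⟩)

lemma CHom.H_cl {K L : Cx} (φ : CHom K L) {n : ℕ} (x : K.C n) (hx : x ∈ K.Z n) :
    φ.H n (K.cl x hx) = L.cl (φ.f n x) (φ.mem_Z hx) := rfl

lemma CHom.H_ext {K L : Cx} (φ ψ : CHom K L) (n : ℕ)
    (h : ∀ x ∈ K.Z n, ∃ y, L.d n y = φ.f n x - ψ.f n x) : φ.H n = ψ.H n := by
  refine LinearMap.ext fun a => ?_
  obtain ⟨x, hx, rfl⟩ := K.cl_surj a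
  rw [CHom.H_cl, CHom.H_cl, Cx.cl_eq_cl]
  exact h x hx

def CHom.id (K : Cx) : CHom K K := ⟨fun _ => LinearMap.id, fun _ _ => rfl⟩
def CHom.comp {K L M : Cx} (ψ : CHom L M) (φ : CHom K L) : CHom K M :=
  ⟨fun n => (ψ.f n).comp (φ.f n), fun n x => by simp [ψ.comm, φ.comm]⟩
lemma CHom.H_id (K : Cx) (n : ℕ) : (CHom.id K).H n = LinearMap.id := by
  ext a; rfl
lemma CHom.H_comp {K L M : Cx} (ψ : CHom L M) (φ : CHom K L) (n : ℕ) :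
    (ψ.comp φ).H n = (ψ.H n).comp (φ.H n) := by
  ext a; rfl

/-! ### Simplices -/
abbrev Dl (n : ℕ) : Type := stdSimplex ℝ (Fin n)

def aff {n k : ℕ} (w : Fin n → Dl k) : C(Dl n, Dl k) where
  toFun t := ⟨∑ i, t i • (w i : Fin k → ℝ), (convex_stdSimplex ℝ (Fin k)).sum_mem
    (fun i _ => t.2.1 i) t.2.2 (fun i _ => (w i).2)⟩
  continuous_toFun := by
    refine Continuous.subtype_mk ?_ _
    refine continuous_finsetSum _ fun i _ => ?_
    exact Continuous.smul ((continuous_apply i).comp continuous_subtype_val) continuous_const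

lemma aff_coe {n k : ℕ} (w : Fin n → Dl k) (t : Dl n) (j : Fin k) :
    (aff w t : Fin k → ℝ) j = ∑ i, (t : Fin n → ℝ) i * (w i : Fin k → ℝ) j := by
  change (∑ i, t i • (w i : Fin k → ℝ)) j = _
  rw [Finset.sum_apply]; rfl

lemma aff_comp {n k l : ℕ} (w : Fin k → Dl l) (w' : Fin n → Dl k) :
    (aff w).comp (aff w') = aff (aff w ∘ w') := by
  ext t j
  change (aff w (aff w' t) : Fin l → ℝ) j = (aff (aff w ∘ w') t : Fin l → ℝ) j
  simp only [aff_coe, Function.comp, Finset.sum_mul, Finset.mul_sum]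
  rw [Finset.sum_comm]
  simp only [mul_assoc]

def vert (n : ℕ) : Fin n → Dl n := fun i => stdSimplex.vertex i

lemma aff_vert (n : ℕ) : aff (vert n) = ContinuousMap.id _ := by
  ext t j
  change (aff (vert n) t : Fin n → ℝ) j = (t : Fin n → ℝ) j
  simp [aff_coe, vert, stdSimplex.vertex_coe, Pi.single_apply]

lemma aff_apply_vert {n k : ℕ} (w : Fin n → Dl k) : aff w ∘ vert n = w := by
  funext i
  apply Subtype.ext
  funext j
  change (aff w (vert n i) : Fin k → ℝ) j = (w i : Fin k → ℝ) j
  simp [aff_coe, vert, stdSimplex.vertex_coe, Pi.single_apply]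

def bar (k n : ℕ) (w : Fin (n + 1) → Dl k) : Dl k := aff w stdSimplex.barycenter

lemma aff_bar {k l : ℕ} (w : Fin k → Dl l) (n : ℕ) (w' : Fin (n + 1) → Dl k) :
    aff w (bar k n w') = bar l n (aff w ∘ w') := by
  have := DFunLike.congr_fun (aff_comp w w') stdSimplex.barycenter
  exact this

/-! ### Singular chains -/
section sing
variable {X Y : Type} [TopologicalSpace X] [TopologicalSpace Y]

abbrev Ch (X : Type) [TopologicalSpace X] (n : ℕ) : Type := C(Dl n, X) →₀ ℤ

def real {k : ℕ} (σ : C(Dl k, X)) {n : ℕ} : E (Dl k) n →ₗ[ℤ] Ch X n :=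
  Finsupp.lmapDomain ℤ ℤ (fun w => σ.comp (aff w))

lemma real_single {k : ℕ} (σ : C(Dl k, X)) {n : ℕ} (w : Fin n → Dl k) (c : ℤ) :
    real σ (Finsupp.single w c) = Finsupp.single (σ.comp (aff w)) c := by simp [real]

lemma real_vert {k : ℕ} (σ : C(Dl k, X)) :
    real σ (Finsupp.single (vert k) 1) = Finsupp.single σ 1 := by
  rw [real_single, aff_vert]; rfl

lemma real_aff {k l : ℕ} (σ : C(Dl k, X)) (w : Fin l → Dl k) {n : ℕ} (x : E (Dl l) n) :
    real (σ.comp (aff w)) x = real σ (emap (aff w) x) := by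
  suffices h : real (σ.comp (aff w)) = (real σ).comp (emap (aff w) (n := n)) from
    LinearMap.congr_fun h x
  apply ext_single
  intro w'
  simp only [LinearMap.comp_apply, real_single, emap_single, ContinuousMap.comp_assoc, aff_comp]

structure NatOp (n m : ℕ) where
  op : ∀ k, E (Dl k) n →ₗ[ℤ] E (Dl k) m
  nat : ∀ k l (w : Fin k → Dl l) x, op l (emap (aff w) x) = emap (aff w) (op k x)

def NatOp.hat {n m : ℕ} (φ : NatOp n m) : Ch X n →ₗ[ℤ] Ch X m :=
  Finsupp.linearCombination ℤ (fun σ => real σ (φ.op n (Finsupp.single (vert n) 1)))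

lemma NatOp.hat_single {n m : ℕ} (φ : NatOp n m) (σ : C(Dl n, X)) :
    φ.hat (Finsupp.single σ 1) = real σ (φ.op n (Finsupp.single (vert n) 1)) := by
  simp [NatOp.hat]

lemma NatOp.hat_real {n m k : ℕ} (φ : NatOp n m) (σ : C(Dl k, X)) (x : E (Dl k) n) :
    φ.hat (real σ x) = real σ (φ.op k x) := by
  suffices h : φ.hat.comp (real σ) = (real σ).comp (φ.op k) from LinearMap.congr_fun h x
  apply ext_single
  intro w
  simp only [LinearMap.comp_apply, real_single, hat_single]
  rw [real_aff, ← φ.nat, emap_single, aff_apply_vert]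

lemma ext_ch {M : Type} [AddCommGroup M] {n : ℕ} {f g : Ch X n →ₗ[ℤ] M}
    (h : ∀ σ, f (Finsupp.single σ 1) = g (Finsupp.single σ 1)) : f = g := by
  apply Finsupp.lhom_ext'
  intro w
  ext
  simpa using h w

lemma ext_real {M : Type} [AddCommGroup M] {n : ℕ} {f g : Ch X n →ₗ[ℤ] M}
    (h : ∀ (σ : C(Dl n, X)) x, f (real σ x) = g (real σ x)) : f = g :=
  ext_ch fun σ => by rw [← real_vert]; exact h _ _

def cmap (f : C(X, Y)) {n : ℕ} : Ch X n →ₗ[ℤ] Ch Y n :=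
  Finsupp.lmapDomain ℤ ℤ (fun σ => f.comp σ)

lemma cmap_single (f : C(X, Y)) {n : ℕ} (σ : C(Dl n, X)) (c : ℤ) :
    cmap f (Finsupp.single σ c) = Finsupp.single (f.comp σ) c := by simp [cmap]

lemma cmap_real (f : C(X, Y)) {n k : ℕ} (σ : C(Dl k, X)) (x : E (Dl k) n) :
    cmap f (real σ x) = real (f.comp σ) x := by
  suffices h : (cmap f).comp (real σ (n := n)) = real (f.comp σ) from LinearMap.congr_fun h x
  apply ext_single
  intro w
  simp only [LinearMap.comp_apply, real_single, cmap_single, ContinuousMap.comp_assoc]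

lemma hat_cmap (f : C(X, Y)) {n m : ℕ} (φ : NatOp n m) (x : Ch X n) :
    φ.hat (cmap f x) = cmap f (φ.hat x) := by
  suffices h : φ.hat.comp (cmap f) = (cmap f).comp φ.hat from LinearMap.congr_fun h x
  apply ext_real
  intro σ x
  simp only [LinearMap.comp_apply, cmap_real, NatOp.hat_real]

def dOp (n : ℕ) : NatOp (n + 1) n := ⟨fun _ => dE n, fun _ _ _ x => dE_emap _ n x⟩
def sdOp (n : ℕ) : NatOp n n := ⟨fun k => sdE (bar k) n,
  fun k l w x => sdE_emap (bar k) (bar l) (aff w) (fun n w' => aff_bar w n w') n x⟩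
def tOp (n : ℕ) : NatOp n (n + 1) := ⟨fun k => tE (bar k) n,
  fun k l w x => tE_emap (bar k) (bar l) (aff w) (fun n w' => aff_bar w n w') n x⟩

def dC (n : ℕ) : Ch X (n + 1) →ₗ[ℤ] Ch X n := (dOp n).hat
def sd (n : ℕ) : Ch X n →ₗ[ℤ] Ch X n := (sdOp n).hat
def tC (n : ℕ) : Ch X n →ₗ[ℤ] Ch X (n + 1) := (tOp n).hat

lemma dC_real {k n : ℕ} (σ : C(Dl k, X)) (x : E (Dl k) (n + 1)) :
    dC n (real σ x) = real σ (dE n x) := NatOp.hat_real _ _ _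
lemma sd_real {k n : ℕ} (σ : C(Dl k, X)) (x : E (Dl k) n) :
    sd n (real σ x) = real σ (sdE (bar k) n x) := NatOp.hat_real _ _ _
lemma tC_real {k n : ℕ} (σ : C(Dl k, X)) (x : E (Dl k) n) :
    tC n (real σ x) = real σ (tE (bar k) n x) := NatOp.hat_real _ _ _

lemma dC_dC (n : ℕ) (x : Ch X (n + 2)) : dC n (dC (n + 1) x) = 0 := by
  suffices h : (dC n).comp (dC (n + 1)) = (0 : Ch X (n + 2) →ₗ[ℤ] Ch X n) from
    LinearMap.congr_fun h x
  apply ext_real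
  intro σ x
  simp only [LinearMap.comp_apply, dC_real, dE_dE, map_zero, LinearMap.zero_apply]

lemma dC_sd (n : ℕ) (x : Ch X (n + 1)) : dC n (sd (n + 1) x) = sd n (dC n x) := by
  suffices h : (dC n).comp (sd (n + 1)) = (sd (X := X) n).comp (dC n) from
    LinearMap.congr_fun h x
  apply ext_real
  intro σ x
  simp only [LinearMap.comp_apply, dC_real, sd_real, dE_sdE]

lemma tC_homotopy_zero (x : Ch X 0) : dC 0 (tC 0 x) = x - sd 0 x := by
  suffices h : (dC 0).comp (tC 0) = LinearMap.id - (sd (X := X) 0) from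
    LinearMap.congr_fun h x
  apply ext_real
  intro σ x
  simp only [LinearMap.comp_apply, dC_real, sd_real, tC_real, tE_homotopy_zero, map_sub,
    LinearMap.sub_apply, LinearMap.id_apply]

lemma tC_homotopy (n : ℕ) (x : Ch X (n + 1)) :
    dC (n + 1) (tC (n + 1) x) + tC n (dC n x) = x - sd (n + 1) x := by
  suffices h : (dC (n + 1)).comp (tC (n + 1)) + (tC n).comp (dC n) =
      LinearMap.id - (sd (X := X) (n + 1)) from
    LinearMap.congr_fun h x
  apply ext_real
  intro σ x
  simp only [LinearMap.comp_apply, dC_real, sd_real, tC_real, LinearMap.add_apply,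
    ← map_add, tE_homotopy, map_sub, LinearMap.sub_apply, LinearMap.id_apply]

def sing (X : Type) [TopologicalSpace X] : Cx where
  C := Ch X
  d := dC
  dd := dC_dC

def smap (f : C(X, Y)) : CHom (sing X) (sing Y) := ⟨fun _ => cmap f, fun n x => hat_cmap f (dOp n) x⟩

abbrev h (X : Type) [TopologicalSpace X] (n : ℕ) : Type := (sing X).H n

def hmap (f : C(X, Y)) (n : ℕ) : h X n →ₗ[ℤ] h Y n := (smap f).H n

lemma cmap_id {n : ℕ} (x : Ch X n) : cmap (ContinuousMap.id X) x = x := by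
  suffices h : cmap (ContinuousMap.id X) = (LinearMap.id : Ch X n →ₗ[ℤ] _) from
    LinearMap.congr_fun h x
  exact ext_ch fun σ => by simp [cmap_single]

lemma cmap_comp {W : Type} [TopologicalSpace W] (g : C(Y, W)) (f : C(X, Y)) {n : ℕ} (x : Ch X n) :
    cmap (g.comp f) x = cmap g (cmap f x) := by
  suffices h : cmap (g.comp f) = (cmap g).comp (cmap f (n := n)) from
    LinearMap.congr_fun h x
  exact ext_ch fun σ => by simp [cmap_single, ContinuousMap.comp_assoc]

lemma hmap_id (n : ℕ) : hmap (ContinuousMap.id X) n = LinearMap.id := by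
  rw [← CHom.H_id]
  apply CHom.H_ext
  intro x _
  refine ⟨0, ?_⟩
  rw [map_zero]
  exact (sub_eq_zero.2 (cmap_id (X := X) (n := n) x)).symm

lemma hmap_comp {W : Type} [TopologicalSpace W] (g : C(Y, W)) (f : C(X, Y)) (n : ℕ) :
    hmap (g.comp f) n = (hmap g n).comp (hmap f n) := by
  rw [hmap, hmap, hmap, ← CHom.H_comp]
  apply CHom.H_ext
  intro x _
  refine ⟨0, ?_⟩
  rw [map_zero]
  exact (sub_eq_zero.2 (cmap_comp (n := n) g f x)).symm

/-! ### Homotopy invariance -/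
def affI {n k : ℕ} (w : Fin n → Dl k × unitInterval) : C(Dl n, Dl k × unitInterval) where
  toFun t := (aff (fun i => (w i).1) t, ⟨∑ i, t i • ((w i).2 : ℝ),
    (convex_Icc (0 : ℝ) 1).sum_mem (fun i _ => t.2.1 i) t.2.2 (fun i _ => (w i).2.2)⟩)
  continuous_toFun := by
    refine Continuous.prodMk (aff _).continuous (Continuous.subtype_mk ?_ _)
    refine continuous_finsetSum _ fun i _ => ?_
    exact Continuous.smul ((continuous_apply i).comp continuous_subtype_val) continuous_const

lemma affI_snd {n k : ℕ} (w : Fin n → Dl k × unitInterval) (t : Dl n) :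
    ((affI w t).2 : ℝ) = ∑ i, (t : Fin n → ℝ) i * ((w i).2 : ℝ) := rfl

lemma affI_comp {n k l : ℕ} (w : Fin k → Dl l × unitInterval) (w' : Fin n → Dl k) :
    (affI w).comp (aff w') = affI (affI w ∘ w') := by
  refine ContinuousMap.ext fun t => Prod.ext ?_ (Subtype.ext ?_)
  · exact DFunLike.congr_fun (aff_comp (fun i => (w i).1) w') t
  · change ((affI w (aff w' t)).2 : ℝ) = ((affI (affI w ∘ w') t).2 : ℝ)
    simp only [affI_snd, Function.comp, Finset.mul_sum, aff_coe, Finset.sum_mul]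
    rw [Finset.sum_comm]
    simp only [mul_assoc]

lemma affI_vert {n k : ℕ} (w : Fin n → Dl k × unitInterval) : affI w ∘ vert n = w := by
  funext i
  refine Prod.ext ?_ (Subtype.ext ?_)
  · exact congrFun (aff_apply_vert (fun i => (w i).1)) i
  · change ((affI w (vert n i)).2 : ℝ) = _
    simp [affI_snd, vert, stdSimplex.vertex_coe, Pi.single_apply]

def realI {k : ℕ} (σ : C(Dl k × unitInterval, X)) {n : ℕ} :
    E (Dl k × unitInterval) n →ₗ[ℤ] Ch X n :=
  Finsupp.lmapDomain ℤ ℤ (fun w => σ.comp (affI w))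

lemma realI_single {k : ℕ} (σ : C(Dl k × unitInterval, X)) {n : ℕ}
    (w : Fin n → Dl k × unitInterval) (c : ℤ) :
    realI σ (Finsupp.single w c) = Finsupp.single (σ.comp (affI w)) c := by simp [realI]

lemma real_affI {k l : ℕ} (σ : C(Dl k × unitInterval, X)) (w : Fin l → Dl k × unitInterval) {n : ℕ}
    (x : E (Dl l) n) :
    real (σ.comp (affI w)) x = realI σ (emap (affI w) x) := by
  suffices h : real (σ.comp (affI w)) = (realI σ).comp (emap (affI w) (n := n)) from
    LinearMap.congr_fun h x
  apply ext_single
  intro w'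
  simp only [LinearMap.comp_apply, real_single, realI_single, emap_single,
    ContinuousMap.comp_assoc, affI_comp]

lemma dC_realI {k n : ℕ} (σ : C(Dl k × unitInterval, X)) (x : E (Dl k × unitInterval) (n + 1)) :
    dC n (realI σ x) = realI σ (dE n x) := by
  suffices h : (dC n).comp (realI σ) = (realI σ).comp (dE n) from LinearMap.congr_fun h x
  apply ext_single
  intro w
  simp only [LinearMap.comp_apply, realI_single]
  rw [← real_vert (σ.comp (affI w)), dC_real, real_affI, ← dE_emap, emap_single, affI_vert]

def b2i (b : Bool) : unitInterval := if b then 1 else 0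

def prd {k : ℕ} (H : C(X × unitInterval, Y)) (σ : C(Dl k, X)) : C(Dl k × unitInterval, Y) :=
  H.comp (σ.prodMap (ContinuousMap.id _))

lemma realI_prd {k l n : ℕ} (H : C(X × unitInterval, Y)) (σ : C(Dl k, X)) (w : Fin l → Dl k)
    (x : E (Dl l × unitInterval) n) :
    realI (prd H (σ.comp (aff w))) x = realI (prd H σ) (emap (Prod.map (aff w) id) x) := by
  suffices h : realI (prd H (σ.comp (aff w))) = (realI (prd H σ)).comp
      (emap (Prod.map (aff w) id) (n := n)) from LinearMap.congr_fun h x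
  apply ext_single
  intro w'
  simp only [LinearMap.comp_apply, realI_single, emap_single]
  congr 1
  refine ContinuousMap.ext fun t => ?_
  refine congrArg (fun a => H (σ a, (affI w' t).2)) ?_
  exact DFunLike.congr_fun (aff_comp w (fun i => (w' i).1)) t

lemma emap_emap {U V W : Type} {n : ℕ} (g : V → W) (f : U → V) (x : E U n) :
    emap g (emap f x) = emap (g ∘ f) x := by
  suffices h : (emap g).comp (emap f (n := n)) = emap (g ∘ f) from LinearMap.congr_fun h x
  exact ext_single fun w => by simp [emap_single, Function.comp_assoc]

def prC (H : C(X × unitInterval, Y)) (n : ℕ) : Ch X n →ₗ[ℤ] Ch Y (n + 1) :=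
  Finsupp.linearCombination ℤ (fun σ => realI (prd H σ)
    (emap (Prod.map id b2i) (prE n (Finsupp.single (vert n) 1))))

lemma prC_real (H : C(X × unitInterval, Y)) {n k : ℕ} (σ : C(Dl k, X)) (x : E (Dl k) n) :
    prC H n (real σ x) = realI (prd H σ) (emap (Prod.map id b2i) (prE n x)) := by
  suffices h : (prC H n).comp (real σ) =
    (realI (prd H σ)).comp ((emap (Prod.map id b2i)).comp (prE n)) from LinearMap.congr_fun h x
  apply ext_single
  intro w
  simp only [LinearMap.comp_apply, real_single, prC, Finsupp.linearCombination_single, one_smul]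
  rw [realI_prd, emap_emap]
  conv_rhs => rw [← aff_apply_vert w, ← emap_single, prE_emap, emap_emap]
  rfl

def slice (H : C(X × unitInterval, Y)) (b : unitInterval) : C(X, Y) :=
  H.comp ((ContinuousMap.id X).prodMk (ContinuousMap.const X b))

lemma realI_slice (H : C(X × unitInterval, Y)) {n k : ℕ} (σ : C(Dl k, X)) (x : E (Dl k) n) (b : Bool) :
    realI (prd H σ) (emap (Prod.map id b2i) (emap (fun a => (a, b)) x)) =
      cmap (slice H (b2i b)) (real σ x) := by
  rw [cmap_real, emap_emap]
  suffices h : (realI (prd H σ)).comp (emap (n := n) (Prod.map id b2i ∘ fun a => (a, b))) =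
    real ((slice H (b2i b)).comp σ) from LinearMap.congr_fun h x
  apply ext_single
  intro w
  simp only [LinearMap.comp_apply, realI_single, real_single, emap_single]
  congr 1
  refine ContinuousMap.ext fun t => ?_
  refine congrArg H (Prod.ext rfl (Subtype.ext ?_))
  change ((affI (fun i => (w i, b2i b)) t).2 : ℝ) = b2i b
  simp only [affI_snd, ← Finset.sum_mul]
  have h1 : ∑ i, t i = 1 := t.2.2
  rw [h1, one_mul]

lemma prC_homotopy (H : C(X × unitInterval, Y)) (n : ℕ) (x : Ch X (n + 1)) :
    dC (n + 1) (prC H (n + 1) x) + prC H n (dC n x) = cmap (slice H 1) x - cmap (slice H 0) x := by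
  suffices h : (dC (n + 1)).comp (prC H (n + 1)) + (prC H n).comp (dC n) =
      cmap (slice H (b2i true)) - cmap (slice H (b2i false)) from LinearMap.congr_fun h x
  apply ext_real
  intro σ x
  simp only [LinearMap.comp_apply, dC_real, prC_real, LinearMap.add_apply, dC_realI, dE_emap,
    ← map_add, prE_homotopy, map_sub, LinearMap.sub_apply, realI_slice]

lemma cmap_zero_deg (f g : C(X, Y)) (x : Ch X 0) : cmap f x = cmap g x := by
  suffices h : cmap f = cmap g (n := 0) from LinearMap.congr_fun h x
  refine ext_ch fun σ => ?_
  rw [cmap_single, cmap_single]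
  congr 1
  refine ContinuousMap.ext fun t => ?_
  exfalso
  have := t.2.2
  simp at this

lemma hmap_slice (H : C(X × unitInterval, Y)) (n : ℕ) : hmap (slice H 1) n = hmap (slice H 0) n := by
  apply CHom.H_ext
  intro x hx
  cases n with
  | zero => exact ⟨0, by rw [map_zero]; exact (sub_eq_zero.2 (cmap_zero_deg _ _ x)).symm⟩
  | succ n =>
    refine ⟨prC H (n + 1) x, ?_⟩
    have hx : dC n x = 0 := hx
    have := prC_homotopy H n x
    rw [hx, map_zero, add_zero] at this
    exact this

lemma hmap_homotopic {f g : C(X, Y)} (hfg : f.Homotopic g) (n : ℕ) : hmap f n = hmap g n := by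
  obtain ⟨H⟩ := hfg
  let H' : C(X × unitInterval, Y) := H.toContinuousMap.comp ContinuousMap.prodSwap
  have h0 : slice H' 0 = f := by ext x; exact H.apply_zero x
  have h1 : slice H' 1 = g := by ext x; exact H.apply_one x
  rw [← h0, ← h1, hmap_slice]

lemma hmap_bij (f : C(X, Y)) (g : C(Y, X)) (h1 : (g.comp f).Homotopic (ContinuousMap.id X))
    (h2 : (f.comp g).Homotopic (ContinuousMap.id Y)) (n : ℕ) : Function.Bijective (hmap f n) := by
  have e1 := hmap_homotopic h1 n
  have e2 := hmap_homotopic h2 n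
  rw [hmap_comp, hmap_id] at e1 e2
  exact ⟨Function.LeftInverse.injective (LinearMap.congr_fun e1),
    Function.RightInverse.surjective (LinearMap.congr_fun e2)⟩

def hequiv (f : C(X, Y)) (g : C(Y, X)) (h1 : (g.comp f).Homotopic (ContinuousMap.id X))
    (h2 : (f.comp g).Homotopic (ContinuousMap.id Y)) (n : ℕ) : h X n ≃ₗ[ℤ] h Y n :=
  LinearEquiv.ofBijective (hmap f n) (hmap_bij f g h1 h2 n)

end sing
end OSH

namespace OSH

/-! ### Mesh of subdivisions -/
abbrev sup' {V : Type} {n : ℕ} (s : Set (Fin n → V)) : Submodule ℤ (E V n) := Finsupp.supported ℤ ℤ s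

lemma map_supported {α β : Type} (f : (α →₀ ℤ) →ₗ[ℤ] (β →₀ ℤ)) (s : Set α) (t : Set β)
    (hf : ∀ a ∈ s, f (Finsupp.single a 1) ∈ Finsupp.supported ℤ ℤ t) (x : α →₀ ℤ)
    (hx : x ∈ Finsupp.supported ℤ ℤ s) : f x ∈ Finsupp.supported ℤ ℤ t := by
  rw [Finsupp.supported_eq_span_single] at hx
  induction hx using Submodule.span_induction with
  | mem x h => obtain ⟨a, ha, rfl⟩ := h; exact hf a ha
  | zero => rw [map_zero]; exact zero_mem _
  | add x y _ _ h1 h2 => rw [map_add]; exact add_mem h1 h2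
  | smul c x _ h1 => rw [map_smul]; exact Submodule.smul_mem _ _ h1

lemma single_sup {α : Type} (s : Set α) (a : α) (ha : a ∈ s) :
    (Finsupp.single a 1 : α →₀ ℤ) ∈ Finsupp.supported ℤ ℤ s := Finsupp.single_mem_supported ℤ _ ha

lemma cone_sup {V : Type} {n : ℕ} (s : Set (Fin n → V)) (t : Set (Fin (n + 1) → V)) (a : V)
    (h : ∀ w ∈ s, Fin.cons (α := fun _ => V) a w ∈ t) (x : E V n) (hx : x ∈ sup' s) :
    cone a x ∈ sup' t :=
  map_supported (cone a) s t (fun w hw => by rw [cone_single]; exact single_sup _ _ (h w hw)) x hx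

lemma dE_sup {V : Type} (S : Set V) : ∀ (n : ℕ) (x : E V (n + 1)),
    x ∈ sup' {w | ∀ i, w i ∈ S} → dE n x ∈ sup' {w | ∀ i, w i ∈ S} := by
  intro n
  induction n with
  | zero =>
    intro x hx
    refine map_supported (dE 0) _ _ (fun w hw => ?_) x hx
    rw [single_eq_cone, dE_cone_zero]
    exact single_sup _ _ (fun i => i.elim0)
  | succ n ih =>
    intro x hx
    refine map_supported (dE (n + 1)) _ _ (fun w hw => ?_) x hx
    rw [single_eq_cone, dE_cone]
    have h1 : (Finsupp.single (Fin.tail w) 1 : E V (n + 1)) ∈ sup' {w | ∀ i, w i ∈ S} :=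
      single_sup _ _ (fun i => hw i.succ)
    refine sub_mem h1 (cone_sup _ _ _ ?_ _ (ih _ h1))
    intro w' hw' i
    refine Fin.cases ?_ (fun j => ?_) i
    · exact hw 0
    · exact hw' j

def hull {k n : ℕ} (w : Fin n → Dl k) : Set (Fin k → ℝ) :=
  convexHull ℝ (Set.range fun i => (w i : Fin k → ℝ))

lemma mem_hull {k n : ℕ} (w : Fin n → Dl k) (i : Fin n) : (w i : Fin k → ℝ) ∈ hull w :=
  subset_convexHull _ _ ⟨i, rfl⟩

lemma aff_hull {k n : ℕ} (w : Fin n → Dl k) (t : Dl n) : (aff w t : Fin k → ℝ) ∈ hull w :=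
  (convex_convexHull ℝ _).sum_mem (fun i _ => t.2.1 i) t.2.2 (fun i _ => mem_hull w i)

lemma bar_coe {k n : ℕ} (w : Fin (n + 1) → Dl k) :
    (bar k n w : Fin k → ℝ) = ∑ i, ((n + 1 : ℝ))⁻¹ • (w i : Fin k → ℝ) := by
  change ∑ i, (stdSimplex.barycenter (𝕜 := ℝ) (X := Fin (n + 1))) i • (w i : Fin k → ℝ) = _
  refine Finset.sum_congr rfl fun i _ => ?_
  congr 1
  change ((Fintype.card (Fin (n + 1)) : ℝ))⁻¹ = _
  simp

lemma bar_dist {k n : ℕ} (w : Fin (n + 1) → Dl k) (D : ℝ)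
    (hD : ∀ i j, dist (w i : Fin k → ℝ) (w j) ≤ D) (j : Fin (n + 1)) :
    dist (w j : Fin k → ℝ) (bar k n w) ≤ (1 - ((n + 1 : ℝ))⁻¹) * D := by
  have hn : (n + 1 : ℝ) ≠ 0 := by positivity
  have e : (w j : Fin k → ℝ) - (bar k n w : Fin k → ℝ)
      = ∑ i, ((n + 1 : ℝ))⁻¹ • ((w j : Fin k → ℝ) - w i) := by
    rw [bar_coe]
    simp only [smul_sub, Finset.sum_sub_distrib, Finset.sum_const, Finset.card_univ, Fintype.card_fin]
    rw [← Nat.cast_smul_eq_nsmul ℝ, smul_smul]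
    push_cast
    rw [mul_inv_cancel₀ hn, one_smul]
  rw [dist_eq_norm, e]
  refine (norm_sum_le _ _).trans ?_
  rw [← Finset.add_sum_erase _ _ (Finset.mem_univ j)]
  simp only [sub_self, smul_zero, norm_zero, zero_add]
  refine (Finset.sum_le_card_nsmul _ _ ((n + 1 : ℝ)⁻¹ * D) (fun i _ => ?_)).trans ?_
  · rw [norm_smul, ← dist_eq_norm, Real.norm_of_nonneg (by positivity)]
    exact mul_le_mul_of_nonneg_left (hD j i) (by positivity)
  · rw [Finset.card_erase_of_mem (Finset.mem_univ _), Finset.card_univ, Fintype.card_fin,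
      nsmul_eq_mul]
    simp only [Nat.add_sub_cancel]
    apply le_of_eq
    field_simp
    ring

def small (k n : ℕ) (D : ℝ) : Set (Fin n → Dl k) :=
  {w | ∀ i j, dist (w i : Fin k → ℝ) (w j : Fin k → ℝ) ≤ D}

lemma sdE_small1 {k N : ℕ} (D : ℝ) (hD : 0 ≤ D) : ∀ (n : ℕ), n ≤ N →
    ∀ (w : Fin n → Dl k), w ∈ small k n D →
    sdE (bar k) n (Finsupp.single w 1) ∈ sup' {w' : Fin n → Dl k | (∀ i, (w' i : Fin k → ℝ) ∈ hull w) ∧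
      w' ∈ small k n ((1 - (N : ℝ)⁻¹) * D)} := by
  intro n
  induction n with
  | zero =>
    intro _ w _
    exact single_sup _ _ ⟨fun i => i.elim0, fun i => i.elim0⟩
  | succ n ih =>
    intro hn w hw
    rw [sdE_single]
    have hb : ∀ y ∈ hull w, dist y (bar k n w : Fin k → ℝ) ≤ (1 - (N : ℝ)⁻¹) * D := by
      intro y hy
      refine convexHull_min (t := Metric.closedBall (bar k n w : Fin k → ℝ) ((1 - (N : ℝ)⁻¹) * D))
        ?_ (convex_closedBall _ _) hy
      rintro _ ⟨j, rfl⟩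
      refine (bar_dist w D hw j).trans ?_
      refine mul_le_mul_of_nonneg_right ?_ hD
      have : (N : ℝ)⁻¹ ≤ ((n + 1 : ℝ))⁻¹ := by
        apply inv_anti₀ (by positivity)
        exact_mod_cast hn
      linarith
    have h1 : dE n (Finsupp.single w 1) ∈ sup' {w' | ∀ i, w' i ∈ Set.range w} :=
      dE_sup _ _ _ (single_sup _ _ (fun i => ⟨i, rfl⟩))
    refine cone_sup {w' : Fin n → Dl k | (∀ i, (w' i : Fin k → ℝ) ∈ hull w) ∧
      w' ∈ small k n ((1 - (N : ℝ)⁻¹) * D)} _ _ ?_ _ ?_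
    · rintro w' ⟨h2, h3⟩
      have h4 : ((bar k n w : Dl k) : Fin k → ℝ) ∈ hull w := aff_hull _ _
      constructor
      · intro i
        refine Fin.cases ?_ (fun i => ?_) i
        · exact h4
        · exact h2 i
      · intro i j
        refine Fin.cases ?_ (fun i => ?_) i <;> refine Fin.cases ?_ (fun j => ?_) j
        · exact hb _ h4
        · simp only [Fin.cons_zero, Fin.cons_succ]; rw [dist_comm]; exact hb _ (h2 j)
        · exact hb _ (h2 i)
        · exact h3 i j
    · refine map_supported (sdE (bar k) n) _ _ ?_ _ h1
      intro w' hw'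
      refine Finsupp.supported_mono ?_ (ih (by omega) w' ?_)
      · rintro w'' ⟨h2, h3⟩
        refine ⟨fun i => ?_, h3⟩
        refine convexHull_mono ?_ (h2 i)
        rintro _ ⟨j, rfl⟩
        obtain ⟨i', h⟩ := hw' j
        exact ⟨i', congrArg Subtype.val h⟩
      · intro i j
        obtain ⟨i', h⟩ := hw' i
        obtain ⟨j', h'⟩ := hw' j
        rw [← h, ← h']
        exact hw i' j'

lemma sdE_small {k n : ℕ} (hn : 1 ≤ n) (D : ℝ) (hD : 0 ≤ D) (x : E (Dl k) n)
    (hx : x ∈ sup' (small k n D)) (m : ℕ) :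
    (sdE (bar k) n)^[m] x ∈ sup' (small k n ((1 - (n : ℝ)⁻¹) ^ m * D)) := by
  induction m with
  | zero => simpa using hx
  | succ m ih =>
    rw [Function.iterate_succ_apply']
    refine map_supported (sdE (bar k) n) _ _ ?_ _ ih
    intro w hw
    have h1 : (n : ℝ)⁻¹ ≤ 1 := by
      apply inv_le_one_of_one_le₀; exact_mod_cast hn
    refine Finsupp.supported_mono ?_ (sdE_small1 _ (by
      have : 0 ≤ 1 - (n : ℝ)⁻¹ := by linarith
      positivity) n le_rfl w hw)
    rintro w' ⟨_, h⟩
    rw [pow_succ', mul_assoc]; exact h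

section sing
variable {X : Type} [TopologicalSpace X]

abbrev sml (U V : Set X) (n : ℕ) : Submodule ℤ (Ch X n) :=
  Finsupp.supported ℤ ℤ {σ | (∀ t, σ t ∈ U) ∨ ∀ t, σ t ∈ V}

lemma real_sml (U V : Set X) {k n : ℕ} (σ : C(Dl k, X)) (hσ : (∀ t, σ t ∈ U) ∨ ∀ t, σ t ∈ V)
    (x : E (Dl k) n) : real σ x ∈ sml U V n := by
  refine map_supported (real σ) Set.univ _ ?_ x (by simp)
  intro w _
  rw [real_single]
  exact single_sup _ _ (hσ.imp (fun h t => h _) (fun h t => h _))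

lemma hat_sml (U V : Set X) {n m : ℕ} (φ : NatOp n m) (x : Ch X n) (hx : x ∈ sml U V n) :
    φ.hat x ∈ sml U V m := by
  refine map_supported φ.hat _ _ ?_ x hx
  intro σ hσ
  rw [NatOp.hat_single]
  exact real_sml U V σ hσ _

lemma sd_iter_real {k n : ℕ} (σ : C(Dl k, X)) (x : E (Dl k) n) (m : ℕ) :
    (sd n)^[m] (real σ x) = real σ ((sdE (bar k) n)^[m] x) := by
  induction m with
  | zero => rfl
  | succ m ih => rw [Function.iterate_succ_apply', Function.iterate_succ_apply', ih, sd_real]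

lemma sd_iter_sml (U V : Set X) {n : ℕ} (x : Ch X n) (hx : x ∈ sml U V n) (m : ℕ) :
    (sd n)^[m] x ∈ sml U V n := by
  induction m with
  | zero => exact hx
  | succ m ih => rw [Function.iterate_succ_apply']; exact hat_sml U V _ _ ih

lemma exists_sml_single (U V : Set X) (hU : IsOpen U) (hV : IsOpen V) (hUV : U ∪ V = Set.univ) {n : ℕ}
    (σ : C(Dl n, X)) : ∃ m, (sd n)^[m] (Finsupp.single σ 1) ∈ sml U V n := by
  rcases Nat.eq_zero_or_pos n with rfl | hn
  · refine ⟨0, single_sup _ _ (Or.inl fun t => ?_)⟩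
    exfalso
    have := t.2.2
    simp at this
  let c : Bool → Set (Dl n) := fun b => if b then σ ⁻¹' U else σ ⁻¹' V
  obtain ⟨δ, hδ, hc⟩ := lebesgue_number_lemma_of_metric (s := (Set.univ : Set (Dl n))) (c := c)
    isCompact_univ (by
      intro b; cases b
      · exact hV.preimage σ.continuous
      · exact hU.preimage σ.continuous) (by
      intro t _
      have : σ t ∈ U ∪ V := by rw [hUV]; trivial
      rcases this with h | h
      · exact Set.mem_iUnion.2 ⟨true, h⟩
      · exact Set.mem_iUnion.2 ⟨false, h⟩)
  let D : ℝ := Metric.diam (Set.univ : Set (Dl n))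
  have hv : (Finsupp.single (vert n) 1 : E (Dl n) n) ∈ sup' (small n n D) := by
    refine single_sup _ _ fun i j => ?_
    exact Metric.dist_le_diam_of_mem (isCompact_univ.isBounded) (Set.mem_univ (vert n i))
      (Set.mem_univ (vert n j))
  have h1 : (n : ℝ)⁻¹ ≤ 1 := by
    apply inv_le_one_of_one_le₀; exact_mod_cast hn
  have h2 : (0 : ℝ) < (n : ℝ)⁻¹ := by positivity
  have h3 : Filter.Tendsto (fun m : ℕ => (1 - (n : ℝ)⁻¹) ^ m * D) Filter.atTop (nhds (0 * D)) :=
    (tendsto_pow_atTop_nhds_zero_of_lt_one (by linarith) (by linarith)).mul_const D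
  rw [zero_mul] at h3
  obtain ⟨m, hm⟩ := (h3.eventually (gt_mem_nhds hδ)).exists
  refine ⟨m, ?_⟩
  rw [← real_vert, sd_iter_real]
  refine map_supported (real σ) _ _ ?_ _ (sdE_small hn D Metric.diam_nonneg _ hv m)
  intro w hw
  rw [real_single]
  refine single_sup _ _ ?_
  obtain ⟨b, hb⟩ := hc (w ⟨0, hn⟩) trivial
  have h4 : ∀ t, aff w t ∈ c b := by
    intro t
    apply hb
    refine lt_of_le_of_lt ?_ hm
    refine convexHull_min (t := Metric.closedBall (w ⟨0, hn⟩ : Fin n → ℝ) ((1 - (n : ℝ)⁻¹) ^ m * D))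
        ?_ (convex_closedBall _ _) (aff_hull w t)
    rintro _ ⟨j, rfl⟩
    exact hw j _
  cases b
  · exact Or.inr h4
  · exact Or.inl h4

lemma sd_iter_add {n : ℕ} (x y : Ch X n) (m : ℕ) : (sd n)^[m] (x + y) = (sd n)^[m] x + (sd n)^[m] y := by
  induction m generalizing x y with
  | zero => rfl
  | succ m ih => simp only [Function.iterate_succ_apply, map_add, ih]

lemma sd_iter_smul {n : ℕ} (c : ℤ) (x : Ch X n) (m : ℕ) : (sd n)^[m] (c • x) = c • (sd n)^[m] x := by
  induction m generalizing x with
  | zero => rfl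
  | succ m ih => simp only [Function.iterate_succ_apply, map_smul, ih]

lemma exists_sml (U V : Set X) (hU : IsOpen U) (hV : IsOpen V) (hUV : U ∪ V = Set.univ) {n : ℕ}
    (x : Ch X n) : ∃ m, (sd n)^[m] x ∈ sml U V n := by
  induction x using Finsupp.induction_linear with
  | zero =>
    exact ⟨0, zero_mem _⟩
  | add x y hx hy =>
    obtain ⟨m1, h1⟩ := hx
    obtain ⟨m2, h2⟩ := hy
    refine ⟨m1 + m2, ?_⟩
    rw [sd_iter_add]
    refine add_mem ?_ ?_
    · rw [add_comm, Function.iterate_add_apply]; exact sd_iter_sml _ _ _ h1 _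
    · rw [Function.iterate_add_apply]; exact sd_iter_sml _ _ _ h2 _
  | single σ c =>
    obtain ⟨m, h⟩ := exists_sml_single U V hU hV hUV σ
    refine ⟨m, ?_⟩
    rw [show (Finsupp.single σ c : Ch X n) = c • Finsupp.single σ 1 by simp, sd_iter_smul]
    exact Submodule.smul_mem _ _ h

lemma sd_iter_mem_Z {n : ℕ} (x : Ch X n) (hx : x ∈ (sing X).Z n) (m : ℕ) :
    (sd n)^[m] x ∈ (sing X).Z n := by
  induction m with
  | zero => exact hx
  | succ m ih =>
    rw [Function.iterate_succ_apply']
    cases n with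
    | zero => trivial
    | succ n =>
      change dC n _ = 0
      rw [dC_sd, show dC n _ = 0 from ih, map_zero]

lemma sd_iter_homologous (U V : Set X) {n : ℕ} (x : Ch X n) (hx : x ∈ (sing X).Z n) (m : ℕ) :
    ∃ y : Ch X (n + 1), dC n y = x - (sd n)^[m] x ∧ (x ∈ sml U V n → y ∈ sml U V (n + 1)) := by
  induction m with
  | zero => exact ⟨0, by simp, fun _ => zero_mem _⟩
  | succ m ih =>
    obtain ⟨y, hy, hs⟩ := ih
    refine ⟨y + tC n ((sd n)^[m] x), ?_, fun h => add_mem (hs h) (hat_sml U V _ _ (sd_iter_sml U V x h m))⟩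
    have h1 : dC n (tC n ((sd n)^[m] x)) = (sd n)^[m] x - sd n ((sd n)^[m] x) := by
      have h2 := sd_iter_mem_Z x hx m
      cases n with
      | zero => exact tC_homotopy_zero _
      | succ n =>
        rw [← tC_homotopy, show dC n _ = 0 from h2, map_zero, add_zero]
    rw [map_add, hy, h1, Function.iterate_succ_apply']
    abel

lemma dC_sd_iter {n : ℕ} (x : Ch X (n + 1)) (m : ℕ) :
    dC n ((sd (n + 1))^[m] x) = (sd n)^[m] (dC n x) := by
  induction m with
  | zero => rfl
  | succ m ih => rw [Function.iterate_succ_apply', Function.iterate_succ_apply', dC_sd, ih]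

/-- every cycle is homologous to a small one -/
lemma small_rep (U V : Set X) (hU : IsOpen U) (hV : IsOpen V) (hUV : U ∪ V = Set.univ) {n : ℕ}
    (x : Ch X n) (hx : x ∈ (sing X).Z n) :
    ∃ x' ∈ sml U V n, x' ∈ (sing X).Z n ∧ ∃ y, dC n y = x - x' := by
  obtain ⟨m, hm⟩ := exists_sml U V hU hV hUV x
  obtain ⟨y, hy, _⟩ := sd_iter_homologous U V x hx m
  exact ⟨_, hm, sd_iter_mem_Z x hx m, y, hy⟩

lemma small_bdry (U V : Set X) (hU : IsOpen U) (hV : IsOpen V) (hUV : U ∪ V = Set.univ) {n : ℕ}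
    (x : Ch X n) (hs : x ∈ sml U V n) (y : Ch X (n + 1)) (hy : dC n y = x) :
    ∃ y' ∈ sml U V (n + 1), dC n y' = x := by
  have hx : x ∈ (sing X).Z n := hy ▸ (sing X).d_mem n y
  obtain ⟨m, hm⟩ := exists_sml U V hU hV hUV y
  obtain ⟨e, he, hes⟩ := sd_iter_homologous U V x hx m
  refine ⟨_, add_mem (hes hs) hm, ?_⟩
  rw [map_add, he, dC_sd_iter, hy]
  abel

end sing
end OSH

namespace OSH

/-! ### Cycles and classes -/
section cyc
variable {X Y : Type} [TopologicalSpace X] [TopologicalSpace Y]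
def Cyc {n : ℕ} (x : Ch X n) : Prop := x ∈ (sing X).Z n
def kl {n : ℕ} (x : Ch X n) (hx : Cyc x) : h X n := (sing X).cl x hx

lemma Cyc.add {n : ℕ} {x y : Ch X n} (hx : Cyc x) (hy : Cyc y) : Cyc (x + y) :=
  ((sing X).Z n).add_mem hx hy
lemma Cyc.sub {n : ℕ} {x y : Ch X n} (hx : Cyc x) (hy : Cyc y) : Cyc (x - y) :=
  ((sing X).Z n).sub_mem hx hy
lemma Cyc.smul {n : ℕ} {x : Ch X n} (c : ℤ) (hx : Cyc x) : Cyc (c • x) := by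
  have := ((sing X).Z n).smul_mem c hx
  exact this
lemma Cyc.zero {n : ℕ} : Cyc (0 : Ch X n) := ((sing X).Z n).zero_mem
lemma Cyc.d {n : ℕ} (x : Ch X (n + 1)) : Cyc (dC n x) := (sing X).d_mem n x
lemma Cyc.map (f : C(X, Y)) {n : ℕ} {x : Ch X n} (hx : Cyc x) : Cyc (cmap f x) := (smap f).mem_Z hx
lemma Cyc.mk {n : ℕ} {x : Ch X (n + 1)} (hx : dC n x = 0) : Cyc x := hx
lemma Cyc.d_eq {n : ℕ} {x : Ch X (n + 1)} (hx : Cyc x) : dC n x = 0 := hx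
lemma Cyc.zero_deg (x : Ch X 0) : Cyc x := trivial

lemma kl_eq_zero {n : ℕ} {x : Ch X n} {hx : Cyc x} : kl x hx = 0 ↔ ∃ y, dC n y = x :=
  Cx.cl_eq_zero _ _ _
lemma kl_eq_kl {n : ℕ} {x x' : Ch X n} {hx : Cyc x} {hx' : Cyc x'} :
    kl x hx = kl x' hx' ↔ ∃ y, dC n y = x - x' := Cx.cl_eq_cl _
lemma kl_surj {n : ℕ} (a : h X n) : ∃ x hx, kl x hx = a := Cx.cl_surj _ a
lemma kl_add {n : ℕ} (x y : Ch X n) (hx : Cyc x) (hy : Cyc y) :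
    kl x hx + kl y hy = kl (x + y) (hx.add hy) := rfl
lemma kl_smul {n : ℕ} (c : ℤ) (x : Ch X n) (hx : Cyc x) :
    c • kl x hx = kl (c • x) (hx.smul c) := rfl
lemma hmap_kl (f : C(X, Y)) {n : ℕ} (x : Ch X n) (hx : Cyc x) :
    hmap f n (kl x hx) = kl (cmap f x) (hx.map f) := rfl
lemma kl_congr {n : ℕ} {x y : Ch X n} (hxy : x = y) (hx : Cyc x) : kl x hx = kl y (hxy ▸ hx) := by
  subst hxy; rfl
end cyc

/-! ### Mayer-Vietoris -/
section mv
variable {X Y : Type} [TopologicalSpace X] [TopologicalSpace Y]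

def res (f : C(X, Y)) {U : Set X} {V : Set Y} (hf : Set.MapsTo f U V) : C(U, V) :=
  ⟨hf.restrict, f.continuous.restrict hf⟩

def inc {U V : Set X} (hUV : U ⊆ V) : C(U, V) := res (ContinuousMap.id X) hUV

lemma cmap_inj {A B : Type} [TopologicalSpace A] [TopologicalSpace B] (f : C(A, B))
    (hf : Function.Injective f) {n : ℕ} {x y : Ch A n} (h : cmap f x = cmap f y) : x = y := by
  refine Finsupp.mapDomain_injective ?_ h
  intro σ τ hh
  exact ContinuousMap.ext fun t => hf (DFunLike.congr_fun hh t)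

lemma inc_inj {U V : Set X} (hUV : U ⊆ V) : Function.Injective (inc hUV) := by
  intro x y hxy
  exact Subtype.ext (congrArg (fun a : V => (a : X)) hxy)

lemma cmap_inc_mem {U V : Set X} (hUV : U ⊆ V) {n : ℕ} (x : Ch V n) :
    (∃ a, cmap (inc hUV) a = x) ↔
      x ∈ Finsupp.supported ℤ ℤ {σ : C(Dl n, V) | ∀ t, (σ t : X) ∈ U} := by
  have : LinearMap.range (cmap (inc hUV) (n := n)) =
      Finsupp.supported ℤ ℤ {σ : C(Dl n, V) | ∀ t, (σ t : X) ∈ U} := by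
    rw [← Submodule.map_top, ← Finsupp.supported_univ, cmap, Finsupp.lmapDomain_supported,
      Set.image_univ]
    congr 1
    ext σ
    constructor
    · rintro ⟨τ, rfl⟩ t
      exact (τ t).2
    · intro hσ
      exact ⟨⟨fun t => ⟨σ t, hσ t⟩, by fun_prop⟩, rfl⟩
  rw [← this]; rfl

variable (U V : Set X)
abbrev jU : C(U, ↥(U ∪ V)) := inc Set.subset_union_left
abbrev jV : C(V, ↥(U ∪ V)) := inc Set.subset_union_right
abbrev kU : C(↥(U ∩ V), U) := inc Set.inter_subset_left
abbrev kV : C(↥(U ∩ V), V) := inc Set.inter_subset_right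

lemma jk {n : ℕ} (c : Ch ↥(U ∩ V) n) : cmap (jU U V) (cmap (kU U V) c) = cmap (jV U V) (cmap (kV U V) c) := by
  rw [← cmap_comp, ← cmap_comp]; rfl

lemma dC_cmap {A B : Type} [TopologicalSpace A] [TopologicalSpace B] (f : C(A, B)) {n : ℕ} (x : Ch A (n + 1)) :
    dC n (cmap f x) = cmap f (dC n x) := hat_cmap f (dOp n) x

lemma chain_exact {n : ℕ} (a : Ch U n) (b : Ch V n) (hab : cmap (jU U V) a + cmap (jV U V) b = 0) :
    ∃ c, cmap (kU U V) c = a ∧ cmap (kV U V) c = -b := by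
  have h1 := (cmap_inc_mem (Set.subset_union_left (s := U) (t := V)) (n := n) _).1 ⟨a, rfl⟩
  have h2 := (cmap_inc_mem (Set.subset_union_right (s := U) (t := V)) (n := n) _).1 ⟨-b, rfl⟩
  have e : cmap (jV U V) (-b) = cmap (jU U V) a := by
    rw [map_neg]; exact (eq_neg_of_add_eq_zero_left hab).symm
  rw [e] at h2
  have h3 : cmap (jU U V) a ∈ Finsupp.supported ℤ ℤ {σ : C(Dl n, ↥(U ∪ V)) | ∀ t, (σ t : X) ∈ U ∩ V} := by
    have : {σ : C(Dl n, ↥(U ∪ V)) | ∀ t, (σ t : X) ∈ U ∩ V} =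
      {σ : C(Dl n, ↥(U ∪ V)) | ∀ t, (σ t : X) ∈ U} ∩ {σ : C(Dl n, ↥(U ∪ V)) | ∀ t, (σ t : X) ∈ V} := by
      ext σ; exact forall_and
    rw [this, Finsupp.supported_inter]
    exact ⟨h1, h2⟩
  obtain ⟨c, hc⟩ := (cmap_inc_mem (fun x hx => Or.inl hx.1 : U ∩ V ⊆ U ∪ V) _).2 h3
  refine ⟨c, ?_, ?_⟩
  · apply cmap_inj (jU U V) (inc_inj _)
    rw [← hc, ← cmap_comp]; rfl
  · apply cmap_inj (jV U V) (inc_inj _)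
    rw [e, ← hc, ← cmap_comp]; rfl

lemma sml_decomp {n : ℕ} (x : Ch ↥(U ∪ V) n)
    (hx : x ∈ sml (Subtype.val ⁻¹' U) (Subtype.val ⁻¹' V) n) :
    ∃ a b, x = cmap (jU U V) a + cmap (jV U V) b := by
  have h : x ∈ Finsupp.supported ℤ ℤ ({σ : C(Dl n, ↥(U ∪ V)) | ∀ t, (σ t : X) ∈ U} ∪
      {σ : C(Dl n, ↥(U ∪ V)) | ∀ t, (σ t : X) ∈ V}) := hx
  rw [Finsupp.supported_union, Submodule.mem_sup] at h
  obtain ⟨y, hy, w, hw, rfl⟩ := h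
  obtain ⟨a, rfl⟩ := (cmap_inc_mem Set.subset_union_left _).2 hy
  obtain ⟨b, rfl⟩ := (cmap_inc_mem Set.subset_union_right _).2 hw
  exact ⟨a, b, rfl⟩

lemma decomp_sml {n : ℕ} (a : Ch U n) (b : Ch V n) :
    cmap (jU U V) a + cmap (jV U V) b ∈ sml (Subtype.val ⁻¹' U) (Subtype.val ⁻¹' V) n := by
  refine add_mem ?_ ?_
  · exact Finsupp.supported_mono Set.subset_union_left ((cmap_inc_mem _ _).1 ⟨a, rfl⟩)
  · exact Finsupp.supported_mono Set.subset_union_right ((cmap_inc_mem _ _).1 ⟨b, rfl⟩)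

variable {U V} (hU : IsOpen U) (hV : IsOpen V)

lemma cov : (Subtype.val ⁻¹' U : Set ↥(U ∪ V)) ∪ Subtype.val ⁻¹' V = Set.univ :=
  Set.eq_univ_of_forall fun x => x.2

lemma rep_decomp {n : ℕ} (x : h ↥(U ∪ V) n) (hU : IsOpen U) (hV : IsOpen V) :
    ∃ a b hx, x = kl (cmap (jU U V) a + cmap (jV U V) b) hx := by
  obtain ⟨x, hx, rfl⟩ := kl_surj x
  obtain ⟨x', hs, hz, y, hy⟩ := small_rep (X := ↥(U ∪ V)) _ _ (hU.preimage continuous_subtype_val)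
    (hV.preimage continuous_subtype_val) cov x hx
  obtain ⟨a, b, rfl⟩ := sml_decomp U V x' hs
  exact ⟨a, b, hz, kl_eq_kl.2 ⟨y, hy⟩⟩

lemma bdry_decomp {n : ℕ} (a : Ch U n) (b : Ch V n) (e : Ch ↥(U ∪ V) (n + 1))
    (he : dC n e = cmap (jU U V) a + cmap (jV U V) b) (hU : IsOpen U) (hV : IsOpen V) :
    ∃ (e1 : Ch U (n + 1)) (e2 : Ch V (n + 1)) (f : Ch ↥(U ∩ V) n),
      cmap (kU U V) f = a - dC n e1 ∧ cmap (kV U V) f = -(b - dC n e2) := by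
  obtain ⟨e', hs, he'⟩ := small_bdry (X := ↥(U ∪ V)) _ _ (hU.preimage continuous_subtype_val)
    (hV.preimage continuous_subtype_val) cov _ (decomp_sml U V a b) e he
  obtain ⟨e1, e2, rfl⟩ := sml_decomp U V e' hs
  obtain ⟨f, h1, h2⟩ := chain_exact U V (a - dC n e1) (b - dC n e2) (by
    rw [map_add, dC_cmap, dC_cmap] at he'
    rw [map_sub, map_sub, sub_add_sub_comm, ← he', sub_self])
  exact ⟨e1, e2, f, h1, h2⟩

lemma mem_Z_of_inj {A B : Type} [TopologicalSpace A] [TopologicalSpace B] (f : C(A, B))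
    (hf : Function.Injective f) {n : ℕ} (x : Ch A n) (hx : Cyc (cmap f x)) : Cyc (x) := by
  cases n with
  | zero => trivial
  | succ n =>
    change dC n x = 0
    apply cmap_inj f hf
    rw [← dC_cmap, map_zero]; exact hx

/-- exactness at the middle term -/
lemma mv_mid {n : ℕ} (x : h U n) (y : h V n) (hxy : hmap (jU U V) n x + hmap (jV U V) n y = 0)
    (hU : IsOpen U) (hV : IsOpen V) :
    ∃ c, hmap (kU U V) n c = x ∧ hmap (kV U V) n c = -y := by
  obtain ⟨a, ha, rfl⟩ := kl_surj x
  obtain ⟨b, hb, rfl⟩ := kl_surj y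
  rw [hmap_kl, hmap_kl, kl_add, kl_eq_zero] at hxy
  obtain ⟨e, he⟩ := hxy
  obtain ⟨e1, e2, f, h1, h2⟩ := bdry_decomp a b e he hU hV
  have hf : Cyc (f) := mem_Z_of_inj (kU U V) (inc_inj _) f (by
    rw [h1]; exact Cyc.sub ha (Cyc.d _))
  refine ⟨kl f hf, ?_, ?_⟩
  · rw [hmap_kl, kl_eq_kl]
    refine ⟨-e1, ?_⟩
    rw [h1, map_neg]; exact (sub_sub_cancel_left _ _).symm
  · rw [hmap_kl, ← sub_eq_zero, sub_neg_eq_add, kl_add, kl_eq_zero]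
    refine ⟨e2, ?_⟩
    rw [h2]
    change _ = -((b : Ch V n) - dC n e2) + b
    rw [neg_sub, sub_add_cancel]

lemma mv_zero (hU : IsOpen U) (hV : IsOpen V) (w : h ↥(U ∪ V) 0) :
    ∃ a b, w = hmap (jU U V) 0 a + hmap (jV U V) 0 b := by
  obtain ⟨a, b, hx, rfl⟩ := rep_decomp w hU hV
  exact ⟨kl a trivial, kl b trivial, rfl⟩

def Rel (U V : Set X) (n : ℕ) (x : h ↥(U ∪ V) (n + 1)) (y : h ↥(U ∩ V) n) : Prop :=
  ∃ (a : Ch U (n + 1)) (b : Ch V (n + 1)) (c : Ch ↥(U ∩ V) n) (hx : _) (hc : _),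
    dC n a = cmap (kU U V) c ∧ dC n b = -cmap (kV U V) c ∧
    x = kl (cmap (jU U V) a + cmap (jV U V) b) hx ∧ y = kl c hc

lemma Rel_add {n : ℕ} {x x' : h ↥(U ∪ V) (n + 1)} {y y' : h ↥(U ∩ V) n} :
    Rel U V n x y → Rel U V n x' y' → Rel U V n (x + x') (y + y') := by
  rintro ⟨a, b, c, hx, hc, h1, h2, rfl, rfl⟩ ⟨a', b', c', hx', hc', h1', h2', rfl, rfl⟩
  refine ⟨a + a', b + b', c + c', ?_, hc.add hc', ?_, ?_, ?_, ?_⟩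
  · have := hx.add hx'
    rw [map_add, map_add, add_add_add_comm]
    exact this
  · simp only [map_add, h1, h1']
  · simp only [map_add, h2, h2']; abel
  · rw [kl_add]; congr 1
    simp only [map_add]
    exact add_add_add_comm _ _ _ _
  · rfl

lemma Rel_smul {n : ℕ} (m : ℤ) {x : h ↥(U ∪ V) (n + 1)} {y : h ↥(U ∩ V) n} :
    Rel U V n x y → Rel U V n (m • x) (m • y) := by
  rintro ⟨a, b, c, hx, hc, h1, h2, rfl, rfl⟩
  refine ⟨m • a, m • b, m • c, ?_, hc.smul m, ?_, ?_, ?_, ?_⟩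
  · have := hx.smul m
    rw [map_smul, map_smul, ← smul_add]
    exact this
  · simp only [map_smul, h1]
  · simp only [map_smul, h2, smul_neg]
  · rw [kl_smul]; congr 1
    simp only [map_smul, ← smul_add]
  · rw [kl_smul]

lemma Rel_total (hU : IsOpen U) (hV : IsOpen V) {n : ℕ} (x : h ↥(U ∪ V) (n + 1)) : ∃ y, Rel U V n x y := by
  obtain ⟨a, b, hx, rfl⟩ := rep_decomp x hU hV
  have hx' : dC n (cmap (jU U V) a + cmap (jV U V) b) = 0 := hx
  rw [map_add, dC_cmap, dC_cmap] at hx'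
  obtain ⟨c, h1, h2⟩ := chain_exact U V _ _ hx'
  have hc : Cyc (c) := mem_Z_of_inj (kU U V) (inc_inj _) c (by
    rw [h1]; exact Cyc.d _)
  exact ⟨kl c hc, a, b, c, hx, hc, h1.symm, by rw [h2, neg_neg], rfl, rfl⟩

lemma Rel_zero (hU : IsOpen U) (hV : IsOpen V) {n : ℕ} {y : h ↥(U ∩ V) n} (hy : Rel U V n 0 y) : y = 0 := by
  obtain ⟨a, b, c, hx, hc, h1, h2, h3, rfl⟩ := hy
  obtain ⟨e, he⟩ := (kl_eq_zero).1 h3.symm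
  obtain ⟨e1, e2, f, h4, h5⟩ := bdry_decomp a b e he hU hV
  rw [kl_eq_zero]
  refine ⟨f, ?_⟩
  apply cmap_inj (kU U V) (inc_inj _)
  rw [← h1]
  rw [← dC_cmap, h4, map_sub, dC_dC, sub_zero]

lemma Rel_unique (hU : IsOpen U) (hV : IsOpen V) {n : ℕ} {x : h ↥(U ∪ V) (n + 1)} {y y' : h ↥(U ∩ V) n}
    (hy : Rel U V n x y) (hy' : Rel U V n x y') : y = y' := by
  have := Rel_add hy (Rel_smul (-1) hy')
  rw [neg_one_smul, neg_one_smul, add_neg_cancel] at this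
  exact add_neg_eq_zero.1 (Rel_zero hU hV this)

def delta (hU : IsOpen U) (hV : IsOpen V) (n : ℕ) : h ↥(U ∪ V) (n + 1) →ₗ[ℤ] h ↥(U ∩ V) n where
  toFun x := (Rel_total hU hV x).choose
  map_add' x y := Rel_unique hU hV (Rel_total hU hV (x + y)).choose_spec
    (Rel_add (Rel_total hU hV x).choose_spec (Rel_total hU hV y).choose_spec)
  map_smul' m x := Rel_unique hU hV (Rel_total hU hV (m • x)).choose_spec
    (Rel_smul m (Rel_total hU hV x).choose_spec)

lemma delta_spec (hU : IsOpen U) (hV : IsOpen V) {n : ℕ} (x : h ↥(U ∪ V) (n + 1)) :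
    Rel U V n x (delta hU hV n x) := (Rel_total hU hV x).choose_spec

lemma delta_eq (hU : IsOpen U) (hV : IsOpen V) {n : ℕ} {x : h ↥(U ∪ V) (n + 1)} {y : h ↥(U ∩ V) n}
    (hxy : Rel U V n x y) : delta hU hV n x = y := Rel_unique hU hV (delta_spec hU hV x) hxy

lemma mv_top (hU : IsOpen U) (hV : IsOpen V) {n : ℕ} (x : h ↥(U ∪ V) (n + 1)) (hx : delta hU hV n x = 0) :
    ∃ a b, x = hmap (jU U V) _ a + hmap (jV U V) _ b := by
  obtain ⟨a, b, c, hx', hc, h1, h2, rfl, h3⟩ := delta_spec hU hV x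
  rw [hx] at h3
  obtain ⟨f, hf⟩ := (kl_eq_zero).1 h3.symm
  have hf : dC n f = c := hf
  have ha : Cyc (a - cmap (kU U V) f) := by
    change dC n (a - cmap (kU U V) f) = 0
    rw [map_sub, dC_cmap, h1, hf, sub_self]
  have hb : Cyc (b + cmap (kV U V) f) := by
    change dC n (b + cmap (kV U V) f) = 0
    rw [map_add, dC_cmap, h2, hf, neg_add_cancel]
  refine ⟨kl (a - cmap (kU U V) f : Ch U (n + 1)) ha,
    kl (b + cmap (kV U V) f : Ch V (n + 1)) hb, ?_⟩
  rw [hmap_kl, hmap_kl, kl_add]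
  congr 1
  simp only [map_sub, map_add]
  rw [jk]
  abel

lemma mv_top' (hU : IsOpen U) (hV : IsOpen V) {n : ℕ} (a : h U (n + 1)) (b : h V (n + 1)) :
    delta hU hV n (hmap (jU U V) _ a + hmap (jV U V) _ b) = 0 := by
  obtain ⟨a, ha, rfl⟩ := kl_surj a
  obtain ⟨b, hb, rfl⟩ := kl_surj b
  apply delta_eq
  refine ⟨a, b, 0, ?_, Cyc.zero, ?_, ?_, ?_, rfl⟩
  · exact Cyc.add (Cyc.map _ ha) (Cyc.map _ hb)
  · rw [map_zero]; exact ha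
  · rw [map_zero, neg_zero]; exact hb
  · rfl

lemma mv_bot (hU : IsOpen U) (hV : IsOpen V) {n : ℕ} (c : h ↥(U ∩ V) n)
    (h1 : hmap (kU U V) n c = 0) (h2 : hmap (kV U V) n c = 0) : ∃ x, delta hU hV n x = c := by
  obtain ⟨c, hc, rfl⟩ := kl_surj c
  rw [hmap_kl, kl_eq_zero] at h1 h2
  obtain ⟨a, ha⟩ := h1
  obtain ⟨b, hb⟩ := h2
  have ha : dC n a = cmap (kU U V) c := ha
  have hb : dC n b = cmap (kV U V) c := hb
  have hx : Cyc (cmap (jU U V) a + cmap (jV U V) (-b)) := by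
    change dC n _ = 0
    rw [map_add, map_neg, map_neg, dC_cmap, dC_cmap, ha, hb, jk, add_neg_cancel]
  refine ⟨kl _ hx, delta_eq hU hV ⟨a, -b, c, hx, hc, ha, ?_, rfl, rfl⟩⟩
  rw [map_neg, hb]

lemma mv_bot' (hU : IsOpen U) (hV : IsOpen V) {n : ℕ} (x : h ↥(U ∪ V) (n + 1)) :
    hmap (kU U V) n (delta hU hV n x) = 0 ∧ hmap (kV U V) n (delta hU hV n x) = 0 := by
  obtain ⟨a, b, c, hx', hc, h1, h2, h3, h4⟩ := delta_spec hU hV x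
  rw [h4, hmap_kl, hmap_kl, kl_eq_zero, kl_eq_zero]
  exact ⟨⟨a, h1⟩, ⟨-b, by rw [map_neg]; exact (neg_eq_iff_eq_neg.2 h2)⟩⟩

lemma hmap_jk {n : ℕ} (c : h ↥(U ∩ V) n) :
    hmap (jU U V) n (hmap (kU U V) n c) = hmap (jV U V) n (hmap (kV U V) n c) := by
  rw [← LinearMap.comp_apply, ← LinearMap.comp_apply, ← hmap_comp, ← hmap_comp]; rfl

lemma delta_nat {U' V' : Set Y} (hU : IsOpen U) (hV : IsOpen V) (hU' : IsOpen U') (hV' : IsOpen V')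
    (f : C(X, Y)) (fU : Set.MapsTo f U U') (fV : Set.MapsTo f V V') {n : ℕ} (x : h ↥(U ∪ V) (n + 1)) :
    delta hU' hV' n (hmap (res f (fU.union_union fV)) _ x) =
      hmap (res f (fU.inter_inter fV)) _ (delta hU hV n x) := by
  apply delta_eq
  obtain ⟨a, b, c, hx', hc, h1, h2, h3, h4⟩ := delta_spec hU hV x
  rw [h4, h3]
  refine ⟨cmap (res f fU) a, cmap (res f fV) b, cmap (res f (fU.inter_inter fV)) c, ?_,
    Cyc.map _ hc, ?_, ?_, ?_, rfl⟩
  · have := hx'.map (res f (fU.union_union fV))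
    have e : cmap (res f (fU.union_union fV)) (cmap (jU U V) a + cmap (jV U V) b) =
      cmap (jU U' V') (cmap (res f fU) a) + cmap (jV U' V') (cmap (res f fV) b) := by
      rw [map_add, ← cmap_comp, ← cmap_comp, ← cmap_comp, ← cmap_comp]; rfl
    rw [← e]; exact this
  · rw [dC_cmap, h1, ← cmap_comp, ← cmap_comp]; rfl
  · rw [dC_cmap, h2, map_neg, ← cmap_comp, ← cmap_comp]; rfl
  · rw [hmap_kl]
    congr 1
    rw [map_add, ← cmap_comp, ← cmap_comp, ← cmap_comp, ← cmap_comp]; rfl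

end mv
end OSH

namespace OSH

/-! ### Bridge to the categorical singular homology -/
lemma dE_single {V : Type} : ∀ (n : ℕ) (w : Fin (n + 1) → V),
    dE n (Finsupp.single w 1) =
      ∑ i : Fin (n + 1), (-1 : ℤ) ^ (i : ℕ) • (Finsupp.single (w ∘ i.succAbove) 1 : E V n) := by
  intro n
  induction n with
  | zero =>
    intro w
    rw [single_eq_cone, dE_cone_zero]
    simp
  | succ n ih =>
    intro w
    rw [single_eq_cone, dE_cone, ih, map_sum, Fin.sum_univ_succ (n := n + 1), sub_eq_add_neg]
    congr 1
    · simp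
      congr 1
    · rw [← Finset.sum_neg_distrib]
      refine Finset.sum_congr rfl fun i _ => ?_
      rw [map_smul, cone_single, Fin.val_succ, pow_succ, mul_neg_one, neg_smul]
      congr 3
      funext k
      refine Fin.cases ?_ (fun j => ?_) k
      · simp
      · simp [Fin.tail]

lemma map_eq_aff {n : ℕ} (i : Fin (n + 1)) (t : Dl n) :
    stdSimplex.map i.succAbove t = aff (vert (n + 1) ∘ i.succAbove) t := by
  apply Subtype.ext
  funext j
  change (stdSimplex.map i.succAbove t : Fin (n + 1) → ℝ) j = (aff _ t : Fin (n + 1) → ℝ) j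
  rw [aff_coe]
  simp [stdSimplex.map_coe, FunOnFinite.linearMap_apply_apply, vert, stdSimplex.vertex_coe, Pi.single_apply, Finset.sum_filter, eq_comm]

lemma ab_hom_aux (S : ShortComplex AddCommGrpCat.{0}) {M : Type} [AddCommGroup M]
    (q : AddMonoidHom.ker S.g.hom →+ M) (hs : Function.Surjective q)
    (hk : ∀ x, q x = 0 ↔ ∃ y, S.f y = x.1) : Nonempty (S.homology ≃+ M) := by
  refine ⟨S.abHomologyIso.addCommGroupIsoToAddEquiv.trans ?_⟩
  refine (QuotientAddGroup.quotientAddEquivOfEq ?_).trans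
    (QuotientAddGroup.quotientKerEquivOfSurjective q hs)
  ext x
  rw [AddMonoidHom.mem_ker, hk]
  constructor
  · rintro ⟨y, rfl⟩; exact ⟨y, rfl⟩
  · rintro ⟨y, hy⟩; exact ⟨y, Subtype.ext hy⟩

section bridge
variable (X : Type) [TopologicalSpace X]
abbrev SC : ChainComplex AddCommGrpCat ℕ := _root_.singularChainComplexFunctor.obj (TopCat.of X)

abbrev SS : SSet := TopCat.toSSet.obj (TopCat.of X)
abbrev SO (n : ℕ) : Type := (SS X).obj (Opposite.op (SimplexCategory.mk n))
def so (n : ℕ) : SO X n ≃ C(Dl (n + 1), X) :=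
  TopCat.toSSetObjEquiv (TopCat.of X) (Opposite.op (SimplexCategory.mk n))
def gen {n : ℕ} (s : SO X n) : (SC X).X n := FreeAbelianGroup.of s

lemma d_gen {n : ℕ} (s : SO X (n + 1)) : (SC X).d (n + 1) n (gen X s) =
    ∑ i : Fin (n + 2), (-1 : ℤ) ^ (i : ℕ) • gen X ((SS X).δ i s) := by
  have : (SC X).d (n + 1) n = AlternatingFaceMapComplex.objD
    (((SimplicialObject.whiskering _ _).obj AddCommGrpCat.free).obj (SS X)) n :=
    alternatingFaceMapComplex_obj_d _ _
  rw [this]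
  unfold AlternatingFaceMapComplex.objD
  have hs : ∀ (P Q : AddCommGrpCat.{0}) (t : Finset (Fin (n + 2))) (f : Fin (n + 2) → (P ⟶ Q)) (p : P),
      (∑ i ∈ t, (-1 : ℤ) ^ (i : ℕ) • f i : P ⟶ Q) p = ∑ i ∈ t, (-1 : ℤ) ^ (i : ℕ) • (f i) p := by
    intro P Q t f p
    classical
    induction t using Finset.induction_on with
    | empty => rfl
    | insert a t ha ih =>
      rw [Finset.sum_insert ha, Finset.sum_insert ha, ← ih]
      rfl
  refine (hs _ _ _ _ _).trans ?_
  refine Finset.sum_congr rfl fun i _ => ?_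
  congr 1

def eqv (n : ℕ) : (SC X).X n ≃+ Ch X (n + 1) :=
  (FreeAbelianGroup.equivFinsupp (SO X n)).trans (Finsupp.domCongr (so X n))

lemma eqv_gen {n : ℕ} (s : SO X n) : eqv X n (gen X s) = Finsupp.single (so X n s) 1 := by
  change (Finsupp.domCongr (so X n)) ((FreeAbelianGroup.equivFinsupp (SO X n)) (FreeAbelianGroup.of s)) = _
  simp

lemma so_δ {n : ℕ} (s : SO X (n + 1)) (i : Fin (n + 2)) :
    so X n ((SS X).δ i s) = (so X (n + 1) s).comp (aff (vert (n + 2) ∘ i.succAbove)) := by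
  ext t
  rw [ContinuousMap.comp_apply, ← map_eq_aff]
  rfl

lemma eqv_d (n : ℕ) (x : (SC X).X (n + 1)) :
    eqv X n ((SC X).d (n + 1) n x) = dC (n + 1) (eqv X (n + 1) x) := by
  suffices h : ((eqv X n).toAddMonoidHom.comp ((SC X).d (n + 1) n).hom) =
    ((dC (n + 1)).toAddMonoidHom.comp (eqv X (n + 1)).toAddMonoidHom) from
    DFunLike.congr_fun h x
  refine FreeAbelianGroup.lift_ext _ _ fun s => ?_
  change eqv X n ((SC X).d (n + 1) n (gen X s)) = dC (n + 1) (eqv X (n + 1) (gen X s))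
  rw [d_gen, eqv_gen, ← real_vert, dC_real, dE_single, map_sum, map_sum]
  refine Finset.sum_congr rfl fun i _ => ?_
  rw [map_zsmul, eqv_gen, map_smul, real_single, so_δ]

lemma homology_succ (n : ℕ) : Nonempty (SingularHomology X (n + 1) ≃+ h X (n + 2)) := by
  obtain ⟨e⟩ := ab_hom_aux ((SC X).sc' (n + 2) (n + 1) n) (M := h X (n + 2))
    (AddMonoidHom.mk' (fun x => kl (eqv X (n + 1) x.1) (by
      apply Cyc.mk
      have hx : (SC X).d (n + 1) n x.1 = 0 := x.2
      exact (eqv_d X n x.1).symm.trans ((congrArg (eqv X n) hx).trans (map_zero _)))) (by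
        intro a b
        rw [kl_add]
        exact kl_congr (map_add _ _ _) _)) (by
      intro a
      obtain ⟨x, hx, rfl⟩ := kl_surj a
      refine ⟨⟨(eqv X (n + 1)).symm x, ?_⟩, ?_⟩
      · change (SC X).d (n + 1) n _ = 0
        apply (eqv X n).injective
        rw [eqv_d, AddEquiv.apply_symm_apply, hx.d_eq, map_zero]
      · exact kl_congr ((eqv X (n + 1)).apply_symm_apply x) _) (by
      intro x
      refine (kl_eq_zero).trans ⟨?_, ?_⟩
      · rintro ⟨y, hy⟩
        refine ⟨(eqv X (n + 2)).symm y, (eqv X (n + 1)).injective ?_⟩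
        refine (eqv_d X (n + 1) _).trans ?_
        rw [AddEquiv.apply_symm_apply, hy]
      · rintro ⟨y, hy⟩
        refine ⟨eqv X (n + 2) y, ?_⟩
        exact (eqv_d X _ y).symm.trans (congrArg (eqv X _) hy))
  exact ⟨((SC X).homologyIsoSc' (n + 2) (n + 1) n (by simp) (by simp)).addCommGroupIsoToAddEquiv.trans e⟩

lemma homology_zero : Nonempty (SingularHomology X 0 ≃+ (Ch X 1 ⧸ LinearMap.range (dC 1 (X := X)))) := by
  obtain ⟨e⟩ := ab_hom_aux ((SC X).sc' 1 0 0) (M := (Ch X 1 ⧸ LinearMap.range (dC 1 (X := X))))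
    (AddMonoidHom.mk' (fun x => Submodule.Quotient.mk (eqv X 0 x.1)) (by
        intro a b
        exact congrArg _ (map_add (eqv X 0) _ _))) (by
      intro a
      obtain ⟨x, rfl⟩ := Submodule.Quotient.mk_surjective _ a
      refine ⟨⟨(eqv X 0).symm x, ?_⟩, ?_⟩
      · change (SC X).d 0 0 _ = 0
        rw [(SC X).shape 0 0 (by simp)]; rfl
      · exact congrArg _ ((eqv X 0).apply_symm_apply x)) (by
      intro x
      refine (Submodule.Quotient.mk_eq_zero _).trans ⟨?_, ?_⟩
      · rintro ⟨y, hy⟩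
        refine ⟨(eqv X 1).symm y, (eqv X 0).injective ?_⟩
        refine (eqv_d X 0 _).trans ?_
        rw [AddEquiv.apply_symm_apply, hy]
      · rintro ⟨y, hy⟩
        refine ⟨eqv X 1 y, ?_⟩
        exact (eqv_d X _ y).symm.trans (congrArg (eqv X _) hy))
  exact ⟨((SC X).homologyIsoSc' 1 0 0 (by simp) (by simp)).addCommGroupIsoToAddEquiv.trans e⟩

lemma free_homology_zero [Module.Free ℤ (h X 1)] [Module.Finite ℤ (h X 1)] :
    Module.Free ℤ (SingularHomology X 0) ∧ Module.Finite ℤ (SingularHomology X 0) := by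
  obtain ⟨e⟩ := homology_zero X
  let M := (Ch X 1 ⧸ LinearMap.range (dC 1 (X := X)))
  let g : M →ₗ[ℤ] Ch X 0 := Submodule.liftQ _ (dC 0) (by
    rintro _ ⟨y, rfl⟩; exact dC_dC 0 y)
  let f : h X 1 → M := fun a => Submodule.Quotient.mk (kl_surj a).choose
  have key : ∀ m : M, g m = 0 → ∃ (x : Ch X 1) (hx : Cyc x), m = Submodule.Quotient.mk x := by
    intro m hm
    obtain ⟨x, rfl⟩ := Submodule.Quotient.mk_surjective _ m
    exact ⟨x, Cyc.mk hm, rfl⟩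
  let _ : Unique C(Dl 0, X) := by
    have : IsEmpty (Dl 0) := ⟨fun t => by simpa using t.2.2⟩
    exact ⟨⟨⟨isEmptyElim, continuous_of_discreteTopology⟩⟩, fun f => ContinuousMap.ext isEmptyElim⟩
  have fin : Module.Finite ℤ M := by
    constructor
    refine Submodule.fg_of_fg_map_of_fg_inf_ker g ?_ ?_
    · exact IsNoetherian.noetherian _
    · let k : h X 1 →ₗ[ℤ] M := Submodule.liftQ _ ((LinearMap.range (dC 1 (X := X))).mkQ.comp (Submodule.subtype _)) (by
        rintro ⟨x, hx⟩ ⟨y, hy⟩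
        exact (Submodule.Quotient.mk_eq_zero _).2 ⟨y, hy⟩)
      have : (⊤ : Submodule ℤ M) ⊓ LinearMap.ker g = LinearMap.range k := by
        ext m
        simp only [top_inf_eq, LinearMap.mem_ker, LinearMap.mem_range]
        constructor
        · intro hm
          obtain ⟨x, hx, rfl⟩ := key m hm
          exact ⟨kl x hx, rfl⟩
        · rintro ⟨a, rfl⟩
          obtain ⟨x, hx, rfl⟩ := kl_surj a
          exact hx.d_eq
      rw [this]
      exact (LinearMap.range_eq_map k) ▸ (Module.Finite.fg_top.map k)
  have tf : Module.IsTorsionFree ℤ M := by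
    refine Module.IsTorsionFree.of_smul_eq_zero fun c m hcm => ?_
    by_cases hc : c = 0
    · exact Or.inl hc
    right
    have h1 : g m = 0 := by
      have : c • g m = 0 := by rw [← map_smul, hcm, map_zero]
      exact (smul_eq_zero.1 this).resolve_left hc
    obtain ⟨x, hx, rfl⟩ := key m h1
    obtain ⟨y, hy⟩ := (Submodule.Quotient.mk_eq_zero _).1 hcm
    have : c • kl x hx = 0 := by
      rw [kl_smul]; exact kl_eq_zero.2 ⟨y, hy⟩
    obtain ⟨y, hy⟩ := kl_eq_zero.1 ((smul_eq_zero.1 this).resolve_left hc)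
    exact (Submodule.Quotient.mk_eq_zero _).2 ⟨y, hy⟩
  have : Module.Free ℤ M := inferInstance
  exact ⟨Module.Free.of_equiv e.symm.toIntLinearEquiv, Module.Finite.equiv e.symm.toIntLinearEquiv⟩
end bridge
end OSH

namespace OSH

/-! ### Isomorphisms up to powers of u -/
section uiso
variable {M N P Q : Type} [AddCommGroup M] [AddCommGroup N] [AddCommGroup P] [AddCommGroup Q]

def UIso (u : ℤ) (f : M →ₗ[ℤ] N) : Prop :=
  (∀ x, f x = 0 → ∃ k : ℕ, u ^ k • x = 0) ∧ ∀ y, ∃ (k : ℕ) (x : M), f x = u ^ k • y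

lemma UIso.two_of_six {u : ℤ} {f : M →ₗ[ℤ] N} {g : N →ₗ[ℤ] M} (h1 : UIso u (g.comp f))
    (h2 : UIso u (f.comp g)) : UIso u f := by
  refine ⟨fun x hx => h1.1 x (by simp [hx]), fun y => ?_⟩
  obtain ⟨k, x, hx⟩ := h2.2 y
  exact ⟨k, g x, hx⟩

lemma UIso.of_bij {u : ℤ} {f : M →ₗ[ℤ] N} (hf : Function.Bijective f) : UIso u f := by
  refine ⟨fun x hx => ⟨0, ?_⟩, fun y => ?_⟩
  · rw [hf.1 (hx.trans (map_zero f).symm), smul_zero]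
  · obtain ⟨x, rfl⟩ := hf.2 y
    exact ⟨0, x, by simp⟩

lemma UIso.comp {u : ℤ} {g : N →ₗ[ℤ] P} {f : M →ₗ[ℤ] N} (hg : UIso u g) (hf : UIso u f) :
    UIso u (g.comp f) := by
  refine ⟨fun x hx => ?_, fun y => ?_⟩
  · obtain ⟨k, hk⟩ := hg.1 (f x) hx
    rw [← map_smul] at hk
    obtain ⟨l, hl⟩ := hf.1 _ hk
    exact ⟨l + k, by rw [pow_add, mul_smul, hl]⟩
  · obtain ⟨k, y', hy⟩ := hg.2 y
    obtain ⟨l, x, hx⟩ := hf.2 y'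
    exact ⟨l + k, x, by rw [LinearMap.comp_apply, hx, map_smul, hy, pow_add, mul_smul]⟩

lemma UIso.of_comp_bij {u : ℤ} {g : N →ₗ[ℤ] P} {f : M →ₗ[ℤ] N} (hg : Function.Bijective g)
    (hf : UIso u (g.comp f)) : UIso u f := by
  refine ⟨fun x hx => hf.1 x (by simp [hx]), fun y => ?_⟩
  obtain ⟨k, x, hx⟩ := hf.2 (g y)
  exact ⟨k, x, hg.1 (by rw [map_smul]; exact hx)⟩

lemma UIso.conj {u : ℤ} {f : M →ₗ[ℤ] N} {f' : P →ₗ[ℤ] Q} {a : M →ₗ[ℤ] P} {b : N →ₗ[ℤ] Q}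
    (hf : UIso u f') (ha : Function.Bijective a) (hb : Function.Bijective b)
    (hc : b.comp f = f'.comp a) : UIso u f :=
  UIso.of_comp_bij hb (hc ▸ hf.comp (UIso.of_bij ha))
end uiso

section five
variable {X Y : Type} [TopologicalSpace X] [TopologicalSpace Y]
variable {U V : Set X} {U' V' : Set Y}

lemma hmap_comp_apply {Z : Type} [TopologicalSpace Z] (g : C(Y, Z)) (f : C(X, Y)) (n : ℕ) (x : h X n) :
    hmap g n (hmap f n x) = hmap (g.comp f) n x := by rw [hmap_comp]; rfl

lemma five {u : ℤ} (hU : IsOpen U) (hV : IsOpen V) (hU' : IsOpen U') (hV' : IsOpen V')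
    (f : C(X, Y)) (fU : Set.MapsTo f U U') (fV : Set.MapsTo f V V')
    (iU : ∀ n, UIso u (hmap (res f fU) n)) (iV : ∀ n, UIso u (hmap (res f fV) n))
    (iW : ∀ n, UIso u (hmap (res f (fU.inter_inter fV)) n)) (n : ℕ) :
    UIso u (hmap (res f (fU.union_union fV)) n) := by
  have eU : ∀ n a, hmap (res f (fU.union_union fV)) n (hmap (jU U V) n a) =
      hmap (jU U' V') n (hmap (res f fU) n a) := by
    intro n a; rw [hmap_comp_apply, hmap_comp_apply]; rfl
  have eV : ∀ n a, hmap (res f (fU.union_union fV)) n (hmap (jV U V) n a) =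
      hmap (jV U' V') n (hmap (res f fV) n a) := by
    intro n a; rw [hmap_comp_apply, hmap_comp_apply]; rfl
  have kkU : ∀ n a, hmap (res f fU) n (hmap (kU U V) n a) =
      hmap (kU U' V') n (hmap (res f (fU.inter_inter fV)) n a) := by
    intro n a; rw [hmap_comp_apply, hmap_comp_apply]; rfl
  have kkV : ∀ n a, hmap (res f fV) n (hmap (kV U V) n a) =
      hmap (kV U' V') n (hmap (res f (fU.inter_inter fV)) n a) := by
    intro n a; rw [hmap_comp_apply, hmap_comp_apply]; rfl
  have A : ∀ n a b, hmap (res f (fU.union_union fV)) n (hmap (jU U V) n a + hmap (jV U V) n b) = 0 →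
      ∃ k : ℕ, u ^ k • (hmap (jU U V) n a + hmap (jV U V) n b) = 0 := by
    intro n a b hab
    rw [map_add, eU, eV] at hab
    obtain ⟨c', h1, h2⟩ := mv_mid _ _ hab hU' hV'
    obtain ⟨m, c, hc⟩ := (iW n).2 c'
    obtain ⟨l, hl⟩ := (iU n).1 (hmap (kU U V) n c - u ^ m • a) (by
      rw [map_sub, kkU, hc, map_smul, map_smul, h1, sub_self])
    obtain ⟨l', hl'⟩ := (iV n).1 (hmap (kV U V) n c + u ^ m • b) (by
      rw [map_add, kkV, hc, map_smul, map_smul, h2, smul_neg, neg_add_cancel])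
    refine ⟨l' + l + m, ?_⟩
    have e1 : u ^ (l' + l + m) • a = u ^ (l' + l) • hmap (kU U V) n c := by
      rw [smul_sub, sub_eq_zero] at hl
      rw [pow_add _ l' l, mul_smul, hl, pow_add, pow_add, mul_smul, mul_smul]
    have e2 : u ^ (l' + l + m) • b = - u ^ (l' + l) • hmap (kV U V) n c := by
      rw [smul_add, add_comm, add_eq_zero_iff_eq_neg] at hl'
      rw [add_comm l' l, neg_smul, pow_add _ l l', mul_smul, ← smul_neg, ← hl', pow_add, pow_add, mul_smul, mul_smul]
    rw [smul_add, ← map_smul, ← map_smul, e1, e2, map_smul, map_smul, hmap_jk, neg_smul, add_neg_cancel]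
  have B : ∀ n a b, ∃ (k : ℕ) (x : _), hmap (res f (fU.union_union fV)) n x =
      u ^ k • (hmap (jU U' V') n a + hmap (jV U' V') n b) := by
    intro n a b
    obtain ⟨k, a', ha⟩ := (iU n).2 a
    obtain ⟨l, b', hb⟩ := (iV n).2 b
    refine ⟨k + l, u ^ l • hmap (jU U V) n a' + u ^ k • hmap (jV U V) n b', ?_⟩
    rw [map_add, map_smul, map_smul, eU, eV, ha, hb, map_smul, map_smul, smul_smul, smul_smul, pow_add, smul_add, mul_comm (u ^ l)]
  refine ⟨fun x hx => ?_, fun y => ?_⟩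
  · cases n with
    | zero =>
      obtain ⟨a, b, rfl⟩ := mv_zero hU hV x
      exact A _ a b hx
    | succ n =>
      have := delta_nat hU hV hU' hV' f fU fV x
      rw [hx, map_zero] at this
      obtain ⟨k, hk⟩ := (iW n).1 _ this.symm
      rw [← map_smul] at hk
      obtain ⟨a, b, hab⟩ := mv_top hU hV _ hk
      obtain ⟨l, hl⟩ := A _ a b (by rw [← hab, map_smul, hx, smul_zero])
      exact ⟨l + k, by rw [pow_add, mul_smul, hab, hl]⟩
  · cases n with
    | zero =>
      obtain ⟨a, b, rfl⟩ := mv_zero hU' hV' y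
      exact B _ a b
    | succ n =>
      obtain ⟨m, c, hc⟩ := (iW n).2 (delta hU' hV' n y)
      obtain ⟨l, hl⟩ := (iU n).1 (hmap (kU U V) n c) (by
        rw [kkU, hc, map_smul, (mv_bot' hU' hV' y).1, smul_zero])
      obtain ⟨l', hl'⟩ := (iV n).1 (hmap (kV U V) n c) (by
        rw [kkV, hc, map_smul, (mv_bot' hU' hV' y).2, smul_zero])
      obtain ⟨x, hx⟩ := mv_bot hU hV (u ^ (l' + l) • c)
        (by rw [map_smul, pow_add, mul_smul, hl, smul_zero])
        (by rw [map_smul, add_comm, pow_add, mul_smul, hl', smul_zero])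
      obtain ⟨a, b, hab⟩ := mv_top hU' hV'
        (hmap (res f (fU.union_union fV)) _ x - u ^ (l' + l + m) • y) (by
          rw [map_sub, delta_nat hU hV hU' hV' f fU fV, hx, map_smul, hc, map_smul, pow_add _ (l' + l), mul_smul, sub_self])
      obtain ⟨k, x', hx'⟩ := B _ a b
      refine ⟨k + (l' + l + m), u ^ k • x - x', ?_⟩
      rw [map_sub, hx', map_smul, ← hab, smul_sub, sub_sub_cancel, pow_add _ k, mul_smul]
end five
end OSH

namespace OSH

/-! ### Power maps on tori -/
section torus
variable {κ : Type}

def pw (κ : Type) (u : ℕ) : C(κ → Circle, κ → Circle) := ⟨fun y => y ^ u, by fun_prop⟩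
def mulL (ζ : κ → Circle) : C(κ → Circle, κ → Circle) := ⟨fun y => ζ * y, by fun_prop⟩

def lineI {n : ℕ} (v : Dl n) : C(unitInterval × Dl n, Dl n) where
  toFun p := ⟨(1 - (p.1 : ℝ)) • (v : Fin n → ℝ) + (p.1 : ℝ) • (p.2 : Fin n → ℝ),
    convex_stdSimplex ℝ (Fin n) v.2 p.2.2 (by linarith [p.1.2.2]) p.1.2.1 (by ring)⟩
  continuous_toFun := by
    refine Continuous.subtype_mk ?_ _
    exact ((continuous_const.sub (continuous_subtype_val.comp continuous_fst)).smul continuous_const).add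
      ((continuous_subtype_val.comp continuous_fst).smul (continuous_subtype_val.comp continuous_snd))

lemma lift_circle {n : ℕ} (σ : C(Dl n, Circle)) : ∃ θ : C(Dl n, ℝ), ∀ t, Circle.exp (θ t) = σ t := by
  cases n with
  | zero =>
    have : IsEmpty (Dl 0) := ⟨fun t => by simpa using t.2.2⟩
    exact ⟨⟨isEmptyElim, continuous_of_discreteTopology⟩, isEmptyElim⟩
  | succ n =>
    let v : Dl (n + 1) := vert (n + 1) 0
    obtain ⟨e, he⟩ := Circle.exp_surjective (σ v)
    let H : C(unitInterval × Dl (n + 1), Circle) := σ.comp (lineI v)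
    have H0 : ∀ a, H (0, a) = Circle.exp ((ContinuousMap.const (Dl (n + 1)) e) a) := by
      intro a
      change σ (lineI v (0, a)) = Circle.exp e
      rw [he]
      congr 1
      apply Subtype.ext
      simp [lineI]
      rfl
    refine ⟨(Circle.isCoveringMap_exp.liftHomotopy H _ H0).comp ⟨fun t => (1, t), by fun_prop⟩, fun t => ?_⟩
    have := congrFun (Circle.isCoveringMap_exp.liftHomotopy_lifts H _ H0) (1, t)
    refine Eq.trans this ?_
    change σ (lineI v (1, t)) = σ t
    congr 1
    apply Subtype.ext
    simp [lineI]
    rfl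

lemma lift_pw {u : ℕ} (hu : u ≠ 0) {n : ℕ} (σ : C(Dl n, κ → Circle)) :
    ∃ τ : C(Dl n, κ → Circle), (pw κ u).comp τ = σ := by
  choose θ hθ using fun k => lift_circle ((⟨fun y => y k, by fun_prop⟩ : C(κ → Circle, Circle)).comp σ)
  refine ⟨⟨fun t k => Circle.exp (θ k t / u), by fun_prop⟩, ?_⟩
  ext t k
  have : Circle.exp (θ k t / u) ^ u = σ t k := by
    rw [← Circle.exp_nsmul, nsmul_eq_mul, mul_div_cancel₀ _ (by exact_mod_cast hu)]
    exact hθ k t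
  exact congrArg (fun z : Circle => (z : ℂ)) this

lemma mulL_homotopic (ζ : κ → Circle) : (mulL ζ).Homotopic (ContinuousMap.id _) := by
  choose θ hθ using fun k => Circle.exp_surjective (ζ k)
  refine ⟨⟨⟨fun p k => Circle.exp ((1 - (p.1 : ℝ)) * θ k) * p.2 k, by fun_prop⟩, ?_, ?_⟩⟩
  · intro y; funext k; simp [mulL, hθ]
  · intro y; funext k; simp

def ker (κ : Type) (u : ℕ) : Subgroup (κ → Circle) := (powMonoidHom u).ker

lemma ker_finite [Finite κ] {u : ℕ} (hu : u ≠ 0) : Finite (ker κ u) := by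
  have h1 : Finite {z : Circle // z ^ u = 1} := by
    have : NeZero u := ⟨hu⟩
    refine Finite.of_injective (β := rootsOfUnity u ℂ) (fun z => ⟨Circle.toUnits z.1, ?_⟩) ?_
    · rw [mem_rootsOfUnity, ← map_pow, z.2, map_one]
    · intro a b hab
      have := congrArg (fun z : rootsOfUnity u ℂ => ((z : ℂˣ) : ℂ)) hab
      exact Subtype.ext (Circle.ext this)
  refine Finite.of_injective (β := κ → {z : Circle // z ^ u = 1}) (fun y k => ⟨y.1 k, congrFun (show y.1 ^ u = 1 from y.2) k⟩) ?_
  intro a b hab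
  apply Subtype.ext
  funext k
  exact congrArg Subtype.val (congrFun hab k)

lemma lift_unique [Finite κ] {u : ℕ} (hu : u ≠ 0) {n : ℕ} (τ τ' : C(Dl n, κ → Circle))
    (hτ : (pw κ u).comp τ = (pw κ u).comp τ') : ∃ ζ ∈ ker κ u, τ' = (mulL ζ).comp τ := by
  cases n with
  | zero =>
    have : IsEmpty (Dl 0) := ⟨fun t => by simpa using t.2.2⟩
    exact ⟨1, one_mem _, ContinuousMap.ext isEmptyElim⟩
  | succ n =>
    have hk : ∀ t, τ' t / τ t ∈ ker κ u := fun t => by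
      have := DFunLike.congr_fun hτ t
      change τ t ^ u = τ' t ^ u at this
      change (τ' t / τ t) ^ u = 1
      rw [div_pow, this, div_self']
    have := ker_finite (κ := κ) hu
    let q : Dl (n + 1) → ker κ u := fun t => ⟨τ' t / τ t, hk t⟩
    have hq : Continuous q := by fun_prop
    have hc : ∀ x y, q x = q y := fun x y =>
      PreconnectedSpace.constant (α := Dl (n+1)) inferInstance (f := q) hq
    let t0 := vert (n + 1) 0
    refine ⟨_, hk t0, ?_⟩
    apply ContinuousMap.ext
    intro t
    have : τ' t / τ t = τ' t0 / τ t0 := congrArg Subtype.val (hc t t0)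
    change τ' t = τ' t0 / τ t0 * τ t
    rw [← this, div_mul_cancel]

def trv [Finite κ] {u : ℕ} (hu : u ≠ 0) (n : ℕ) : Ch (κ → Circle) n →ₗ[ℤ] Ch (κ → Circle) n :=
  haveI := ker_finite (κ := κ) hu
  haveI := Fintype.ofFinite (ker κ u)
  Finsupp.linearCombination ℤ (fun σ => ∑ ζ : ker κ u, Finsupp.single ((mulL ζ.1).comp (lift_pw hu σ).choose) 1)

lemma trv_pw [Finite κ] {u : ℕ} (hu : u ≠ 0) [Fintype (ker κ u)] {n : ℕ} (c : Ch (κ → Circle) n) :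
    trv hu n (cmap (pw κ u) c) = ∑ ζ : ker κ u, cmap (mulL ζ.1) c := by
  suffices H : (trv hu n).comp (cmap (pw κ u)) = ∑ ζ : ker κ u, cmap (mulL ζ.1) by
    have := LinearMap.congr_fun H c
    rwa [LinearMap.sum_apply] at this
  apply ext_ch
  intro τ
  rw [LinearMap.sum_apply, LinearMap.comp_apply, cmap_single]
  simp only [trv, Finsupp.linearCombination_single, one_smul, cmap_single]
  obtain ⟨ζ0, h0, e⟩ := lift_unique hu τ _ (lift_pw hu ((pw κ u).comp τ)).choose_spec.symm
  rw [e]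
  have := Fintype.sum_equiv (Equiv.mulRight (⟨ζ0, h0⟩ : ker κ u))
    (fun ζ : ker κ u => (Finsupp.single ((mulL ζ.1).comp ((mulL ζ0).comp τ)) 1 : Ch (κ → Circle) n))
    (fun ζ : ker κ u => (Finsupp.single ((mulL ζ.1).comp τ) 1 : Ch (κ → Circle) n)) (by
      intro ζ
      congr 1
      ext t : 1
      exact (mul_assoc _ _ _).symm)
  rw [← this]
  congr!

lemma pw_surj {u : ℕ} (hu : u ≠ 0) {n : ℕ} (a : Ch (κ → Circle) n) : ∃ c, cmap (pw κ u) c = a := by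
  induction a using Finsupp.induction_linear with
  | zero => exact ⟨0, map_zero _⟩
  | add a b ha hb =>
    obtain ⟨x, rfl⟩ := ha
    obtain ⟨y, rfl⟩ := hb
    exact ⟨x + y, map_add _ _ _⟩
  | single σ m =>
    obtain ⟨τ, rfl⟩ := lift_pw hu σ
    exact ⟨Finsupp.single τ m, cmap_single _ _ _⟩

theorem pw_uiso [Finite κ] {u : ℕ} (hu : u ≠ 0) (n : ℕ) : UIso (u : ℤ) (hmap (pw κ u) n) := by
  have := ker_finite (κ := κ) hu
  let _ := Fintype.ofFinite (ker κ u)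
  obtain ⟨m, q, hq⟩ : ∃ (m : ℕ) (q : ℕ), u ^ m = q * Fintype.card (ker κ u) := by
    obtain ⟨q, hq⟩ := card_dvd_exponent_pow_rank' (G := ker κ u) (n := u) (fun g => Subtype.ext g.2)
    exact ⟨_, q, by rw [hq, Nat.card_eq_fintype_card, mul_comm]⟩
  have key : ∀ z : h (κ → Circle) n, ∑ ζ : ker κ u, hmap (mulL ζ.1) n z = (Fintype.card (ker κ u) : ℤ) • z := by
    intro z
    simp [hmap_homotopic (mulL_homotopic _), hmap_id]
  have kls : ∀ (s : Finset (ker κ u)) (x : Ch (κ → Circle) n) (hx : Cyc x), ∃ hh : Cyc (∑ ζ ∈ s, cmap (mulL ζ.1) x),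
      ∑ ζ ∈ s, hmap (mulL ζ.1) n (kl x hx) = kl _ hh := by
    intro s x hx
    classical
    induction s using Finset.induction_on with
    | empty => exact ⟨Cyc.zero, rfl⟩
    | insert a s ha ih =>
      obtain ⟨h1, h2⟩ := ih
      refine ⟨by rw [Finset.sum_insert ha]; exact (hx.map _).add h1, ?_⟩
      rw [Finset.sum_insert ha, h2, hmap_kl, kl_add]
      exact kl_congr (Finset.sum_insert ha).symm _
  refine ⟨fun x hx => ?_, fun y => ?_⟩
  · refine ⟨m, ?_⟩
    obtain ⟨a, ha, rfl⟩ := kl_surj x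
    rw [hmap_kl, kl_eq_zero] at hx
    obtain ⟨b, hb⟩ := hx
    obtain ⟨b', rfl⟩ := pw_surj hu b
    have h2 := trv_pw hu a
    rw [← hb, dC_cmap, trv_pw] at h2
    obtain ⟨hh, e⟩ := kls Finset.univ a ha
    rw [key] at e
    have : kl _ hh = 0 := by
      rw [kl_eq_zero]
      refine ⟨∑ ζ : ker κ u, cmap (mulL ζ.1) b', ?_⟩
      rw [← h2, map_sum]
      simp only [dC_cmap]
    rw [this] at e
    have hq' : ((u : ℤ)) ^ m = q * (Fintype.card (ker κ u) : ℤ) := by exact_mod_cast hq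
    rw [hq', mul_smul, e, smul_zero]
  · obtain ⟨a, ha, rfl⟩ := kl_surj y
    obtain ⟨a', rfl⟩ := pw_surj hu a
    have hc : Cyc (∑ ζ : ker κ u, cmap (mulL ζ.1) a') := by
      cases n with
      | zero => trivial
      | succ n =>
        apply Cyc.mk
        have := ha.d_eq
        rw [dC_cmap] at this
        rw [map_sum]
        simp only [dC_cmap]
        rw [← trv_pw hu, this, map_zero]
    refine ⟨m, (q : ℤ) • kl _ hc, ?_⟩
    have hq' : ((u : ℤ)) ^ m = q * (Fintype.card (ker κ u) : ℤ) := by exact_mod_cast hq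
    have : ∀ ζ : ker κ u, cmap (pw κ u) (cmap (mulL ζ.1) a') = cmap (pw κ u) a' := by
      intro ζ
      rw [← cmap_comp]
      congr 1
      congr 1
      ext t : 1
      change (ζ.1 * t) ^ u = t ^ u
      rw [mul_pow, show ζ.1 ^ u = 1 from ζ.2, one_mul]
    have e2 : cmap (pw κ u) (∑ ζ : ker κ u, cmap (mulL ζ.1) a') =
        (Fintype.card (ker κ u) : ℤ) • cmap (pw κ u) a' := by
      rw [map_sum]; simp [this]
    rw [map_smul, hmap_kl, hq', mul_smul, kl_congr e2, kl_smul (Fintype.card (ker κ u) : ℤ)]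
end torus
end OSH

namespace OSH

/-! ### Phases and characters -/
section chars

lemma ph_mem {x : ℂ} (hx : x ≠ 0) : x / ‖x‖ ∈ Submonoid.unitSphere ℂ :=
  mem_sphere_zero_iff_norm.2 (by simp [hx])

def ph (x : ℂ) : Circle := if hx : x ≠ 0 then ⟨x / ‖x‖, ph_mem hx⟩ else 1

lemma ph_coe {x : ℂ} (hx : x ≠ 0) : (ph x : ℂ) = x / ‖x‖ :=
  congrArg (fun z : Circle => (z : ℂ)) (dif_pos hx : ph x = _)

lemma ph_mul_norm {x : ℂ} (hx : x ≠ 0) : (ph x : ℂ) * ‖x‖ = x := by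
  rw [ph_coe hx]
  have : (‖x‖ : ℂ) ≠ 0 := by simpa using hx
  field_simp

lemma ph_circle_mul (c : Circle) {x : ℂ} (hx : x ≠ 0) : ph (c * x) = c * ph x := by
  ext
  rw [ph_coe (mul_ne_zero (Circle.coe_ne_zero _) hx), Circle.coe_mul, ph_coe hx, norm_mul, Circle.norm_coe, one_mul]
  ring

lemma ph_pos {a : ℝ} (ha : 0 < a) : ph (a : ℂ) = 1 := by
  ext
  rw [ph_coe (by exact_mod_cast ha.ne')]
  have : (a : ℂ) ≠ 0 := by exact_mod_cast ha.ne'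
  simp [abs_of_pos ha, this]

lemma ph_circle (c : Circle) : ph c = c := by
  have := ph_circle_mul c (one_ne_zero : (1 : ℂ) ≠ 0)
  rw [mul_one] at this
  rw [this]
  have := ph_pos one_pos
  rw [Complex.ofReal_one] at this
  rw [this, mul_one]

lemma ph_pow {x : ℂ} (hx : x ≠ 0) (u : ℕ) : ph (x ^ u) = ph x ^ u := by
  ext
  rw [ph_coe (pow_ne_zero _ hx), Circle.coe_pow, ph_coe hx, norm_pow, div_pow]
  push_cast
  rfl

lemma ph_cont : ContinuousOn ph {x : ℂ | x ≠ 0} := by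
  refine (Topology.IsInducing.induced (fun z : Circle => (z : ℂ))).continuousOn_iff.2 ?_
  have : ContinuousOn (fun x : ℂ => x / (‖x‖ : ℂ)) {x : ℂ | x ≠ 0} := by
    apply ContinuousOn.div continuousOn_id (by fun_prop)
    intro x hx
    simpa using hx
  exact this.congr fun x hx => ph_coe hx

variable {A : Type} [AddCommGroup A]

def IsC (χ : A → Circle) : Prop := ∀ a b, χ (a + b) = χ a * χ b

def IsC.hom {χ : A → Circle} (hχ : IsC χ) : A →+ Additive Circle :=
  AddMonoidHom.mk' (fun a => Additive.ofMul (χ a)) hχ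

lemma isC_hom (f : A →+ Additive Circle) : IsC fun a => (f a).toMul := fun a b => by
  simp

lemma IsC.zero {χ : A → Circle} (hχ : IsC χ) : χ 0 = 1 := hχ.hom.map_zero
lemma IsC.neg {χ : A → Circle} (hχ : IsC χ) (a : A) : χ (-a) = (χ a)⁻¹ := hχ.hom.map_neg a
lemma IsC.sub {χ : A → Circle} (hχ : IsC χ) (a b : A) : χ (a - b) = χ a * (χ b)⁻¹ := by
  rw [sub_eq_add_neg, hχ, hχ.neg]
lemma IsC.zsmul {χ : A → Circle} (hχ : IsC χ) (m : ℤ) (a : A) : χ (m • a) = χ a ^ m := hχ.hom.map_zsmul m a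
lemma IsC.nsmul {χ : A → Circle} (hχ : IsC χ) (m : ℕ) (a : A) : χ (m • a) = χ a ^ m := hχ.hom.map_nsmul m a
lemma IsC.sum {χ : A → Circle} (hχ : IsC χ) {κ : Type} (s : Finset κ) (f : κ → A) :
    χ (∑ k ∈ s, f k) = ∏ k ∈ s, χ (f k) := map_sum hχ.hom f s
lemma IsC.mul {χ ψ : A → Circle} (hχ : IsC χ) (hψ : IsC ψ) : IsC fun a => χ a * ψ a := fun a b => by
  simp only [hχ a b, hψ a b]; exact mul_mul_mul_comm _ _ _ _
lemma IsC.inv {χ : A → Circle} (hχ : IsC χ) : IsC fun a => (χ a)⁻¹ := fun a b => by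
  simp only [hχ a b]; exact mul_inv _ _
lemma IsC.pow {χ : A → Circle} (hχ : IsC χ) (u : ℕ) : IsC fun a => (χ a) ^ u := fun a b => by
  simp only [hχ a b]; exact mul_pow _ _ _
lemma isC_one : IsC fun _ : A => (1 : Circle) := fun _ _ => (mul_one _).symm
lemma isC_zpow (c : Circle) (l : A →ₗ[ℤ] ℤ) : IsC fun a => c ^ l a := fun a b => by
  simp only [map_add]; exact zpow_add _ _ _
lemma IsC.comp {B : Type} [AddCommGroup B] {χ : A → Circle} (hχ : IsC χ) (f : B →ₗ[ℤ] A) : IsC fun a => χ (f a) :=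
  fun a b => by simp only [map_add]; exact hχ _ _

lemma circle_root (c : Circle) {d : ℤ} (hd : d ≠ 0) : ∃ b : Circle, b ^ d = c := by
  obtain ⟨e, rfl⟩ := Circle.exp_surjective c
  refine ⟨Circle.exp (e / d), ?_⟩
  rw [← Circle.exp_zsmul, zsmul_eq_mul, mul_div_cancel₀ _ (by exact_mod_cast hd)]

lemma baer_circle : Module.Baer ℤ (Additive Circle) := by
  let _ : DivisibleBy (Additive Circle) ℤ := divisibleByOfSMulRightSurj _ _ (by
    intro m hm c
    obtain ⟨b, hb⟩ := circle_root c.toMul hm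
    exact ⟨Additive.ofMul b, hb⟩)
  exact Module.Baer.of_divisible _

lemma ext_char {κ : Type} [Fintype κ] (v : κ → A) (g : κ → Circle)
    (hg : ∀ m : κ → ℤ, ∑ j, m j • v j = 0 → ∏ j, g j ^ m j = 1) :
    ∃ χ : A → Circle, IsC χ ∧ ∀ j, χ (v j) = g j := by
  classical
  let p : (κ → ℤ) →ₗ[ℤ] A := Fintype.linearCombination ℤ v
  let q : (κ → ℤ) →ₗ[ℤ] Additive Circle := Fintype.linearCombination ℤ (fun j => Additive.ofMul (g j))
  have hle : LinearMap.ker p ≤ LinearMap.ker q := by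
    intro m hm
    rw [LinearMap.mem_ker, Fintype.linearCombination_apply] at hm ⊢
    exact hg m hm
  let q' : ((κ → ℤ) ⧸ LinearMap.ker p) →ₗ[ℤ] Additive Circle := (LinearMap.ker p).liftQ q hle
  let p' : ((κ → ℤ) ⧸ LinearMap.ker p) →ₗ[ℤ] A := (LinearMap.ker p).liftQ p le_rfl
  have hp' : Function.Injective p' := by
    rw [← LinearMap.ker_eq_bot]
    exact Submodule.ker_liftQ_eq_bot _ _ _ le_rfl
  obtain ⟨f, hf⟩ := baer_circle.extension_property_addMonoidHom p'.toAddMonoidHom hp' q'.toAddMonoidHom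
  refine ⟨_, isC_hom f, fun j => ?_⟩
  have h1 : p (Pi.single j 1) = v j := by
    simp [p, Fintype.linearCombination_apply, Pi.single_apply]
  have h2 : q (Pi.single j 1) = Additive.ofMul (g j) := by
    simp [q, Fintype.linearCombination_apply, Pi.single_apply]
  have := DFunLike.congr_fun hf (Submodule.Quotient.mk (Pi.single j 1))
  change f (p (Pi.single j 1)) = q (Pi.single j 1) at this
  rw [h1, h2] at this
  rw [this]; rfl
end chars

/-! ### Orbit spaces -/
section orbit
variable {ι : Type} {A : Type} [AddCommGroup A]

def qs (v : ι → A) : Setoid (ι → ℂ) where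
  r x y := ∃ χ : A → Circle, IsC χ ∧ ∀ j, y j = χ (v j) * x j
  iseqv := by
    refine ⟨fun x => ⟨_, isC_one, fun j => by simp⟩, ?_, ?_⟩
    · rintro x y ⟨χ, hχ, e⟩
      refine ⟨_, hχ.inv, fun j => ?_⟩
      rw [e j, Circle.coe_inv, inv_mul_cancel_left₀ (Circle.coe_ne_zero _)]
    · rintro x y w ⟨χ, hχ, e⟩ ⟨ψ, hψ, e'⟩
      refine ⟨_, hψ.mul hχ, fun j => ?_⟩
      rw [e' j, e j, Circle.coe_mul, mul_assoc]

def Q (v : ι → A) : Type := Quotient (qs v)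
instance (v : ι → A) : TopologicalSpace (Q v) := inferInstanceAs (TopologicalSpace (Quotient (qs v)))
def mk (v : ι → A) (x : ι → ℂ) : Q v := Quotient.mk _ x

variable {v : ι → A}

lemma mk_eq {x y : ι → ℂ} : mk v x = mk v y ↔ ∃ χ : A → Circle, IsC χ ∧ ∀ j, y j = χ (v j) * x j :=
  Quotient.eq (r := qs v)

lemma mk_surj (p : Q v) : ∃ x, mk v x = p := Quotient.exists_rep p

lemma mk_oq : IsOpenQuotientMap (mk v) where
  surjective := mk_surj
  continuous := continuous_quotient_mk'
  isOpenMap := by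
    intro O hO
    have : Topology.IsQuotientMap (mk v) := isQuotientMap_quotient_mk'
    rw [← this.isOpen_preimage]
    have e : mk v ⁻¹' (mk v '' O) = ⋃ χ : {χ : A → Circle // IsC χ}, (fun y j => (χ.1 (v j) : ℂ) * y j) ⁻¹' O := by
      ext y
      simp only [Set.mem_preimage, Set.mem_image, Set.mem_iUnion]
      constructor
      · rintro ⟨x, hx, hxy⟩
        obtain ⟨χ, hχ, e⟩ := mk_eq.1 hxy.symm
        refine ⟨⟨χ, hχ⟩, ?_⟩
        have : (fun j => (χ (v j) : ℂ) * y j) = x := by funext j; exact (e j).symm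
        rw [this]; exact hx
      · rintro ⟨⟨χ, hχ⟩, hx⟩
        exact ⟨_, hx, (mk_eq.2 ⟨χ, hχ, fun j => rfl⟩).symm⟩
    rw [e]
    exact isOpen_iUnion fun χ => hO.preimage (by fun_prop)

variable {Y : Type} [TopologicalSpace Y] {U : Set (Q v)} {V : Set Y}

lemma qcont (hU : IsOpen U) {G : Q v → Y} (hG : ContinuousOn (fun x => G (mk v x)) (mk v ⁻¹' U)) : ContinuousOn G U :=
  (mk_oq.isQuotientMap.continuousOn_isOpen_iff hU).2 hG

def out (p : Q v) : ι → ℂ := (mk_surj p).choose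
lemma mk_out (p : Q v) : mk v (out p) = p := (mk_surj p).choose_spec

def qlift (hU : IsOpen U) (F : (ι → ℂ) → Y) (hF : ContinuousOn F (mk v ⁻¹' U))
    (hr : ∀ x (χ : A → Circle), IsC χ → mk v x ∈ U → F (fun j => χ (v j) * x j) = F x)
    (hV : ∀ x, mk v x ∈ U → F x ∈ V) : C(U, V) where
  toFun p := ⟨F (out p.1), hV _ (by rw [mk_out]; exact p.2)⟩
  continuous_toFun := by
    refine Continuous.subtype_mk ?_ _
    refine continuousOn_iff_continuous_domRestrict.1 (qcont hU (G := fun p => F (out p)) ?_)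
    refine hF.congr fun x hx => ?_
    obtain ⟨χ, hχ, e⟩ := mk_eq.1 (mk_out (mk v x)).symm
    have : out (mk v x) = fun j => (χ (v j) : ℂ) * x j := funext e
    rw [this]
    exact hr x χ hχ hx

lemma qlift_mk (hU : IsOpen U) (F : (ι → ℂ) → Y) (hF : ContinuousOn F (mk v ⁻¹' U))
    (hr : ∀ x (χ : A → Circle), IsC χ → mk v x ∈ U → F (fun j => χ (v j) * x j) = F x)
    (hV : ∀ x, mk v x ∈ U → F x ∈ V) (x : ι → ℂ) (hx : mk v x ∈ U) :
    ((qlift hU F hF hr hV ⟨mk v x, hx⟩ : V) : Y) = F x := by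
  obtain ⟨χ, hχ, e⟩ := mk_eq.1 (mk_out (mk v x)).symm
  have : out (mk v x) = fun j => (χ (v j) : ℂ) * x j := funext e
  change F (out (mk v x)) = F x
  rw [this]
  exact hr x χ hχ hx

lemma qhomotopic (hU : IsOpen U) (f g : C(U, V)) (F : ℝ → (ι → ℂ) → Y)
    (hF : ContinuousOn (fun p : unitInterval × (ι → ℂ) => F p.1 p.2) {p | mk v p.2 ∈ U})
    (hr : ∀ t ∈ unitInterval, ∀ x (χ : A → Circle), IsC χ → mk v x ∈ U → F t (fun j => χ (v j) * x j) = F t x)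
    (hV : ∀ t ∈ unitInterval, ∀ x, mk v x ∈ U → F t x ∈ V)
    (h0 : ∀ x (hx : mk v x ∈ U), (f ⟨mk v x, hx⟩ : Y) = F 0 x)
    (h1 : ∀ x (hx : mk v x ∈ U), (g ⟨mk v x, hx⟩ : Y) = F 1 x) : f.Homotopic g := by
  have hro : ∀ t ∈ unitInterval, ∀ x, mk v x ∈ U → F t (out (mk v x)) = F t x := by
    intro t ht x hx
    obtain ⟨χ, hχ, e⟩ := mk_eq.1 (mk_out (mk v x)).symm
    have : out (mk v x) = fun j => (χ (v j) : ℂ) * x j := funext e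
    rw [this]
    exact hr t ht x χ hχ hx
  have hc : ContinuousOn (fun p : unitInterval × Q v => F p.1 (out p.2)) {p | p.2 ∈ U} := by
    have ho : IsOpenQuotientMap (Prod.map (id : unitInterval → unitInterval) (mk v)) :=
      IsOpenQuotientMap.id.prodMap mk_oq
    refine (ho.isQuotientMap.continuousOn_isOpen_iff (hU.preimage continuous_snd)).2 ?_
    refine hF.congr fun p hp => ?_
    exact hro _ p.1.2 _ hp
  refine ⟨⟨⟨fun p => ⟨F p.1 (out p.2.1), hV _ p.1.2 _ (by rw [mk_out]; exact p.2.2)⟩, ?_⟩, ?_, ?_⟩⟩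
  · refine Continuous.subtype_mk ?_ _
    exact hc.comp_continuous (f := fun p : unitInterval × U => (p.1, p.2.1)) (by fun_prop) (fun p => p.2.2)
  · rintro ⟨p, hp⟩
    obtain ⟨x, rfl⟩ := mk_surj p
    apply Subtype.ext
    rw [h0 x hp]
    exact hro 0 (by simp) x hp
  · rintro ⟨p, hp⟩
    obtain ⟨x, rfl⟩ := mk_surj p
    apply Subtype.ext
    rw [h1 x hp]
    exact hro 1 (by simp) x hp
end orbit
end OSH

namespace OSH
set_option linter.unusedSectionVars false

section opens
variable {ι : Type} {A : Type} [AddCommGroup A] (v : ι → A)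

lemma out_mk (x : ι → ℂ) (k : ι) : out (mk v x) k ≠ 0 ↔ x k ≠ 0 := by
  obtain ⟨χ, hχ, e⟩ := mk_eq.1 (mk_out (mk v x)).symm
  rw [e k]
  simp

def Uo (τ : Finset ι) : Set (Q v) := {p | ∀ k ∈ τ, out p k ≠ 0}
def Xo (s : Finset ι) : Set (Q v) := {p | ∃ k ∈ s, out p k ≠ 0}
variable {v}
lemma mem_Uo {τ : Finset ι} {x : ι → ℂ} : mk v x ∈ Uo v τ ↔ ∀ k ∈ τ, x k ≠ 0 :=
  forall₂_congr fun k _ => out_mk v x k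
lemma mem_Xo {s : Finset ι} {x : ι → ℂ} : mk v x ∈ Xo v s ↔ ∃ k ∈ s, x k ≠ 0 :=
  exists_congr fun k => and_congr_right fun _ => out_mk v x k

lemma isOpen_Uo (τ : Finset ι) : IsOpen (Uo v τ) := by
  rw [← mk_oq.isQuotientMap.isOpen_preimage]
  have : mk v ⁻¹' Uo v τ = ⋂ k ∈ τ, {x | x k ≠ 0} := by
    ext x; rw [Set.mem_preimage, mem_Uo]; simp
  rw [this]
  exact isOpen_biInter_finset fun k _ => isOpen_ne.preimage (by fun_prop : Continuous fun x : ι → ℂ => x k)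

lemma isOpen_Xo (τ : Finset ι) : IsOpen (Xo v τ) := by
  rw [← mk_oq.isQuotientMap.isOpen_preimage]
  have : mk v ⁻¹' Xo v τ = ⋃ k ∈ τ, {x | x k ≠ 0} := by
    ext x; rw [Set.mem_preimage, mem_Xo]; simp
  rw [this]
  exact isOpen_biUnion fun k _ => isOpen_ne.preimage (by fun_prop : Continuous fun x : ι → ℂ => x k)

/-- power maps -/
def pm {v v' : ι → A} (a : ι → ℕ) (c : ℕ) (hac : ∀ j, a j • v j = c • v' j) : C(Q v, Q v') where
  toFun p := mk v' fun j => out p j ^ a j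
  continuous_toFun := by
    rw [mk_oq.isQuotientMap.continuous_iff]
    have : Continuous fun x : ι → ℂ => mk v' fun j => x j ^ a j := mk_oq.continuous.comp (by fun_prop)
    refine this.congr fun x => ?_
    obtain ⟨χ, hχ, e⟩ := mk_eq.1 (mk_out (mk v x)).symm
    refine mk_eq.2 ⟨_, hχ.pow c, fun j => ?_⟩
    rw [e j, mul_pow, ← Circle.coe_pow, ← hχ.nsmul, ← hχ.nsmul, hac]

lemma pm_mk {v v' : ι → A} (a : ι → ℕ) (c : ℕ) (hac : ∀ j, a j • v j = c • v' j) (x : ι → ℂ) :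
    pm a c hac (mk v x) = mk v' fun j => x j ^ a j := by
  obtain ⟨χ, hχ, e⟩ := mk_eq.1 (mk_out (mk v x)).symm
  refine (mk_eq.2 ⟨_, hχ.pow c, fun j => ?_⟩).symm
  rw [e j, mul_pow, ← Circle.coe_pow, ← hχ.nsmul, ← hχ.nsmul, hac]

lemma pm_Uo {v v' : ι → A} (a : ι → ℕ) (c : ℕ) (hac : ∀ j, a j • v j = c • v' j) (τ : Finset ι) :
    Set.MapsTo (pm a c hac) (Uo v τ) (Uo v' τ) := by
  intro p hp
  obtain ⟨x, rfl⟩ := mk_surj p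
  rw [pm_mk, mem_Uo]
  exact fun k hk => pow_ne_zero _ (mem_Uo.1 hp k hk)

lemma pm_Xo {v v' : ι → A} (a : ι → ℕ) (c : ℕ) (hac : ∀ j, a j • v j = c • v' j) (τ : Finset ι) :
    Set.MapsTo (pm a c hac) (Xo v τ) (Xo v' τ) := by
  intro p hp
  obtain ⟨x, rfl⟩ := mk_surj p
  rw [pm_mk, mem_Xo]
  obtain ⟨k, hk, hx⟩ := mem_Xo.1 hp
  exact ⟨k, hk, pow_ne_zero _ hx⟩

def Phi (v : ι → A) (u : ℕ) : C(Q v, Q v) := pm (fun _ => u) u (fun _ => rfl)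

end opens

section strata
variable {ι : Type} {A : Type} [AddCommGroup A] [Module.Free ℤ A] [Module.Finite ℤ A] (v : ι → A) (τ : Finset ι)

def piT : (τ → ℤ) →ₗ[ℤ] A := Fintype.linearCombination ℤ fun k : τ => v k
abbrev KT := LinearMap.ker (piT v τ)

lemma exists_retr : ∃ r : (τ → ℤ) →ₗ[ℤ] KT v τ, ∀ m : KT v τ, r m = m := by
  obtain ⟨σ, hσ⟩ := Module.projective_lifting_property (piT v τ).rangeRestrict LinearMap.id
    (piT v τ).surjective_rangeRestrict
  refine ⟨LinearMap.codRestrict _ (LinearMap.id - σ.comp (piT v τ).rangeRestrict) ?_, ?_⟩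
  · intro m
    rw [LinearMap.mem_ker]
    have := congrArg Subtype.val (LinearMap.congr_fun hσ ((piT v τ).rangeRestrict m))
    have h2 : piT v τ (σ ((piT v τ).rangeRestrict m)) = piT v τ m := this
    simp only [LinearMap.sub_apply, LinearMap.id_apply, LinearMap.comp_apply, map_sub]
    rw [h2, sub_self]
  · intro m
    apply Subtype.ext
    have : (piT v τ).rangeRestrict m = 0 := Subtype.ext m.2
    simp [this]

def rT := (exists_retr v τ).choose
lemma rT_spec (m : KT v τ) : rT v τ m = m := (exists_retr v τ).choose_spec m

abbrev kT := Module.Free.ChooseBasisIndex ℤ (KT v τ)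
def bT : Module.Basis (kT v τ) ℤ (KT v τ) := Module.Free.chooseBasis ℤ _

def HT {κ : Type} [Fintype κ] (y : κ → Circle) : (κ → ℤ) →ₗ[ℤ] Additive Circle :=
  Fintype.linearCombination ℤ (fun j => Additive.ofMul (y j))
def HK (y : kT v τ → Circle) : KT v τ →ₗ[ℤ] Additive Circle := (bT v τ).constr ℤ (fun j => Additive.ofMul (y j))

lemma HT_single {κ : Type} [Fintype κ] [DecidableEq κ] (y : κ → Circle) (j : κ) : HT y (Pi.single j 1) = Additive.ofMul (y j) := by
  simp [HT, Fintype.linearCombination_apply, Pi.single_apply]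

def dn (x : ι → ℂ) (i : kT v τ) : Circle := (HT (fun j : τ => ph (x j)) (bT v τ i)).toMul

open Classical in
def upT (y : kT v τ → Circle) (j : τ) : Circle := (HK v τ y (rT v τ (Pi.single j 1))).toMul

lemma HT_upT (y : kT v τ → Circle) : HT (upT v τ y) = (HK v τ y).comp (rT v τ) := by
  classical
  apply (Pi.basisFun ℤ τ).ext
  intro j
  rw [Pi.basisFun_apply, HT_single, LinearMap.comp_apply, upT]
  congr!

lemma HK_b (y : kT v τ → Circle) (i) : HK v τ y (bT v τ i) = Additive.ofMul (y i) := by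
  simp [HK]

lemma HK_dn (x : ι → ℂ) : HK v τ (dn v τ x) = (HT fun j : τ => ph (x j)).comp (KT v τ).subtype := by
  apply (bT v τ).ext
  intro i
  rw [HK_b]
  rfl

open Classical in
def up (y : kT v τ → Circle) (j : ι) : ℂ := if hj : j ∈ τ then upT v τ y ⟨j, hj⟩ else 0

lemma up_mem (y : kT v τ → Circle) {j : ι} (hj : j ∈ τ) : up v τ y j = upT v τ y ⟨j, hj⟩ := dif_pos hj
lemma up_not (y : kT v τ → Circle) {j : ι} (hj : j ∉ τ) : up v τ y j = 0 := dif_neg hj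

lemma dn_up (y : kT v τ → Circle) : dn v τ (up v τ y) = y := by
  funext i
  have : (fun j : τ => ph (up v τ y j)) = upT v τ y := by
    funext j
    rw [up_mem v τ y j.2, ph_circle]
  rw [dn, this, HT_upT, LinearMap.comp_apply, rT_spec, HK_b]
  rfl

lemma up_cont : Continuous (up v τ) := by
  classical
  refine continuous_pi fun j => ?_
  by_cases hj : j ∈ τ
  · simp only [up_mem v τ _ hj]
    refine Continuous.comp (g := fun z : Circle => (z : ℂ)) (by fun_prop) ?_
    have : (fun y => upT v τ y ⟨j, hj⟩) =
        fun y => ∏ i, y i ^ ((bT v τ).repr (rT v τ (Pi.single ⟨j, hj⟩ 1)) i) := by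
      funext y
      simp only [upT, HK, Module.Basis.constr_apply_fintype, Module.Basis.equivFun_apply, toMul_sum, toMul_zsmul, toMul_ofMul]
    rw [this]
    fun_prop
  · simp only [up_not v τ _ hj]
    fun_prop

lemma dn_cont : ContinuousOn (dn v τ) (mk v ⁻¹' Uo v τ) := by
  refine continuousOn_pi.2 fun i => ?_
  have : (fun x => dn v τ x i) = fun x => ∏ j : τ, ph (x j) ^ (bT v τ i).1 j := by
    funext x
    simp [dn, HT, Fintype.linearCombination_apply]
  rw [this]
  refine continuousOn_finsetProd _ fun j _ => ContinuousOn.zpow ?_ _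
  refine ph_cont.comp (by fun_prop) fun x hx => mem_Uo.1 hx j j.2

lemma dn_inv (x : ι → ℂ) (χ : A → Circle) (hχ : IsC χ) (hx : mk v x ∈ Uo v τ) :
    dn v τ (fun j => χ (v j) * x j) = dn v τ x := by
  funext i
  have e : (fun j : τ => ph (χ (v j) * x j)) = fun j : τ => χ (v j) * ph (x j) :=
    funext fun j => ph_circle_mul _ (mem_Uo.1 hx j j.2)
  have h0 : ∑ j : τ, (bT v τ i).1 j • v j = 0 := (bT v τ i).2
  have h1 : ∏ j : τ, χ (v j) ^ (bT v τ i).1 j = 1 := by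
    rw [← hχ.zero, ← h0, hχ.sum]
    exact Finset.prod_congr rfl fun j _ => (hχ.zsmul _ _).symm
  rw [dn, e, dn]
  simp only [HT, Fintype.linearCombination_apply, toMul_sum, toMul_zsmul, toMul_ofMul, mul_zpow, Finset.prod_mul_distrib, h1, one_mul]

def dnC : C(Uo v τ, (Set.univ : Set (kT v τ → Circle))) :=
  qlift (isOpen_Uo τ) (dn v τ) (dn_cont v τ) (dn_inv v τ) (fun _ _ => trivial)
def upC : C((Set.univ : Set (kT v τ → Circle)), Uo v τ) where
  toFun y := ⟨mk v (up v τ y.1), mem_Uo.2 fun k hk => by rw [up_mem v τ _ hk]; exact Circle.coe_ne_zero _⟩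
  continuous_toFun := Continuous.subtype_mk (mk_oq.continuous.comp ((up_cont v τ).comp continuous_subtype_val)) _

lemma dnC_mk (x : ι → ℂ) (hx : mk v x ∈ Uo v τ) : (dnC v τ ⟨mk v x, hx⟩ : kT v τ → Circle) = dn v τ x :=
  qlift_mk (V := Set.univ) (isOpen_Uo τ) (dn v τ) (dn_cont v τ) (dn_inv v τ) (fun _ _ => trivial) x hx

lemma dnC_upC : (dnC v τ).comp (upC v τ) = ContinuousMap.id _ := by
  apply ContinuousMap.ext
  intro y
  apply Subtype.ext
  refine (dnC_mk v τ _ _).trans ?_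
  exact dn_up v τ _

lemma upC_dnC : ((upC v τ).comp (dnC v τ)).Homotopic (ContinuousMap.id _) := by
  classical
  refine ContinuousMap.Homotopic.symm ?_
  refine qhomotopic (isOpen_Uo τ) _ _ (fun t x => mk v fun j => if j ∈ τ then
    (((1 - t) * ‖x j‖ + t : ℝ) : ℂ) * ph (x j) else ((1 - t : ℝ) : ℂ) * x j) ?_ ?_ ?_ ?_ ?_
  · refine mk_oq.continuous.comp_continuousOn (continuousOn_pi.2 fun j => ?_)
    by_cases hj : j ∈ τ
    · simp only [hj, if_true]
      refine ContinuousOn.mul (by fun_prop) ?_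
      refine Continuous.comp_continuousOn (g := fun z : Circle => (z : ℂ)) (by fun_prop) ?_
      exact ph_cont.comp (by fun_prop) fun x hx => mem_Uo.1 hx j hj
    · simp only [hj, if_false]
      fun_prop
  · intro t ht x χ hχ hx
    refine (mk_eq.2 ⟨χ, hχ, fun j => ?_⟩).symm
    by_cases hj : j ∈ τ
    · simp only [hj, if_true]
      rw [ph_circle_mul _ (mem_Uo.1 hx j hj), norm_mul, Circle.norm_coe, one_mul, Circle.coe_mul]
      ring
    · simp only [hj, if_false]
      ring
  · intro t ht x hx
    refine mem_Uo.2 fun k hk => ?_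
    simp only [hk, if_true]
    refine mul_ne_zero ?_ (Circle.coe_ne_zero _)
    have h1 : 0 < ‖x k‖ := norm_pos_iff.2 (mem_Uo.1 hx k hk)
    rcases ht.1.eq_or_lt with h0 | h0
    · rw [← h0]; simpa using h1.ne'
    · have : 0 ≤ (1 - t) * ‖x k‖ := mul_nonneg (by linarith [ht.2]) h1.le
      exact_mod_cast (by linarith : 0 < (1 - t) * ‖x k‖ + t).ne'
  · intro x hx
    change mk v x = _
    congr 1
    funext j
    by_cases hj : j ∈ τ
    · simp only [hj, if_true]
      have := ph_mul_norm (mem_Uo.1 hx j hj)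
      rw [mul_comm] at this
      simpa using this.symm
    · simp [hj]
  · intro x hx
    have e : (dnC v τ ⟨mk v x, hx⟩ : kT v τ → Circle) = dn v τ x := dnC_mk v τ _ _
    change mk v (up v τ (dnC v τ ⟨mk v x, hx⟩ : kT v τ → Circle)) = _
    rw [e]
    obtain ⟨χ, hχ, hh⟩ := ext_char (fun j : τ => v j) (fun j => ph (x j) * (upT v τ (dn v τ x) j)⁻¹) (by
      intro m hm
      have hK : m ∈ KT v τ := hm
      have := LinearMap.congr_fun (HT_upT v τ (dn v τ x)) m
      rw [HK_dn, LinearMap.comp_apply, rT_spec v τ ⟨m, hK⟩, LinearMap.comp_apply] at this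
      have := congrArg Additive.toMul this
      simp only [HT, Fintype.linearCombination_apply, toMul_sum, toMul_zsmul, toMul_ofMul] at this
      simp only [mul_zpow, Finset.prod_mul_distrib, inv_zpow, Finset.prod_inv_distrib]
      rw [this]
      exact mul_inv_cancel _)
    refine mk_eq.2 ⟨χ, hχ, fun j => ?_⟩
    by_cases hj : j ∈ τ
    · simp only [hj, if_true]
      rw [up_mem v τ _ hj, hh ⟨j, hj⟩]
      rw [← Circle.coe_mul, inv_mul_cancel_right]
      simp
    · simp [hj, up_not]

def univC (Y : Type) [TopologicalSpace Y] : C((Set.univ : Set Y), Y) := ⟨Subtype.val, continuous_subtype_val⟩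

lemma dn_pow (u : ℕ) (x : ι → ℂ) (hx : mk v x ∈ Uo v τ) : dn v τ (fun j => x j ^ u) = (dn v τ x) ^ u := by
  funext i
  have e : (fun j : τ => ph (x j ^ u)) = fun j : τ => ph (x j) ^ u :=
    funext fun j => ph_pow (mem_Uo.1 hx j j.2) u
  rw [Pi.pow_apply, dn, e, dn]
  simp only [HT, Fintype.linearCombination_apply, toMul_sum, toMul_zsmul, toMul_ofMul, ← Finset.prod_pow]
  refine Finset.prod_congr rfl fun j _ => ?_
  rw [← zpow_natCast, ← zpow_natCast, zpow_comm]

lemma Uo_uiso {u : ℕ} (hu : u ≠ 0) (n : ℕ) : UIso (u : ℤ) (hmap (res (Phi v u) (pm_Uo _ _ _ τ)) n) := by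
  have b1 : Function.Bijective (hmap (dnC v τ) n) :=
    (hequiv (dnC v τ) (upC v τ) (upC_dnC v τ) (by rw [dnC_upC])  n).bijective
  let vC : C(kT v τ → Circle, (Set.univ : Set (kT v τ → Circle))) := ⟨fun y => ⟨y, trivial⟩, by fun_prop⟩
  have b2 : Function.Bijective (hmap (univC (kT v τ → Circle)) n) :=
    (hequiv (univC (kT v τ → Circle)) vC (by exact ContinuousMap.Homotopic.refl _)
      (by exact ContinuousMap.Homotopic.refl _) n).bijective
  have b : Function.Bijective (hmap ((univC (kT v τ → Circle)).comp (dnC v τ)) n) := by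
    rw [hmap_comp]; exact b2.comp b1
  refine UIso.conj (pw_uiso (κ := kT v τ) hu n) b b ?_
  rw [← hmap_comp, ← hmap_comp]
  congr 1
  apply ContinuousMap.ext
  rintro ⟨p, hp⟩
  obtain ⟨x, rfl⟩ := mk_surj p
  have e : (dnC v τ ⟨mk v x, hp⟩ : kT v τ → Circle) = dn v τ x := dnC_mk v τ _ _
  have hp' : mk v (fun j => x j ^ u) ∈ Uo v τ := mem_Uo.2 fun k hk => pow_ne_zero _ (mem_Uo.1 hp k hk)
  have e' : (dnC v τ ⟨_, hp'⟩ : kT v τ → Circle) = dn v τ (fun j => x j ^ u) := dnC_mk v τ _ _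
  have e2 : res (Phi v u) (pm_Uo _ _ _ τ) ⟨mk v x, hp⟩ = ⟨_, hp'⟩ := Subtype.ext (pm_mk _ _ _ x)
  change (dnC v τ (res (Phi v u) _ ⟨mk v x, hp⟩) : kT v τ → Circle) = (dnC v τ ⟨mk v x, hp⟩ : kT v τ → Circle) ^ u
  rw [e2, e', e, dn_pow v τ u x hp]
end strata
end OSH

namespace OSH
set_option linter.unusedSectionVars false
section pmuiso
variable {ι : Type} {A : Type} [AddCommGroup A] [Module.Free ℤ A] [Module.Finite ℤ A] (v : ι → A)

def PU (u : ℕ) (W : Set (Q v)) : Prop :=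
  ∃ hW : Set.MapsTo (Phi v u) W W, ∀ n, UIso (u : ℤ) (hmap (res (Phi v u) hW) n)

lemma PU_inter {u : ℕ} (hu : u ≠ 0) (s τ : Finset ι) : PU v u (Xo v s ∩ Uo v τ) := by
  classical
  induction s using Finset.induction_on generalizing τ with
  | empty =>
    have e : Xo v (∅ : Finset ι) ∩ Uo v τ = ∅ := by
      ext p; simp [Xo]
    rw [e]
    refine ⟨fun _ h => h.elim, fun n => ?_⟩
    have : res (Phi v u) (fun _ h => h.elim : Set.MapsTo (Phi v u) ∅ ∅) = ContinuousMap.id _ :=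
      ContinuousMap.ext fun p => p.2.elim
    rw [this, hmap_id]
    exact UIso.of_bij Function.bijective_id
  | insert k s hk ih =>
    have e1 : Xo v (insert k s) ∩ Uo v τ = (Xo v s ∩ Uo v τ) ∪ Uo v (insert k τ) := by
      ext p
      simp only [Xo, Uo, Set.mem_inter_iff, Set.mem_union, Set.mem_ofPred_eq, Finset.mem_insert,
        exists_eq_or_imp, forall_eq_or_imp]
      rw [or_and_right, or_comm]
    have e2 : (Xo v s ∩ Uo v τ) ∩ Uo v (insert k τ) = Xo v s ∩ Uo v (insert k τ) := by
      ext p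
      simp only [Xo, Uo, Set.mem_inter_iff, Set.mem_ofPred_eq, Finset.mem_insert, forall_eq_or_imp]
      tauto
    rw [e1]
    obtain ⟨h1, h2⟩ := ih τ
    obtain ⟨h3, h4⟩ : PU v u ((Xo v s ∩ Uo v τ) ∩ Uo v (insert k τ)) := e2 ▸ ih (insert k τ)
    exact ⟨h1.union_union (pm_Uo _ _ _ _), five ((isOpen_Xo s).inter (isOpen_Uo τ)) (isOpen_Uo _)
      ((isOpen_Xo s).inter (isOpen_Uo τ)) (isOpen_Uo _) (Phi v u) h1 (pm_Uo _ _ _ _) h2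
      (Uo_uiso v _ hu) h4⟩

lemma PU_Xo {u : ℕ} (hu : u ≠ 0) (s : Finset ι) : PU v u (Xo v s) := by
  have e : Xo v s ∩ Uo v ∅ = Xo v s := by
    ext p; simp [Uo]
  exact e ▸ PU_inter v hu s ∅

variable {v} {v' : ι → A}
lemma pm_comp {a b : ι → ℕ} {c d : ℕ} (hac : ∀ j, a j • v j = c • v' j) (hbd : ∀ j, b j • v' j = d • v j)
    {u : ℕ} (hab : ∀ j, a j * b j = u) (s : Finset ι) :
    (res (pm b d hbd) (pm_Xo b d hbd s)).comp (res (pm a c hac) (pm_Xo a c hac s)) =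
      res (Phi v u) (pm_Xo _ _ _ s) := by
  apply ContinuousMap.ext
  rintro ⟨p, hp⟩
  obtain ⟨x, rfl⟩ := mk_surj p
  apply Subtype.ext
  change pm b d hbd (pm a c hac (mk v x)) = Phi v u (mk v x)
  rw [Phi, pm_mk, pm_mk, pm_mk]
  congr 1
  funext j
  rw [← pow_mul, hab]

lemma pm_uiso {a b : ι → ℕ} {c d : ℕ} (hac : ∀ j, a j • v j = c • v' j) (hbd : ∀ j, b j • v' j = d • v j)
    {u : ℕ} (hu : u ≠ 0) (hab : ∀ j, a j * b j = u) (s : Finset ι) (n : ℕ) :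
    UIso (u : ℤ) (hmap (res (pm a c hac) (pm_Xo a c hac s)) n) := by
  refine UIso.two_of_six (g := hmap (res (pm b d hbd) (pm_Xo b d hbd s)) n) ?_ ?_
  · rw [← hmap_comp, pm_comp hac hbd hab]
    exact (PU_Xo v hu s).choose_spec n
  · rw [← hmap_comp, pm_comp hbd hac (fun j => (mul_comm _ _).trans (hab j))]
    exact (PU_Xo v' hu s).choose_spec n
end pmuiso
end OSH

namespace OSH
section contractible
lemma homotopic_of_eq {X Y : Type} [TopologicalSpace X] [TopologicalSpace Y] {f g : C(X, Y)} (hfg : ∀ x, f x = g x) :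
    f.Homotopic g := by
  rw [ContinuousMap.ext hfg]

lemma h_punit (n : ℕ) (z : h PUnit n) : z = 0 := by
  let a : Dl 1 := vert 1 0
  let σ : C(Dl 1, PUnit) := ContinuousMap.const _ PUnit.unit
  have hsurj : ∀ m (x : Ch PUnit m), ∃ y : E (Dl 1) m, real σ y = x := by
    intro m x
    induction x using Finsupp.induction_linear with
    | zero => exact ⟨0, map_zero _⟩
    | add x y hx hy =>
      obtain ⟨p, rfl⟩ := hx
      obtain ⟨q, rfl⟩ := hy
      exact ⟨p + q, map_add _ _ _⟩
    | single τ c =>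
      refine ⟨Finsupp.single (fun _ => a) c, ?_⟩
      rw [real_single]
      congr 1
  let S : ∀ m, Ch PUnit m →ₗ[ℤ] Ch PUnit (m + 1) := fun m =>
    Finsupp.linearCombination ℤ fun _ => Finsupp.single (ContinuousMap.const _ PUnit.unit) 1
  have hS : ∀ m (w : E (Dl 1) m), S m (real σ w) = real σ (cone a w) := by
    intro m w
    suffices H : (S m).comp (real σ) = (real σ).comp (cone a) from LinearMap.congr_fun H w
    apply ext_single
    intro w
    rw [LinearMap.comp_apply, LinearMap.comp_apply, real_single, cone_single, real_single]
    simp only [S, Finsupp.linearCombination_single, one_smul]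
    congr 1
  obtain ⟨x, hx, rfl⟩ := kl_surj z
  rw [kl_eq_zero]
  obtain ⟨w, rfl⟩ := hsurj n x
  refine ⟨real σ (cone a w), ?_⟩
  rw [dC_real]
  cases n with
  | zero => rw [dE_cone_zero]
  | succ n =>
    have := hx.d_eq
    rw [dC_real] at this
    rw [dE_cone, map_sub, ← hS, this, map_zero, sub_zero]

lemma h_zero_of_contr {X : Type} [TopologicalSpace X] (p : X)
    (hp : (ContinuousMap.id X).Homotopic (ContinuousMap.const X p)) (n : ℕ) (z : h X n) : z = 0 := by
  have e : ContinuousMap.const X p =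
    (ContinuousMap.const PUnit p).comp (ContinuousMap.const X PUnit.unit) := rfl
  have := congrArg (fun f => f z) (hmap_homotopic hp n)
  simp only [hmap_id] at this
  rw [e, ← hmap_comp_apply, h_punit n (hmap _ n z), map_zero] at this
  exact this

/-- The homology of `X` is finitely generated free with ranks `d`. -/
def Good (X : Type) [TopologicalSpace X] (d : ℕ → ℤ) : Prop :=
  ∀ n, Module.Free ℤ (h X n) ∧ Module.Finite ℤ (h X n) ∧ (Module.finrank ℤ (h X n) : ℤ) = d n

lemma Good.equiv {X Y : Type} [TopologicalSpace X] [TopologicalSpace Y] {d : ℕ → ℤ} (hX : Good X d)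
    (f : C(X, Y)) (g : C(Y, X)) (h1 : (g.comp f).Homotopic (ContinuousMap.id X))
    (h2 : (f.comp g).Homotopic (ContinuousMap.id Y)) : Good Y d := by
  intro n
  obtain ⟨a, b, c⟩ := hX n
  let e := hequiv f g h1 h2 n
  exact ⟨Module.Free.of_equiv e, Module.Finite.equiv e, by rw [← e.finrank_eq, c]⟩

lemma Good.of_contr {X : Type} [TopologicalSpace X] (p : X)
    (hp : (ContinuousMap.id X).Homotopic (ContinuousMap.const X p)) : Good X 0 := by
  intro n
  have : Subsingleton (h X n) := ⟨fun a b => by rw [h_zero_of_contr p hp n a, h_zero_of_contr p hp n b]⟩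
  exact ⟨inferInstance, inferInstance, by simp [Module.finrank_zero_of_subsingleton]⟩

lemma Good.zero {X : Type} [TopologicalSpace X] {d : ℕ → ℤ} (hX : Good X d) {n : ℕ} (hn : d n = 0) (z : h X n) : z = 0 := by
  obtain ⟨a, b, c⟩ := hX n
  rw [hn] at c
  have := Module.finrank_eq_zero_iff_of_free (R := ℤ) (M := h X n)
  have := this.1 (by exact_mod_cast c)
  exact Subsingleton.elim _ _

variable {X : Type} [TopologicalSpace X] {U V : Set X}

/-- Mayer-Vietoris when the comparison maps vanish for degree reasons. -/
lemma Good.mv (hU : IsOpen U) (hV : IsOpen V) {d e : ℕ → ℤ} (gU : Good U 0) (gV : Good V d)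
    (gI : Good ↥(U ∩ V) e) (hp : ∀ n, d n = 0 ∨ e n = 0) :
    Good ↥(U ∪ V) (fun n => d n + match n with | 0 => 0 | m + 1 => e m) := by
  have kz : ∀ n (c : h ↥(U ∩ V) n), hmap (kV U V) n c = 0 := by
    intro n c
    rcases hp n with h0 | h0
    · exact gV.zero h0 _
    · rw [gI.zero h0 c, map_zero]
  have uz : ∀ n (c : h U n), c = 0 := fun n c => gU.zero rfl c
  have inj : ∀ n, Function.Injective (hmap (jV U V) n) := by
    intro n
    rw [injective_iff_map_eq_zero]
    intro y hy
    obtain ⟨c, -, hc⟩ := mv_mid (0 : h U n) y (by rw [map_zero, zero_add, hy]) hU hV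
    rw [kz] at hc
    exact neg_eq_zero.1 hc.symm
  intro n
  cases n with
  | zero =>
    obtain ⟨a, b, c⟩ := gV 0
    have sur : Function.Surjective (hmap (jV U V) 0) := by
      intro w
      obtain ⟨a, b, rfl⟩ := mv_zero hU hV w
      exact ⟨b, by rw [uz 0 a, map_zero, zero_add]⟩
    let ee := LinearEquiv.ofBijective (hmap (jV U V) 0) ⟨inj 0, sur⟩
    exact ⟨Module.Free.of_equiv ee, Module.Finite.equiv ee, by rw [← ee.finrank_eq, c]; simp⟩
  | succ n =>
    obtain ⟨a, b, c⟩ := gV (n + 1)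
    obtain ⟨a', b', c'⟩ := gI n
    have sur : Function.Surjective (delta hU hV n) := fun c => mv_bot hU hV c (uz _ _) (kz _ _)
    have ex : Function.Exact (hmap (jV U V) (n + 1)) (delta hU hV n) := by
      intro x
      constructor
      · intro hx
        obtain ⟨a, b, rfl⟩ := mv_top hU hV x hx
        exact ⟨b, by rw [uz _ a, map_zero, zero_add]⟩
      · rintro ⟨b, rfl⟩
        have := mv_top' hU hV (0 : h U (n + 1)) b
        rwa [map_zero, zero_add] at this
    obtain ⟨s, hs⟩ := Module.projective_lifting_property (delta hU hV n) LinearMap.id sur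
    let ee : h V (n + 1) × h ↥(U ∩ V) n →ₗ[ℤ] h ↥(U ∪ V) (n + 1) := (hmap (jV U V) (n + 1)).coprod s
    have hs' : ∀ y, delta hU hV n (s y) = y := LinearMap.congr_fun hs
    have hb : Function.Bijective ee := by
      constructor
      · rw [injective_iff_map_eq_zero]
        rintro ⟨x, y⟩ hxy
        have hxy : hmap (jV U V) (n + 1) x + s y = 0 := hxy
        have h1 := congrArg (delta hU hV n) hxy
        rw [map_add, hs', (ex _).2 ⟨x, rfl⟩, zero_add, map_zero] at h1
        subst h1
        rw [map_zero, add_zero] at hxy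
        rw [inj _ (hxy.trans (map_zero _).symm)]
        rfl
      · intro w
        obtain ⟨x, hx⟩ := (ex (w - s (delta hU hV n w))).1 (by rw [map_sub, hs', sub_self])
        exact ⟨(x, delta hU hV n w), by change hmap (jV U V) (n + 1) x + s (delta hU hV n w) = _; rw [hx, sub_add_cancel]⟩
    let e2 := LinearEquiv.ofBijective ee hb
    refine ⟨Module.Free.of_equiv e2, Module.Finite.equiv e2, ?_⟩
    rw [← e2.finrank_eq, Module.finrank_prod]
    push_cast
    rw [c, c']

end contractible

/-! ### Spheres -/
section spheres

def nz (E : Type) [Zero E] : Set E := {x | x ≠ 0}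

variable {E : Type} [NormedAddCommGroup E] [NormedSpace ℝ E]

def up' (E : Type) [NormedAddCommGroup E] (σ : ℝ) : Set (E × ℝ) := {p | p.1 ≠ 0 ∨ 0 < σ * p.2}

lemma isOpen_up' (σ : ℝ) : IsOpen (up' E σ) := by
  have h1 : IsOpen {p : E × ℝ | p.1 ≠ 0} := isOpen_ne.preimage continuous_fst
  have h2 : IsOpen {p : E × ℝ | 0 < σ * p.2} := isOpen_lt continuous_const (by fun_prop)
  exact h1.union h2

lemma up'_contr {σ : ℝ} (hσ : σ ^ 2 = 1) : Good (up' E σ) 0 := by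
  refine Good.of_contr ⟨(0, σ), Or.inr (by nlinarith)⟩ ⟨⟨⟨fun q =>
    ⟨((1 - (q.1 : ℝ)) • q.2.1.1, (1 - (q.1 : ℝ)) * q.2.1.2 + q.1 * σ), ?_⟩, ?_⟩, ?_, ?_⟩⟩
  · obtain ⟨⟨t, ht0, ht1⟩, ⟨⟨x, y⟩, hxy⟩⟩ := q
    by_cases hx : x = 0
    · right
      have hy : 0 < σ * y := by
        rcases hxy with h' | h'
        · exact (h' hx).elim
        · exact h'
      change 0 < σ * ((1 - t) * y + t * σ)
      have : σ * ((1 - t) * y + t * σ) = (1 - t) * (σ * y) + t := by linear_combination t * hσ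
      rw [this]
      rcases ht0.eq_or_lt with h0 | h0
      · rw [← h0]; simpa using hy
      · have := mul_nonneg (sub_nonneg.2 ht1) hy.le; linarith
    · rcases ht1.eq_or_lt with h0 | h0
      · right
        change 0 < σ * ((1 - t) * y + t * σ)
        rw [h0]; nlinarith
      · left
        exact smul_ne_zero (sub_pos.2 h0).ne' hx
  · refine Continuous.subtype_mk ?_ _
    fun_prop
  · intro q; apply Subtype.ext; simp
  · intro q; apply Subtype.ext; simp

lemma good_prod {d : ℕ → ℤ} (hE : Good (nz E) d) :
    Good (nz (E × ℝ)) (fun n => match n with | 0 => 0 | m + 1 => d m) := by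
  have e1 : up' E 1 ∪ up' E (-1) = nz (E × ℝ) := by
    ext ⟨x, y⟩
    simp only [up', nz, Set.mem_union, Set.mem_ofPred_eq, ne_eq, Prod.mk_eq_zero, one_mul, neg_mul, Left.neg_pos_iff]
    constructor
    · rintro ((h1 | h1) | (h1 | h1)) ⟨h2, h3⟩
      · exact h1 h2
      · exact h1.ne' h3
      · exact h1 h2
      · exact h1.ne h3
    · intro h1
      by_cases hx : x = 0
      · rcases lt_trichotomy y 0 with h2 | h2 | h2
        · exact Or.inr (Or.inr h2)
        · exact (h1 ⟨hx, h2⟩).elim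
        · exact Or.inl (Or.inr h2)
      · exact Or.inl (Or.inl hx)
  have e2 : ∀ p : E × ℝ, p ∈ up' E 1 ∩ up' E (-1) ↔ p.1 ≠ 0 := by
    rintro ⟨x, y⟩
    simp only [up', Set.mem_inter_iff, Set.mem_ofPred_eq, one_mul, neg_mul, Left.neg_pos_iff]
    constructor
    · rintro ⟨h1 | h1, h2 | h2⟩
      · exact h1
      · exact h1
      · exact h2
      · exact (lt_asymm h1 h2).elim
    · exact fun h1 => ⟨Or.inl h1, Or.inl h1⟩
  have gI : Good ↥(up' E 1 ∩ up' E (-1)) d := by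
    refine hE.equiv ⟨fun x => ⟨(x.1, 0), (e2 _).2 x.2⟩, Continuous.subtype_mk (by fun_prop) _⟩
      ⟨fun p => ⟨p.1.1, (e2 _).1 p.2⟩, Continuous.subtype_mk (by fun_prop) _⟩ ?_ ?_
    · exact ContinuousMap.Homotopic.refl _
    · refine ⟨⟨⟨fun q => ⟨(q.2.1.1, (q.1 : ℝ) * q.2.1.2), (e2 _).2 (show q.2.1.1 ≠ 0 from (e2 q.2.1).1 q.2.2)⟩, ?_⟩, ?_, ?_⟩⟩
      · exact Continuous.subtype_mk (by fun_prop) _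
      · intro q; apply Subtype.ext; simp
      · intro q; apply Subtype.ext; simp
  have := Good.mv (isOpen_up' 1) (isOpen_up' (-1)) (up'_contr (E := E) (by norm_num)) (up'_contr (by norm_num)) gI
    (fun n => Or.inl rfl)
  rw [e1] at this
  refine fun n => ?_
  obtain ⟨a, b, c⟩ := this n
  exact ⟨a, b, by simpa using c⟩

lemma good_empty {X : Type} [TopologicalSpace X] [IsEmpty X] : Good X (fun n => if n = 0 then 1 else 0) := by
  have he : ∀ n, IsEmpty C(Dl (n + 1), X) := fun n => ⟨fun f => isEmptyElim (f (vert _ 0))⟩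
  intro n
  cases n with
  | succ n =>
    have : Subsingleton (h X (n + 1)) := by
      refine ⟨fun a b => ?_⟩
      obtain ⟨x, hx, rfl⟩ := kl_surj a
      obtain ⟨y, hy, rfl⟩ := kl_surj b
      have := he n
      have : Subsingleton (Ch X (n + 1)) := inferInstanceAs (Subsingleton (C(Dl (n+1), X) →₀ ℤ))
      have : x = y := Subsingleton.elim _ _
      subst this
      rfl
    exact ⟨inferInstance, inferInstance, by simp [Module.finrank_zero_of_subsingleton]⟩
  | zero =>
    have h0 : IsEmpty (Dl 0) := ⟨fun t => by simpa using t.2.2⟩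
    let σ : C(Dl 0, X) := ⟨isEmptyElim, continuous_of_discreteTopology⟩
    have hu : Unique C(Dl 0, X) := ⟨⟨σ⟩, fun f => ContinuousMap.ext isEmptyElim⟩
    let e : Ch X 0 ≃ₗ[ℤ] ℤ := Finsupp.LinearEquiv.finsuppUnique ℤ ℤ _
    let f : Ch X 0 →ₗ[ℤ] h X 0 :=
      { toFun := fun x => kl x (Cyc.zero_deg x), map_add' := fun _ _ => rfl, map_smul' := fun _ _ => rfl }
    have hf : Function.Bijective f := by
      constructor
      · rw [injective_iff_map_eq_zero]
        intro x hx
        obtain ⟨y, rfl⟩ := kl_eq_zero.1 hx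
        have := he 0
        have : Subsingleton (Ch X 1) := inferInstanceAs (Subsingleton (C(Dl 1, X) →₀ ℤ))
        rw [Subsingleton.elim y 0, map_zero]
      · intro a
        obtain ⟨x, hx, rfl⟩ := kl_surj a
        exact ⟨x, rfl⟩
    let ee := e.symm.trans (LinearEquiv.ofBijective f hf)
    exact ⟨Module.Free.of_equiv ee, Module.Finite.equiv ee, by rw [← ee.finrank_eq]; simp⟩

lemma Good.clequiv {F : Type} [NormedAddCommGroup F] [NormedSpace ℝ F] {d : ℕ → ℤ} (hE : Good (nz E) d) (e : E ≃L[ℝ] F) :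
    Good (nz F) d := by
  refine hE.equiv ⟨fun x => ⟨e x.1, fun h0 => x.2 (by simpa using h0)⟩, Continuous.subtype_mk (by fun_prop) _⟩
    ⟨fun x => ⟨e.symm x.1, fun h0 => x.2 (by simpa using h0)⟩, Continuous.subtype_mk (by fun_prop) _⟩ ?_ ?_
  · refine homotopic_of_eq fun x => Subtype.ext ?_
    exact e.symm_apply_apply _
  · refine homotopic_of_eq fun x => Subtype.ext ?_
    exact e.apply_symm_apply _

theorem good_sphere (E : Type) [NormedAddCommGroup E] [NormedSpace ℝ E] [FiniteDimensional ℝ E] :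
    Good (nz E) (fun n => if n = Module.finrank ℝ E then 1 else 0) := by
  generalize hd : Module.finrank ℝ E = d
  induction d generalizing E with
  | zero =>
    have : Subsingleton E := Module.finrank_zero_iff.1 hd
    have : IsEmpty (nz E) := ⟨fun x => x.2 (Subsingleton.elim _ _)⟩
    exact good_empty
  | succ d ih =>
    have h1 := good_prod (ih (EuclideanSpace ℝ (Fin d)) (by simp))
    have e : (EuclideanSpace ℝ (Fin d) × ℝ) ≃L[ℝ] E := ContinuousLinearEquiv.ofFinrankEq (by simp [hd])
    intro n
    obtain ⟨a, b, c⟩ := h1.clequiv e n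
    refine ⟨a, b, c.trans ?_⟩
    cases n with
    | zero => simp
    | succ n => simp
end spheres
end OSH

namespace OSH
section hequivs
set_option linter.unusedSectionVars false
variable {ι : Type} [DecidableEq ι] {A B : Type} [AddCommGroup A] [AddCommGroup B] (v : ι → A)

lemma ph_cont_coe {Z : Type} [TopologicalSpace Z] {S : Set Z} {f : Z → ℂ} (hf : ContinuousOn f S) (h0 : ∀ z ∈ S, f z ≠ 0) (m : ℤ) :
    ContinuousOn (fun z => ((ph (f z) ^ m : Circle) : ℂ)) S := by
  refine Continuous.comp_continuousOn (g := fun z : Circle => ((z ^ m : Circle) : ℂ))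
    (continuous_subtype_val.comp (continuous_zpow m)) ?_
  exact ph_cont.comp hf h0

lemma pos_aux {t a : ℝ} (ht : t ∈ unitInterval) (ha : 0 < a) : 0 < (1 - t) * a + t := by
  rcases ht.1.eq_or_lt with h0 | h0
  · rw [← h0]; simpa using ha
  · have : 0 ≤ (1 - t) * a := mul_nonneg (by linarith [ht.2]) ha.le
    linarith

variable {v}
/-- (e) -/
lemma good_Uo (j : ι) (l : A →ₗ[ℤ] ℤ) (hl : l (v j) ≠ 0) : Good (Uo v {j}) 0 := by
  refine Good.of_contr ⟨mk v (Pi.single j 1), mem_Uo.2 (by simp)⟩ ?_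
  refine qhomotopic (isOpen_Uo _) _ _ (fun t x => mk v fun k => if k = j then
    (((1 - t) * ‖x k‖ + t : ℝ) : ℂ) * ((ph (x j) ^ (1 : ℤ) : Circle) : ℂ) else ((1 - t : ℝ) : ℂ) * x k) ?_ ?_ ?_ ?_ ?_
  · refine mk_oq.continuous.comp_continuousOn (continuousOn_pi.2 fun k => ?_)
    by_cases hj : k = j
    · simp only [hj, if_true]
      refine ContinuousOn.mul (by fun_prop) ?_
      exact ph_cont_coe (by fun_prop) (fun x hx => mem_Uo.1 hx j (by simp)) 1
    · simp only [hj, if_false]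
      fun_prop
  · intro t ht x χ hχ hx
    refine (mk_eq.2 ⟨χ, hχ, fun k => ?_⟩).symm
    by_cases hj : k = j
    · subst hj
      simp only [if_true, zpow_one]
      rw [ph_circle_mul _ (mem_Uo.1 hx k (by simp)), norm_mul, Circle.norm_coe, one_mul, Circle.coe_mul]
      ring
    · simp only [hj, if_false]
      ring
  · intro t ht x hx
    refine mem_Uo.2 fun k hk => ?_
    obtain rfl := Finset.mem_singleton.1 hk
    simp only [if_true]
    refine mul_ne_zero ?_ (Circle.coe_ne_zero _)
    exact_mod_cast (pos_aux ht (norm_pos_iff.2 (mem_Uo.1 hx k hk))).ne'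
  · intro x hx
    change mk v x = _
    congr 1
    funext k
    by_cases hj : k = j
    · subst hj
      simp only [if_true, zpow_one]
      have := ph_mul_norm (mem_Uo.1 hx k (by simp))
      rw [mul_comm] at this
      simpa using this.symm
    · simp [hj]
  · intro x hx
    change mk v (Pi.single j 1) = _
    obtain ⟨c, hc⟩ := circle_root (ph (x j)) hl
    refine mk_eq.2 ⟨_, isC_zpow c l, fun k => ?_⟩
    by_cases hj : k = j
    · subst hj
      simp [hc]
    · simp [hj]

/-- (h) -/
lemma good_coloop {s : Finset ι} {j : ι} (hjs : j ∈ s) (l : A →ₗ[ℤ] ℤ) (hl : l (v j) ≠ 0) (hk : ∀ k, k ≠ j → l (v k) = 0) :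
    Good (Xo v s) 0 := by
  refine Good.of_contr ⟨mk v (Pi.single j 1), mem_Xo.2 ⟨j, hjs, by simp⟩⟩ ?_
  refine qhomotopic (isOpen_Xo _) _ _ (fun t x => mk v fun k => if k = j then
    (((1 - t) * ‖x k‖ + t : ℝ) : ℂ) else ((1 - t : ℝ) : ℂ) * x k) ?_ ?_ ?_ ?_ ?_
  · refine mk_oq.continuous.comp_continuousOn (continuousOn_pi.2 fun k => ?_)
    by_cases hj : k = j
    · simp only [hj, if_true]
      fun_prop
    · simp only [hj, if_false]
      fun_prop
  · intro t ht x χ hχ hx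
    obtain ⟨c, hc⟩ := circle_root (χ (v j))⁻¹ hl
    refine (mk_eq.2 ⟨_, hχ.mul (isC_zpow c l), fun k => ?_⟩).symm
    by_cases hj : k = j
    · subst hj
      simp [hc, Circle.norm_coe]
    · simp only [hj, if_false, hk k hj, zpow_zero, mul_one]
      ring
  · intro t ht x hx
    obtain ⟨k, hks, hxk⟩ := mem_Xo.1 hx
    rcases ht.1.eq_or_lt with h0 | h0
    · refine mem_Xo.2 ⟨k, hks, ?_⟩
      rw [← h0]
      by_cases hj : k = j
      · simp [hj]; simpa [hj] using hxk
      · simpa [hj] using hxk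
    · refine mem_Xo.2 ⟨j, hjs, ?_⟩
      simp only [if_true]
      have : 0 ≤ (1 - t) * ‖x j‖ := mul_nonneg (by linarith [ht.2]) (norm_nonneg _)
      exact_mod_cast (by linarith : 0 < (1 - t) * ‖x j‖ + t).ne'
  · intro x hx
    change mk v x = _
    obtain ⟨c, hc⟩ := circle_root (ph (x j))⁻¹ hl
    refine mk_eq.2 ⟨_, isC_zpow c l, fun k => ?_⟩
    by_cases hj : k = j
    · subst hj
      simp only [hc, if_true]
      by_cases hx0 : x k = 0
      · simp [hx0]
      · have := ph_mul_norm hx0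
        rw [Circle.coe_inv, eq_inv_mul_iff_mul_eq₀ (Circle.coe_ne_zero _)]
        simpa using this
    · simp [hj, hk k hj]
  · intro x hx
    change mk v (Pi.single j 1) = _
    congr 1
    funext k
    by_cases hj : k = j
    · subst hj
      simp
    · simp [hj]

/-! contraction -/
def con (v : ι → A) (j : ι) (l : A →ₗ[ℤ] ℤ) (k : ι) : A := v k - l (v k) • v j

lemma isOpen_UX (j : ι) (s : Finset ι) : IsOpen (Uo v {j} ∩ Xo v s) := (isOpen_Uo _).inter (isOpen_Xo _)

def gdn (v : ι → A) (j : ι) (l : A →ₗ[ℤ] ℤ) (x : ι → ℂ) (k : ι) : ℂ :=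
  if k = j then 0 else x k * ((ph (x j) ^ (- l (v k)) : Circle) : ℂ)

def gdnC (v : ι → A) (j : ι) (l : A →ₗ[ℤ] ℤ) (s : Finset ι) (hjs : j ∉ s) :
    C(↥(Uo v {j} ∩ Xo v s), ↥(Xo (con v j l) s)) :=
  qlift (isOpen_UX j s) (fun x => mk (con v j l) (gdn v j l x)) (by
    refine mk_oq.continuous.comp_continuousOn (continuousOn_pi.2 fun k => ?_)
    by_cases hj : k = j
    · simp only [gdn, hj, if_true]
      fun_prop
    · simp only [gdn, hj, if_false]
      exact ContinuousOn.mul (by fun_prop) (ph_cont_coe (by fun_prop) (fun x hx => mem_Uo.1 hx.1 j (by simp)) _))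
  (by
    intro x χ hχ hx
    refine (mk_eq.2 ⟨χ, hχ, fun k => ?_⟩).symm
    by_cases hj : k = j
    · simp only [gdn, hj, if_true, mul_zero]
    · simp only [gdn, hj, if_false]
      rw [ph_circle_mul _ (mem_Uo.1 hx.1 j (by simp)), con, hχ.sub, hχ.zsmul, mul_zpow, Circle.coe_mul, Circle.coe_mul, zpow_neg (χ (v j))]
      ring)
  (by
    intro x hx
    obtain ⟨k, hks, hxk⟩ := mem_Xo.1 hx.2
    refine mem_Xo.2 ⟨k, hks, ?_⟩
    have hj : k ≠ j := fun h => hjs (h ▸ hks)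
    simp only [gdn, hj, if_false]
    exact mul_ne_zero hxk (Circle.coe_ne_zero _))

lemma gdnC_mk (j : ι) (l : A →ₗ[ℤ] ℤ) (s : Finset ι) (hjs : j ∉ s) (x : ι → ℂ) (hx : mk v x ∈ Uo v {j} ∩ Xo v s) :
    (gdnC v j l s hjs ⟨mk v x, hx⟩ : Q (con v j l)) = mk (con v j l) (gdn v j l x) :=
  qlift_mk _ _ _ _ _ _ _

def gupC (v : ι → A) (j : ι) (l : A →ₗ[ℤ] ℤ) (hl : l (v j) = 1) (s : Finset ι) (hjs : j ∉ s) :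
    C(↥(Xo (con v j l) s), ↥(Uo v {j} ∩ Xo v s)) :=
  qlift (isOpen_Xo s) (fun y => mk v (fun k => if k = j then 1 else y k)) (by
    refine mk_oq.continuous.comp_continuousOn (continuousOn_pi.2 fun k => ?_)
    by_cases hj : k = j
    · simp only [hj, if_true]
      fun_prop
    · simp only [hj, if_false]
      fun_prop)
  (by
    intro x χ hχ hx
    refine (mk_eq.2 ⟨fun a => χ (a - l a • v j), fun a b => by
      rw [← hχ]
      change χ (a + b - l (a + b) • v j) = _
      rw [map_add, add_smul]
      congr 1
      abel, fun k => ?_⟩).symm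
    by_cases hj : k = j
    · subst hj
      simp [hl, hχ.zero]
    · simp only [hj, if_false]
      rfl)
  (by
    intro x hx
    refine ⟨mem_Uo.2 (by simp), ?_⟩
    obtain ⟨k, hks, hxk⟩ := mem_Xo.1 hx
    refine mem_Xo.2 ⟨k, hks, ?_⟩
    have hj : k ≠ j := fun h => hjs (h ▸ hks)
    simpa only [hj, if_false] using hxk)

lemma gupC_mk (j : ι) (l : A →ₗ[ℤ] ℤ) (hl : l (v j) = 1) (s : Finset ι) (hjs : j ∉ s) (x : ι → ℂ) (hx : mk (con v j l) x ∈ Xo (con v j l) s) :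
    (gupC v j l hl s hjs ⟨mk (con v j l) x, hx⟩ : Q v) = mk v (fun k => if k = j then 1 else x k) :=
  qlift_mk _ _ _ _ _ _ _

/-- (g) -/
lemma good_con {j : ι} {l : A →ₗ[ℤ] ℤ} (hl : l (v j) = 1) {s : Finset ι} (hjs : j ∉ s) {d : ℕ → ℤ}
    (hg : Good (Xo (con v j l) s) d) : Good ↥(Uo v {j} ∩ Xo v s) d := by
  refine hg.equiv (gupC v j l hl s hjs) (gdnC v j l s hjs) ?_ ?_
  · refine qhomotopic (isOpen_Xo s) _ _ (fun t x => mk _ fun k => if k = j then (t : ℂ) * x k else x k) ?_ ?_ ?_ ?_ ?_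
    · refine mk_oq.continuous.comp_continuousOn (continuousOn_pi.2 fun k => ?_)
      by_cases hj : k = j
      · simp only [hj, if_true]
        fun_prop
      · simp only [hj, if_false]
        fun_prop
    · intro t ht x χ hχ hx
      refine (mk_eq.2 ⟨χ, hχ, fun k => ?_⟩).symm
      split_ifs <;> ring
    · intro t ht x hx
      obtain ⟨k, hks, hxk⟩ := mem_Xo.1 hx
      refine mem_Xo.2 ⟨k, hks, ?_⟩
      have hj : k ≠ j := fun h => hjs (h ▸ hks)
      simpa only [hj, if_false] using hxk
    · intro x hx
      have e : gupC v j l hl s hjs ⟨mk _ x, hx⟩ = ⟨mk v (fun k => if k = j then 1 else x k), by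
        rw [← gupC_mk j l hl s hjs x hx]; exact Subtype.property _⟩ := Subtype.ext (gupC_mk j l hl s hjs x hx)
      rw [ContinuousMap.comp_apply, e]
      refine (gdnC_mk j l s hjs _ _).trans ?_
      congr 1
      funext k
      by_cases hj : k = j
      · simp [gdn, hj]
      · have : ph 1 = 1 := by simpa using ph_pos one_pos
        simp [gdn, hj, this]
    · intro x hx
      change mk _ x = _
      congr 1
      funext k
      by_cases hj : k = j <;> simp [hj]
  · refine ContinuousMap.Homotopic.symm ?_
    refine qhomotopic (isOpen_UX j s) _ _ (fun t x => mk v fun k => if k = j then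
      (((1 - t) * ‖x k‖ + t : ℝ) : ℂ) * ((ph (x j) ^ (1 : ℤ) : Circle) : ℂ) else x k) ?_ ?_ ?_ ?_ ?_
    · refine mk_oq.continuous.comp_continuousOn (continuousOn_pi.2 fun k => ?_)
      by_cases hj : k = j
      · simp only [hj, if_true]
        refine ContinuousOn.mul (by fun_prop) ?_
        exact ph_cont_coe (by fun_prop) (fun x hx => mem_Uo.1 hx.1 j (by simp)) 1
      · simp only [hj, if_false]
        fun_prop
    · intro t ht x χ hχ hx
      refine (mk_eq.2 ⟨χ, hχ, fun k => ?_⟩).symm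
      by_cases hj : k = j
      · subst hj
        simp only [if_true, zpow_one]
        rw [ph_circle_mul _ (mem_Uo.1 hx.1 k (by simp)), norm_mul, Circle.norm_coe, one_mul, Circle.coe_mul]
        ring
      · simp only [hj, if_false]
    · intro t ht x hx
      refine ⟨mem_Uo.2 fun k hk => ?_, ?_⟩
      · obtain rfl := Finset.mem_singleton.1 hk
        simp only [if_true]
        refine mul_ne_zero ?_ (Circle.coe_ne_zero _)
        exact_mod_cast (pos_aux ht (norm_pos_iff.2 (mem_Uo.1 hx.1 k hk))).ne'
      · obtain ⟨k, hks, hxk⟩ := mem_Xo.1 hx.2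
        refine mem_Xo.2 ⟨k, hks, ?_⟩
        have hj : k ≠ j := fun h => hjs (h ▸ hks)
        simpa only [hj, if_false] using hxk
    · intro x hx
      change mk v x = _
      congr 1
      funext k
      by_cases hj : k = j
      · subst hj
        simp only [if_true, zpow_one]
        have := ph_mul_norm (mem_Uo.1 hx.1 k (by simp))
        rw [mul_comm] at this
        simpa using this.symm
      · simp [hj]
    · intro x hx
      have e : gdnC v j l s hjs ⟨mk _ x, hx⟩ = ⟨mk _ (gdn v j l x), by
        rw [← gdnC_mk j l s hjs x hx]; exact Subtype.property _⟩ := Subtype.ext (gdnC_mk j l s hjs x hx)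
      rw [ContinuousMap.comp_apply, e]
      refine (gupC_mk j l hl s hjs _ _).trans ?_
      refine mk_eq.2 ⟨_, isC_zpow (ph (x j)) l, fun k => ?_⟩
      by_cases hj : k = j
      · subst hj
        simp [hl]
      · simp only [hj, if_false, gdn]
        rw [mul_left_comm, ← Circle.coe_mul, ← zpow_add, add_neg_cancel]
        simp

/-! truncation -/
def trC (v : ι → A) (v' : ι → B) (s : Finset ι) (hr : ∀ m : s → ℤ, ∑ k, m k • v' k = 0 → ∑ k, m k • v k = 0) :
    C(↥(Xo v s), ↥(Xo v' s)) :=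
  qlift (isOpen_Xo s) (fun x => mk v' (fun k => if k ∈ s then x k else 0)) (by
    refine mk_oq.continuous.comp_continuousOn (continuousOn_pi.2 fun k => ?_)
    by_cases hj : k ∈ s
    · simp only [hj, if_true]
      fun_prop
    · simp only [hj, if_false]
      fun_prop)
  (by
    intro x χ hχ hx
    obtain ⟨ψ, hψ, hh⟩ := ext_char (fun k : s => v' k) (fun k : s => χ (v k)) (by
      intro m hm
      have := congrArg χ (hr m hm)
      rw [hχ.sum, hχ.zero] at this
      simpa only [hχ.zsmul] using this)
    refine (mk_eq.2 ⟨ψ, hψ, fun k => ?_⟩).symm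
    by_cases hj : k ∈ s
    · simp only [hj, if_true]
      rw [hh ⟨k, hj⟩]
    · simp only [hj, if_false, mul_zero])
  (by
    intro x hx
    obtain ⟨k, hks, hxk⟩ := mem_Xo.1 hx
    exact mem_Xo.2 ⟨k, hks, by simpa only [hks, if_true] using hxk⟩)

lemma trC_mk (v' : ι → B) (s : Finset ι) (hr : ∀ m : s → ℤ, ∑ k, m k • v' k = 0 → ∑ k, m k • v k = 0)
    (x : ι → ℂ) (hx : mk v x ∈ Xo v s) :
    (trC v v' s hr ⟨mk v x, hx⟩ : Q v') = mk v' (fun k => if k ∈ s then x k else 0) :=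
  qlift_mk _ _ _ _ _ _ _

lemma trC_trC (v' : ι → B) (s : Finset ι) (hr : ∀ m : s → ℤ, ∑ k, m k • v' k = 0 → ∑ k, m k • v k = 0)
    (hr' : ∀ m : s → ℤ, ∑ k, m k • v k = 0 → ∑ k, m k • v' k = 0) :
    ((trC v' v s hr').comp (trC v v' s hr)).Homotopic (ContinuousMap.id _) := by
  refine qhomotopic (isOpen_Xo s) _ _ (fun t x => mk _ fun k => if k ∈ s then x k else (t : ℂ) * x k) ?_ ?_ ?_ ?_ ?_
  · refine mk_oq.continuous.comp_continuousOn (continuousOn_pi.2 fun k => ?_)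
    by_cases hj : k ∈ s
    · simp only [hj, if_true]
      fun_prop
    · simp only [hj, if_false]
      fun_prop
  · intro t ht x χ hχ hx
    refine (mk_eq.2 ⟨χ, hχ, fun k => ?_⟩).symm
    split_ifs <;> ring
  · intro t ht x hx
    obtain ⟨k, hks, hxk⟩ := mem_Xo.1 hx
    exact mem_Xo.2 ⟨k, hks, by simpa only [hks, if_true] using hxk⟩
  · intro x hx
    have e : trC v v' s hr ⟨mk _ x, hx⟩ = ⟨mk v' (fun k => if k ∈ s then x k else 0), by
      rw [← trC_mk v' s hr x hx]; exact Subtype.property _⟩ := Subtype.ext (trC_mk v' s hr x hx)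
    rw [ContinuousMap.comp_apply, e]
    refine (trC_mk v s hr' _ _).trans ?_
    congr 1
    funext k
    by_cases hj : k ∈ s <;> simp [hj]
  · intro x hx
    change mk _ x = _
    congr 1
    funext k
    by_cases hj : k ∈ s <;> simp [hj]

lemma good_trunc (v' : ι → B) (s : Finset ι) (hr : ∀ m : s → ℤ, ∑ k, m k • v' k = 0 ↔ ∑ k, m k • v k = 0)
    {d : ℕ → ℤ} (hg : Good (Xo v' s) d) : Good (Xo v s) d :=
  hg.equiv (trC v' v s fun m => (hr m).2) (trC v v' s fun m => (hr m).1) (trC_trC _ _ _ _) (trC_trC _ _ _ _)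

/-! rank zero -/
lemma good_zero (s : Finset ι) (hv : ∀ k ∈ s, v k = 0) :
    Good (Xo v s) (fun n => if n = 2 * s.card then 1 else 0) := by
  have g := good_sphere (s → ℂ)
  have hfr : Module.finrank ℝ (s → ℂ) = 2 * s.card := by
    rw [Module.finrank_pi_fintype]; simp [Complex.finrank_real_complex, mul_comm]
  rw [hfr] at g
  let up : C(nz (s → ℂ), Xo v s) := ⟨fun y => ⟨mk v (fun k => if hk : k ∈ s then y.1 ⟨k, hk⟩ else 0), by
      obtain ⟨k, hk⟩ := Function.ne_iff.1 y.2
      exact mem_Xo.2 ⟨k, k.2, by simpa using hk⟩⟩, by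
      refine Continuous.subtype_mk (mk_oq.continuous.comp (continuous_pi fun k => ?_)) _
      by_cases hj : k ∈ s
      · simp only [hj, dif_pos]
        exact (continuous_apply _).comp continuous_subtype_val
      · simp only [hj, dif_neg, not_false_eq_true]
        fun_prop⟩
  have hrr : ∀ (x : ι → ℂ) (χ : A → Circle), IsC χ → mk v x ∈ Xo v s →
      (fun k : s => (χ (v k) : ℂ) * x k) = fun k : s => x k := by
    intro x χ hχ hx
    funext k
    rw [hv k k.2, hχ.zero]
    simp
  have hVV : ∀ x : ι → ℂ, mk v x ∈ Xo v s → (fun k : s => x k) ∈ nz (s → ℂ) := by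
    intro x hx
    obtain ⟨k, hks, hxk⟩ := mem_Xo.1 hx
    exact Function.ne_iff.2 ⟨⟨k, hks⟩, hxk⟩
  let dn : C(Xo v s, nz (s → ℂ)) := qlift (isOpen_Xo s) (fun x (k : s) => x k) (by fun_prop) hrr hVV
  have dn_mk : ∀ x hx, (dn ⟨mk v x, hx⟩ : s → ℂ) = fun k : s => x k := fun x hx => qlift_mk (isOpen_Xo s) _ (by fun_prop) hrr hVV x hx
  refine g.equiv up dn ?_ ?_
  · refine homotopic_of_eq fun y => Subtype.ext ?_
    refine (dn_mk _ _).trans ?_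
    funext k
    simp
  · refine qhomotopic (isOpen_Xo s) _ _ (fun t x => mk _ fun k => if k ∈ s then x k else (t : ℂ) * x k) ?_ ?_ ?_ ?_ ?_
    · refine mk_oq.continuous.comp_continuousOn (continuousOn_pi.2 fun k => ?_)
      by_cases hj : k ∈ s
      · simp only [hj, if_true]
        fun_prop
      · simp only [hj, if_false]
        fun_prop
    · intro t ht x χ hχ hx
      refine (mk_eq.2 ⟨χ, hχ, fun k => ?_⟩).symm
      split_ifs <;> ring
    · intro t ht x hx
      obtain ⟨k, hks, hxk⟩ := mem_Xo.1 hx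
      exact mem_Xo.2 ⟨k, hks, by simpa only [hks, if_true] using hxk⟩
    · intro x hx
      change mk v (fun k => if hk : k ∈ s then (dn ⟨mk v x, hx⟩ : s → ℂ) ⟨k, hk⟩ else 0) = _
      rw [dn_mk]
      congr 1
      funext k
      by_cases hj : k ∈ s <;> simp [hj]
    · intro x hx
      change mk _ x = _
      congr 1
      funext k
      by_cases hj : k ∈ s <;> simp [hj]

lemma Uo_union_Xo {j : ι} {s : Finset ι} (hj : j ∈ s) : Uo v {j} ∪ Xo v (s.erase j) = Xo v s := by
  ext p
  obtain ⟨x, rfl⟩ := mk_surj p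
  rw [Set.mem_union, mem_Uo, mem_Xo, mem_Xo]
  constructor
  · rintro (h1 | ⟨k, hk, h1⟩)
    · exact ⟨j, hj, h1 j (by simp)⟩
    · exact ⟨k, Finset.mem_of_mem_erase hk, h1⟩
  · rintro ⟨k, hk, h1⟩
    by_cases hkj : k = j
    · left
      intro i hi
      obtain rfl := Finset.mem_singleton.1 hi
      exact hkj ▸ h1
    · exact Or.inr ⟨k, Finset.mem_erase.2 ⟨hkj, hk⟩, h1⟩
end hequivs

/-! ### The orbit space of the sphere -/
section sphere_orbit
variable {n r : ℕ} (z : Fin r → Fin n → ℤ)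
abbrev col (j : Fin n) : Fin r → ℤ := fun i => z i j

lemma weight_isC (t : Fin r → Circle) : IsC fun a : Fin r → ℤ => ∏ i, t i ^ a i := fun a b => by
  simp [zpow_add, Finset.prod_mul_distrib]

lemma isC_weight {χ : (Fin r → ℤ) → Circle} (hχ : IsC χ) : ∃ t : Fin r → Circle, ∀ a, χ a = ∏ i, t i ^ a i := by
  refine ⟨fun i => χ (Pi.single i 1), fun a => ?_⟩
  have : a = ∑ i, a i • (Pi.single i 1 : Fin r → ℤ) := by
    funext k
    simp [Finset.sum_apply, Pi.single_apply]
  conv_lhs => rw [this, hχ.sum]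
  simp only [hχ.zsmul]

def nrm (x : Fin n → ℂ) : ℝ := ‖(WithLp.toLp 2 x : EuclideanSpace ℂ (Fin n))‖

lemma nrm_pos {x : Fin n → ℂ} (hx : mk (col z) x ∈ Xo (col z) Finset.univ) : 0 < nrm x := by
  refine norm_pos_iff.2 fun h0 => ?_
  obtain ⟨k, -, hk⟩ := mem_Xo.1 hx
  exact hk (congrFun (congrArg WithLp.ofLp h0) k)

lemma nrm_cont : Continuous (nrm : (Fin n → ℂ) → ℝ) := by
  unfold nrm
  exact continuous_norm.comp (PiLp.continuous_toLp 2 _)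

lemma nrm_char (x : Fin n → ℂ) (c : Fin n → Circle) : nrm (fun j => (c j : ℂ) * x j) = nrm x := by
  simp [nrm, EuclideanSpace.norm_eq, Circle.norm_coe]

def nsph (x : Fin n → ℂ) (hx : 0 < nrm x) : Sph n :=
  ⟨WithLp.toLp 2 (fun j => ((nrm x)⁻¹ : ℂ) * x j), by
    rw [mem_sphere_zero_iff_norm]
    have : (WithLp.toLp 2 (fun j => ((nrm x)⁻¹ : ℂ) * x j) : EuclideanSpace ℂ (Fin n)) = ((nrm x)⁻¹ : ℂ) • WithLp.toLp 2 x := rfl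
    rw [this, norm_smul]
    change _ * nrm x = 1
    rw [norm_inv, Complex.norm_real, Real.norm_of_nonneg hx.le, inv_mul_cancel₀ hx.ne']⟩

def qsph (x : Fin n → ℂ) (p : OrbitSpace z) : OrbitSpace z := if hx : 0 < nrm x then Quotient.mk _ (nsph x hx) else p

lemma good_orbit {d : ℕ → ℤ} (hn : 1 ≤ n) (hg : Good (Xo (col z) Finset.univ) d) : Good (OrbitSpace z) d := by
  let p0 : OrbitSpace z := Quotient.mk _ ⟨EuclideanSpace.single ⟨0, hn⟩ 1, by simp⟩
  have hrr : ∀ (x : Fin n → ℂ) (χ : (Fin r → ℤ) → Circle), IsC χ → mk (col z) x ∈ Xo (col z) Finset.univ →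
      qsph z (fun k => (χ (col z k) : ℂ) * x k) p0 = qsph z x p0 := by
    intro x χ hχ hx
    have h1 := nrm_pos z hx
    have h2 := h1
    rw [← nrm_char x fun k => χ (col z k)] at h2
    rw [qsph, dif_pos h2, qsph, dif_pos h1]
    refine Eq.symm (Quotient.sound ?_)
    obtain ⟨t, ht⟩ := isC_weight hχ
    refine ⟨t, fun j => ?_⟩
    change ((∏ i, t i ^ z i j : Circle) : ℂ) * (((nrm x)⁻¹ : ℂ) * x j) = ((nrm _)⁻¹ : ℂ) * (_ * x j)
    rw [nrm_char x fun k => χ (col z k), ht]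
    ring
  have hc : ContinuousOn (fun x => qsph z x p0) (mk (col z) ⁻¹' Xo (col z) Finset.univ) := by
    rw [continuousOn_iff_continuous_domRestrict]
    have : (fun x : (mk (col z) ⁻¹' Xo (col z) Finset.univ : Set (Fin n → ℂ)) => qsph z x.1 p0) =
        fun x => Quotient.mk _ (nsph x.1 (nrm_pos z x.2)) := by
      funext x
      rw [qsph, dif_pos (nrm_pos z x.2)]
    change Continuous (fun x : (mk (col z) ⁻¹' Xo (col z) Finset.univ : Set (Fin n → ℂ)) => qsph z x.1 p0)
    rw [this]
    refine continuous_quotient_mk'.comp (Continuous.subtype_mk ?_ _)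
    refine (PiLp.continuous_toLp 2 _).comp (continuous_pi fun j => Continuous.mul (Continuous.inv₀ ?_ ?_) ((continuous_apply j).comp continuous_subtype_val))
    · exact Complex.continuous_ofReal.comp (nrm_cont.comp continuous_subtype_val)
    · intro x
      exact_mod_cast (nrm_pos z x.2).ne'
  have hVV : ∀ x : Fin n → ℂ, mk (col z) x ∈ Xo (col z) Finset.univ → qsph z x p0 ∈ (Set.univ : Set (OrbitSpace z)) := fun _ _ => trivial
  let dn := qlift (isOpen_Xo Finset.univ) (fun x => qsph z x p0) hc hrr hVV
  have dn_mk : ∀ x hx, (dn ⟨mk (col z) x, hx⟩ : OrbitSpace z) = qsph z x p0 :=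
    fun x hx => qlift_mk (isOpen_Xo Finset.univ) _ hc hrr hVV x hx
  have hup : ∀ x : Sph n, mk (col z) (fun j => x.1 j) ∈ Xo (col z) Finset.univ := by
    intro x
    by_contra hcon
    have : x.1 = 0 := by
      ext j
      by_contra hj
      exact hcon (mem_Xo.2 ⟨j, Finset.mem_univ _, hj⟩)
    have h2 := mem_sphere_zero_iff_norm.1 x.2
    rw [this] at h2
    simp at h2
  let up : C(OrbitSpace z, Xo (col z) Finset.univ) :=
    ⟨Quotient.lift (fun x : Sph n => (⟨mk (col z) (fun j => x.1 j), hup x⟩ : Xo (col z) Finset.univ)) (by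
      rintro x y ⟨t, ht⟩
      exact Subtype.ext (mk_eq.2 ⟨_, weight_isC t, fun j => (ht j).symm⟩)), by
      refine Continuous.quotient_lift (Continuous.subtype_mk (mk_oq.continuous.comp (continuous_pi fun j => ?_)) _) _
      fun_prop⟩
  have nsph_self : ∀ x : Sph n, 0 < nrm (fun j => x.1 j) ∧ ∀ hh, nsph (fun j => x.1 j) hh = x := by
    intro x
    have h2 : nrm (fun j => x.1 j) = 1 := mem_sphere_zero_iff_norm.1 x.2
    refine ⟨by rw [h2]; exact one_pos, fun hh => Subtype.ext ?_⟩
    ext j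
    change ((nrm _)⁻¹ : ℂ) * x.1 j = x.1 j
    rw [h2]; simp
  refine hg.equiv ((univC _).comp dn) up ?_ ?_
  · refine ContinuousMap.Homotopic.symm ?_
    refine qhomotopic (isOpen_Xo _) _ _ (fun t x => mk _ fun k => (((1 - t) + t * (nrm x)⁻¹ : ℝ) : ℂ) * x k) ?_ ?_ ?_ ?_ ?_
    · refine mk_oq.continuous.comp_continuousOn (continuousOn_pi.2 fun k => ?_)
      refine ContinuousOn.mul (Complex.continuous_ofReal.comp_continuousOn ?_) (by fun_prop)
      refine ContinuousOn.add (by fun_prop) (ContinuousOn.mul (by fun_prop) (ContinuousOn.inv₀ ?_ ?_))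
      · exact (nrm_cont.comp continuous_snd).continuousOn
      · exact fun x hx => (nrm_pos z hx).ne'
    · intro t ht x χ hχ hx
      refine (mk_eq.2 ⟨χ, hχ, fun k => ?_⟩).symm
      rw [nrm_char x fun k => χ (col z k)]
      ring
    · intro t ht x hx
      obtain ⟨k, hks, hxk⟩ := mem_Xo.1 hx
      refine mem_Xo.2 ⟨k, hks, mul_ne_zero ?_ hxk⟩
      have h3 : 0 < (nrm x)⁻¹ := inv_pos.2 (nrm_pos z hx)
      have : 0 < (1 - t) + t * (nrm x)⁻¹ := by
        rcases ht.1.eq_or_lt with h0 | h0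
        · rw [← h0]; simp
        · have := mul_pos h0 h3
          linarith [ht.2]
      exact_mod_cast this.ne'
    · intro x hx
      change mk _ x = _
      congr 1
      funext k
      simp
    · intro x hx
      change ((up (dn ⟨mk (col z) x, hx⟩ : OrbitSpace z) : Xo (col z) Finset.univ) : Q (col z)) = _
      rw [dn_mk, qsph, dif_pos (nrm_pos z hx)]
      change mk (col z) _ = _
      congr 1
      funext k
      change ((nrm x)⁻¹ : ℂ) * x k = _
      simp
  · refine homotopic_of_eq fun p => ?_
    induction p using Quotient.inductionOn with
    | h x =>
      change (dn ⟨mk (col z) (fun j => x.1 j), hup x⟩ : OrbitSpace z) = _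
      rw [dn_mk, qsph, dif_pos (nsph_self x).1, (nsph_self x).2]
      rfl
end sphere_orbit
end OSH

namespace OSH
section ranks
set_option linter.unusedSectionVars false
variable {ι : Type} [DecidableEq ι]
open Polynomial in
def PP (f : Finset ι → ℕ) (s : Finset ι) : Polynomial ℤ :=
  X ^ f s * ∑ S ∈ s.powerset, (-1) ^ (f s - f S) * (X ^ 2 - 1) ^ (S.card - f S)

lemma PP_rec {f g : Finset ι → ℕ} {s : Finset ι} {j : ι} (hj : j ∈ s) (h1 : f (s.erase j) = f s)
    (h2 : ∀ S ⊆ s.erase j, f (insert j S) = g S + 1) :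
    PP f s = PP f (s.erase j) + Polynomial.X * PP g (s.erase j) := by
  have h3 := h2 _ (Finset.Subset.refl _)
  rw [Finset.insert_erase hj] at h3
  have h4 : s.powerset = (insert j (s.erase j)).powerset := by rw [Finset.insert_erase hj]
  unfold PP
  rw [h4, Finset.sum_powerset_insert (Finset.notMem_erase j s), h1, mul_add]
  congr 1
  rw [← mul_assoc, ← pow_succ', ← h3]
  congr 1
  refine Finset.sum_congr rfl fun S hS => ?_
  have hS := Finset.mem_powerset.1 hS
  rw [h2 S hS, h3, Finset.card_insert_of_notMem fun h => Finset.notMem_erase j s (hS h), Nat.add_sub_add_right, Nat.add_sub_add_right]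

lemma PP_coloop {f : Finset ι → ℕ} {s : Finset ι} {j : ι} (hj : j ∈ s)
    (h2 : ∀ S ⊆ s.erase j, f (insert j S) = f S + 1) (hm : ∀ S ⊆ s.erase j, f S ≤ f (s.erase j)) :
    PP f s = 0 := by
  have h3 := h2 _ (Finset.Subset.refl _)
  rw [Finset.insert_erase hj] at h3
  have h4 : s.powerset = (insert j (s.erase j)).powerset := by rw [Finset.insert_erase hj]
  unfold PP
  rw [h4, Finset.sum_powerset_insert (Finset.notMem_erase j s), ← Finset.sum_add_distrib]
  rw [Finset.sum_eq_zero, mul_zero]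
  intro S hS
  have hS := Finset.mem_powerset.1 hS
  rw [h2 S hS, h3, Finset.card_insert_of_notMem fun h => Finset.notMem_erase j s (hS h), Nat.add_sub_add_right, Nat.add_sub_add_right]
  rw [Nat.sub_add_comm (hm S hS), pow_succ]
  ring

lemma PP_zero {f : Finset ι → ℕ} {s : Finset ι} (hf : ∀ S ⊆ s, f S = 0) : PP f s = Polynomial.X ^ (2 * s.card) := by
  unfold PP
  rw [hf s (Finset.Subset.refl _), pow_zero, one_mul]
  have := Finset.sum_pow_mul_eq_add_pow (Polynomial.X ^ 2 - 1 : Polynomial ℤ) 1 s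
  rw [sub_add_cancel, ← pow_mul] at this
  rw [← this]
  refine Finset.sum_congr rfl fun S hS => ?_
  rw [hf S (Finset.mem_powerset.1 hS)]
  simp

lemma PP_parity (f : Finset ι → ℕ) (s : Finset ι) {n : ℕ} (hn : n % 2 ≠ f s % 2) : (PP f s).coeff n = 0 := by
  have : PP f s = Polynomial.X ^ f s * Polynomial.expand ℤ 2
      (∑ S ∈ s.powerset, (-1) ^ (f s - f S) * (Polynomial.X - 1) ^ (S.card - f S)) := by
    unfold PP
    simp [map_sum]
  rw [this, Polynomial.coeff_X_pow_mul']
  split_ifs with h0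
  · rw [Polynomial.coeff_expand two_pos, if_neg]
    intro h1
    obtain ⟨c, hc⟩ := h1
    omega
  · rfl

variable {A : Type} [AddCommGroup A] [Module.Free ℤ A] [Module.Finite ℤ A] 

def rk (v : ι → A) (S : Finset ι) : ℕ := Module.finrank ℤ (Submodule.span ℤ (v '' (S : Set ι)))

lemma finrank_map_ker {B : Type} [AddCommGroup B] (M : Submodule ℤ A) (f : A →ₗ[ℤ] B) :
    Module.finrank ℤ M = Module.finrank ℤ (M.map f) + Module.finrank ℤ ↥(LinearMap.ker f ⊓ M) := by
  have h1 := Submodule.finrank_quotient_add_finrank (LinearMap.ker (f.domRestrict M))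
  rw [(f.domRestrict M).quotKerEquivRange.finrank_eq] at h1
  rw [LinearMap.range_domRestrict] at h1
  rw [← h1]
  congr 1
  have : LinearMap.ker f ⊓ M = (LinearMap.ker (f.domRestrict M)).map M.subtype := by
    ext x
    simp only [Submodule.mem_inf, Submodule.mem_map, LinearMap.mem_ker]
    constructor
    · rintro ⟨h2, h3⟩
      exact ⟨⟨x, h3⟩, h2, rfl⟩
    · rintro ⟨y, h2, rfl⟩
      exact ⟨h2, y.2⟩
  rw [this]
  exact (LinearEquiv.finrank_eq (Submodule.equivMapOfInjective _ M.subtype_injective _))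

lemma finrank_int_sub (N : Submodule ℤ ℤ) (hN : N ≠ ⊥) : Module.finrank ℤ N = 1 := by
  obtain ⟨x, hx, h0⟩ := Submodule.exists_mem_ne_zero_of_ne_bot hN
  have h1 : Module.finrank ℤ N ≤ 1 := by simpa using Submodule.finrank_le N
  have h2 : 0 < Module.finrank ℤ N := by
    rw [Module.finrank_pos_iff]
    exact ⟨⟨x, hx⟩, 0, fun h => h0 (congrArg Subtype.val h)⟩
  omega

lemma finrank_one (N : Submodule ℤ A) (l : A →ₗ[ℤ] ℤ) (hl : ∀ x ∈ N, l x = 0 → x = 0) {x : A} (hx : x ∈ N) (h0 : x ≠ 0) :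
    Module.finrank ℤ N = 1 := by
  rw [finrank_map_ker N l, finrank_int_sub]
  · have : LinearMap.ker l ⊓ N = ⊥ := by
      rw [eq_bot_iff]
      rintro y ⟨h1, h2⟩
      exact hl y h2 h1
    rw [this]
    simp
  · intro h1
    have := Submodule.mem_map_of_mem (f := l) hx
    rw [h1] at this
    exact h0 (hl x hx this)

lemma rk_mono (v : ι → A) {S T : Finset ι} (hST : S ⊆ T) : rk v S ≤ rk v T :=
  Submodule.finrank_mono (Submodule.span_mono (Set.image_mono hST))

lemma rk_coloop {v : ι → A} {j : ι} {S : Finset ι} (l : A →ₗ[ℤ] ℤ) (hl : l (v j) ≠ 0) (hk : ∀ k ∈ S, l (v k) = 0) :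
    rk v (insert j S) = rk v S + 1 := by
  unfold rk
  rw [finrank_map_ker _ l, finrank_int_sub, add_comm]
  · congr 1
    have hS : Submodule.span ℤ (v '' (S : Set ι)) ≤ LinearMap.ker l := by
      rw [Submodule.span_le]
      rintro _ ⟨k, hk', rfl⟩
      exact hk k hk'
    suffices H : LinearMap.ker l ⊓ Submodule.span ℤ (v '' ↑(insert j S)) = Submodule.span ℤ (v '' ↑S) by rw [H]
    rw [Finset.coe_insert, Set.image_insert_eq]
    apply le_antisymm
    · rintro x ⟨h1, h2⟩
      obtain ⟨m, y, hy, rfl⟩ := Submodule.mem_span_insert.1 h2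
      have h3 : l (m • v j + y) = 0 := h1
      rw [map_add, LinearMap.mem_ker.1 (hS hy), add_zero, map_smul, smul_eq_mul] at h3
      rcases mul_eq_zero.1 h3 with h4 | h4
      · rw [h4, zero_smul, zero_add]; exact hy
      · exact (hl h4).elim
    · exact le_inf hS (Submodule.span_mono (Set.subset_insert _ _))
  · intro h1
    have : l (v j) ∈ (Submodule.span ℤ (v '' ↑(insert j S))).map l :=
      Submodule.mem_map_of_mem (Submodule.subset_span ⟨j, by simp, rfl⟩)
    rw [h1] at this
    exact hl this

lemma rk_con {v : ι → A} {j : ι} {S : Finset ι} (hjS : j ∉ S) (w : A) (u : ℤ) (hu : u ≠ 0) (hw : v j = u • w) (l : A →ₗ[ℤ] ℤ) (hl : l w = 1) :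
    rk v (insert j S) = rk (con (Function.update v j w) j l) S + 1 := by
  unfold rk
  let p : A →ₗ[ℤ] A := LinearMap.id - l.smulRight w
  have hp : ∀ a, p a = a - l a • w := fun a => rfl
  rw [finrank_map_ker _ p]
  congr 1
  · have hc : ∀ k ∈ S, con (Function.update v j w) j l k = p (v k) := by
      intro k hk
      have : k ≠ j := fun h => hjS (h ▸ hk)
      rw [con, hp, Function.update_self, Function.update_of_ne this]
    rw [Submodule.map_span, Finset.coe_insert, Set.image_insert_eq, Set.image_insert_eq, Set.image_image]
    have h0 : p (v j) = 0 := by rw [hp, hw, map_smul, hl, smul_eq_mul, mul_one, sub_self]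
    rw [h0, Submodule.span_insert_zero]
    rw [Set.image_congr (f := con (Function.update v j w) j l) (g := fun k => p (v k)) (fun k hk => hc k hk)]
  · refine finrank_one _ l ?_ (x := v j) ?_ ?_
    · rintro x ⟨h1, -⟩ h2
      have h3 : x - l x • w = 0 := h1
      rw [h2, zero_smul, sub_zero] at h3
      exact h3
    · refine ⟨?_, Submodule.subset_span ⟨j, by simp, rfl⟩⟩
      change v j - l (v j) • w = 0
      rw [hw, map_smul, hl, smul_eq_mul, mul_one, sub_self]
    · intro h0
      have := congrArg l h0
      rw [hw, map_smul, hl, map_zero, smul_eq_mul, mul_one] at this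
      exact hu this

lemma exists_functional (B : Submodule ℤ A) (a : A) (ha : ∀ u : ℤ, u ≠ 0 → u • a ∉ B) :
    ∃ l : A →ₗ[ℤ] ℤ, l a ≠ 0 ∧ ∀ b ∈ B, l b = 0 := by
  let T := Submodule.torsion ℤ (A ⧸ B)
  let F := (A ⧸ B) ⧸ T
  let π : A →ₗ[ℤ] F := T.mkQ.comp B.mkQ
  have : Module.IsTorsionFree ℤ F := inferInstance
  have : Module.Free ℤ F := Module.free_of_finite_type_torsion_free'
  have h0 : π a ≠ 0 := by
    intro h0
    have h1 : B.mkQ a ∈ T := (Submodule.Quotient.mk_eq_zero _).1 h0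
    obtain ⟨⟨u, hu⟩, h2⟩ := (Submodule.mem_torsion_iff _).1 h1
    refine ha u (nonZeroDivisors.ne_zero hu) ?_
    have h3 : B.mkQ (u • a) = 0 := by rw [map_smul]; exact h2
    exact (Submodule.Quotient.mk_eq_zero _).1 h3
  let b := Module.Free.chooseBasis ℤ F
  have h1 : b.repr (π a) ≠ 0 := by simpa using h0
  obtain ⟨i, hi⟩ := Finsupp.ne_iff.1 h1
  refine ⟨(b.coord i).comp π, hi, fun x hx => ?_⟩
  have : π x = 0 := by
    change T.mkQ (B.mkQ x) = 0
    have : B.mkQ x = 0 := (Submodule.Quotient.mk_eq_zero _).2 hx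
    rw [this, map_zero]
  rw [LinearMap.comp_apply, this, map_zero]

lemma rk_erase {v : ι → A} {j : ι} {s : Finset ι} (hj : j ∈ s)
    (hn : ∀ l : A →ₗ[ℤ] ℤ, (∀ k ∈ s, k ≠ j → l (v k) = 0) → l (v j) = 0) : rk v (s.erase j) = rk v s := by
  apply le_antisymm (rk_mono v (Finset.erase_subset _ _))
  by_cases hB : ∃ u : ℤ, u ≠ 0 ∧ u • v j ∈ Submodule.span ℤ (v '' ↑(s.erase j))
  · obtain ⟨u, hu, hB⟩ := hB
    have key : ∀ x ∈ Submodule.span ℤ (v '' (s : Set ι)), u • x ∈ Submodule.span ℤ (v '' ↑(s.erase j)) := by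
      intro x hx
      rw [← Finset.insert_erase hj, Finset.coe_insert, Set.image_insert_eq] at hx
      obtain ⟨m, y, hy, rfl⟩ := Submodule.mem_span_insert.1 hx
      rw [smul_add, smul_comm]
      exact add_mem (Submodule.smul_mem _ _ hB) (Submodule.smul_mem _ _ hy)
    let φ : Submodule.span ℤ (v '' (s : Set ι)) →ₗ[ℤ] Submodule.span ℤ (v '' ↑(s.erase j)) :=
      LinearMap.codRestrict _ ((u • LinearMap.id).comp (Submodule.subtype _)) (fun x => key x x.2)
    refine LinearMap.finrank_le_finrank_of_injective (f := φ) ?_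
    intro x y hxy
    have : u • (x : A) = u • (y : A) := congrArg Subtype.val hxy
    exact Subtype.ext (smul_right_injective A hu this)
  · push Not at hB
    obtain ⟨l, h1, h2⟩ := exists_functional _ _ hB
    refine (h1 (hn l fun k hk hkj => h2 _ (Submodule.subset_span ⟨k, ?_, rfl⟩))).elim
    exact Finset.mem_coe.2 (Finset.mem_erase.2 ⟨hkj, hk⟩)

/-- content -/
lemma exists_content {a : A} (ha : a ≠ 0) : ∃ (u : ℕ) (w : A) (l : A →ₗ[ℤ] ℤ), u ≠ 0 ∧ a = u • w ∧ l w = 1 := by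
  let b := Module.Free.chooseBasis ℤ A
  let ev : (A →ₗ[ℤ] ℤ) →ₗ[ℤ] ℤ := LinearMap.applyₗ a
  obtain ⟨d, hd⟩ := (IsPrincipalIdealRing.principal (LinearMap.range ev)).principal
  have hdv : ∀ l : A →ₗ[ℤ] ℤ, d ∣ l a := by
    intro l
    have : l a ∈ LinearMap.range ev := ⟨l, rfl⟩
    rw [hd] at this
    exact Ideal.mem_span_singleton.1 this
  have hd0 : d ≠ 0 := by
    rintro rfl
    refine ha (b.repr.map_eq_zero_iff.1 (Finsupp.ext fun i => ?_))
    exact zero_dvd_iff.1 (hdv (b.coord i))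
  have hn : ((d.natAbs : ℕ) : ℤ) ∈ LinearMap.range ev := by
    rw [hd]
    exact Ideal.mem_span_singleton.2 (Int.dvd_natAbs.2 dvd_rfl)
  obtain ⟨l, hl⟩ := hn
  have hl : l a = (d.natAbs : ℤ) := hl
  choose c hc using fun i => Int.natAbs_dvd.2 (hdv (b.coord i))
  have hw : a = d.natAbs • ∑ i, c i • b i := by
    rw [← natCast_zsmul, Finset.smul_sum]
    conv_lhs => rw [← b.sum_repr a]
    refine Finset.sum_congr rfl fun i _ => ?_
    rw [smul_smul, ← hc]
    rfl
  refine ⟨d.natAbs, ∑ i, c i • b i, l, Int.natAbs_ne_zero.2 hd0, hw, ?_⟩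
  rw [hw] at hl
  rw [map_nsmul, nsmul_eq_mul] at hl
  have h0 : ((d.natAbs : ℕ) : ℤ) ≠ 0 := by exact_mod_cast Int.natAbs_ne_zero.2 hd0
  exact mul_left_cancel₀ h0 (hl.trans (mul_one _).symm)
end ranks
end OSH

namespace OSH
section maininduction
set_option linter.unusedSectionVars false
variable {ι : Type} [DecidableEq ι]

lemma PP_congr {f g : Finset ι → ℕ} {s : Finset ι} (hfg : ∀ S ⊆ s, f S = g S) : PP f s = PP g s := by
  unfold PP
  rw [hfg s (Finset.Subset.refl _)]
  congr 1
  refine Finset.sum_congr rfl fun S hS => ?_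
  rw [hfg S (Finset.mem_powerset.1 hS)]

lemma Good.congr {X : Type} [TopologicalSpace X] {d e : ℕ → ℤ} (hX : Good X d) (hde : ∀ n, d n = e n) : Good X e := by
  rwa [← (funext hde : d = e)]

lemma span_pow_mem {H : Type} [AddCommGroup H] {D : Type} [Fintype D] (R : Submodule ℤ H) (u : D → ℤ)
    (hI : Ideal.span (Set.range u) = ⊤) (y : H) (hy : ∀ j, ∃ k : ℕ, u j ^ k • y ∈ R) : y ∈ R := by
  choose k hk using hy
  have h1 := Ideal.span_pow_eq_top _ hI (∑ j, k j)
  let J : Ideal ℤ := R.comap (LinearMap.toSpanSingleton ℤ H y)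
  have h2 : Ideal.span ((fun x : ℤ => x ^ (∑ j, k j)) '' Set.range u) ≤ J := by
    rw [Ideal.span_le]
    rintro _ ⟨_, ⟨j, rfl⟩, rfl⟩
    change (u j ^ (∑ j, k j)) • y ∈ R
    have h3 : k j ≤ ∑ j, k j := Finset.single_le_sum (fun _ _ => Nat.zero_le _) (Finset.mem_univ j)
    obtain ⟨c, hc⟩ := Nat.exists_eq_add_of_le h3
    rw [hc, add_comm, pow_add, mul_smul]
    exact R.smul_mem _ (hk j)
  rw [h1] at h2
  have h3 : (1 : ℤ) ∈ J := h2 trivial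
  have h4 : (1 : ℤ) • y ∈ R := h3
  rwa [one_smul] at h4

/-- gluing -/
lemma good_glue {X D : Type} [TopologicalSpace X] [Fintype D] [Nonempty D] (Y : D → Type) [∀ j, TopologicalSpace (Y j)]
    {d : ℕ → ℤ} (u : D → ℤ) (hu : ∀ j, u j ≠ 0) (hI : Ideal.span (Set.range u) = ⊤) (hY : ∀ j, Good (Y j) d)
    (f : ∀ j, C(Y j, X)) (g : ∀ j, C(X, Y j)) (hf : ∀ j n, UIso (u j) (hmap (f j) n))
    (hg : ∀ j n, UIso (u j) (hmap (g j) n)) : Good X d := by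
  intro n
  have hfree : ∀ j, Module.Free ℤ (h (Y j) n) := fun j => (hY j n).1
  have hfin : ∀ j, Module.Finite ℤ (h (Y j) n) := fun j => (hY j n).2.1
  have htf : ∀ (m : ℤ) (y : h X n), m ≠ 0 → m • y = 0 → y = 0 := by
    intro m y hm hmy
    refine (Submodule.mem_bot ℤ).1 (span_pow_mem ⊥ u hI y fun j => ?_)
    have h1 : m • hmap (g j) n y = 0 := by rw [← map_smul, hmy, map_zero]
    have h2 : hmap (g j) n y = 0 := (smul_eq_zero.1 h1).resolve_left hm
    exact (hg j n).1 y h2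
  have hfg : Module.Finite ℤ (h X n) := by
    refine ⟨?_⟩
    have : (⊤ : Submodule ℤ (h X n)) = ⨆ j, LinearMap.range (hmap (f j) n) := by
      symm
      rw [eq_top_iff]
      intro y _
      refine span_pow_mem _ u hI y fun j => ?_
      obtain ⟨k, x, hx⟩ := (hf j n).2 y
      exact ⟨k, (le_iSup (fun j => LinearMap.range (hmap (f j) n)) j) ⟨x, hx⟩⟩
    rw [this]
    refine Submodule.fg_iSup _ fun j => ?_
    rw [LinearMap.range_eq_map]
    exact Submodule.FG.map _ (hfin j).1
  have htf' : Module.IsTorsionFree ℤ (h X n) := by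
    rw [Module.isTorsionFree_iff_smul_eq_zero]
    intro m y hmy
    by_cases hm : m = 0
    · exact Or.inl hm
    · exact Or.inr (htf m y hm hmy)
  have hfr : Module.Free ℤ (h X n) := Module.free_of_finite_type_torsion_free'
  refine ⟨hfr, hfg, ?_⟩
  obtain ⟨j⟩ := ‹Nonempty D›
  rw [← (hY j n).2.2]
  have h1 : Function.Injective (hmap (f j) n) := by
    rw [injective_iff_map_eq_zero]
    intro x hx
    obtain ⟨k, hk⟩ := (hf j n).1 x hx
    exact (smul_eq_zero.1 hk).resolve_left (pow_ne_zero _ (hu j))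
  have h2 : Function.Injective (hmap (g j) n) := by
    rw [injective_iff_map_eq_zero]
    intro x hx
    obtain ⟨k, hk⟩ := (hg j n).1 x hx
    exact htf _ _ (pow_ne_zero _ (hu j)) hk
  exact_mod_cast le_antisymm (LinearMap.finrank_le_finrank_of_injective h2) (LinearMap.finrank_le_finrank_of_injective h1)

variable {A : Type} [AddCommGroup A] [Module.Free ℤ A] [Module.Finite ℤ A]

lemma rk_congr {v v' : ι → A} {S : Finset ι} (hv : ∀ k ∈ S, v k = v' k) : rk v S = rk v' S := by
  unfold rk
  rw [Set.image_congr (f := v) (g := v') (fun k hk => hv k hk)]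

lemma good_step {v : ι → A} {s : Finset ι} {j : ι} (hj : j ∈ s) {w : A} {u : ℕ} {l : A →ₗ[ℤ] ℤ} (hu : u ≠ 0) (hw : v j = u • w)
    (hl : l w = 1) (hn : ∀ l : A →ₗ[ℤ] ℤ, (∀ k ∈ s, k ≠ j → l (v k) = 0) → l (v j) = 0)
    (IH : ∀ v' : ι → A, Good (Xo v' (s.erase j)) (fun n => (PP (rk v') (s.erase j)).coeff n)) :
    Good (Xo (Function.update v j w) s) (fun n => (PP (rk v) s).coeff n) := by
  have hl' : l (Function.update v j w j) = 1 := by rw [Function.update_self]; exact hl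
  have g1 : Good (Uo (Function.update v j w) {j}) 0 := good_Uo j l (by rw [hl']; exact one_ne_zero)
  have g2 := IH (Function.update v j w)
  have e2 : PP (rk (Function.update v j w)) (s.erase j) = PP (rk v) (s.erase j) := by
    refine PP_congr fun S hS => rk_congr fun k hk => ?_
    rw [Function.update_of_ne]
    rintro rfl
    exact Finset.notMem_erase k s (hS hk)
  rw [e2] at g2
  have g3 := good_con hl' (Finset.notMem_erase j s) (IH (con (Function.update v j w) j l))
  have hu' : (u : ℤ) ≠ 0 := by exact_mod_cast hu
  have r1 := rk_erase hj hn
  have r2 : ∀ S ⊆ s.erase j, rk v (insert j S) = rk (con (Function.update v j w) j l) S + 1 := fun S hS =>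
    rk_con (fun h => Finset.notMem_erase j s (hS h)) w u hu' (by rw [hw, natCast_zsmul]) l hl
  have r3 := r2 _ (Finset.Subset.refl _)
  rw [Finset.insert_erase hj] at r3
  have g4 := Good.mv (isOpen_Uo _) (isOpen_Xo _) g1 g2 g3 (by
    intro n
    by_cases hpar : n % 2 = rk v s % 2
    · right
      apply PP_parity
      omega
    · left
      apply PP_parity
      rw [r1]
      exact hpar)
  rw [Uo_union_Xo hj] at g4
  refine g4.congr fun n => ?_
  rw [PP_rec hj r1 r2, Polynomial.coeff_add]
  congr 1
  cases n with
  | zero => simp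
  | succ n => rw [Polynomial.coeff_X_mul]

lemma good_top {v : ι → A} {s : Finset ι} (hoff : ∀ k, k ∉ s → v k = 0) (hsp : Submodule.span ℤ (v '' (s : Set ι)) = ⊤)
    (IH : ∀ j ∈ s, ∀ v' : ι → A, Good (Xo v' (s.erase j)) (fun n => (PP (rk v') (s.erase j)).coeff n)) :
    Good (Xo v s) (fun n => (PP (rk v) s).coeff n) := by
  by_cases h0 : ∀ k ∈ s, v k = 0
  · refine (good_zero s h0).congr fun n => ?_
    rw [PP_zero, Polynomial.coeff_X_pow]
    intro S hS
    have : Submodule.span ℤ (v '' (S : Set ι)) = ⊥ := by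
      rw [Submodule.span_eq_bot]
      rintro _ ⟨k, hk, rfl⟩
      exact h0 k (hS hk)
    rw [rk, this]
    simp
  by_cases hc : ∃ j ∈ s, ∃ l : A →ₗ[ℤ] ℤ, l (v j) ≠ 0 ∧ ∀ k ∈ s, k ≠ j → l (v k) = 0
  · obtain ⟨j, hj, l, hl, hk⟩ := hc
    refine (good_coloop hj l hl fun k hkj => ?_).congr fun n => ?_
    · by_cases hks : k ∈ s
      · exact hk k hks hkj
      · rw [hoff k hks, map_zero]
    · rw [PP_coloop hj, Polynomial.coeff_zero]
      · rfl
      · intro S hS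
        refine rk_coloop l hl fun k hkS => ?_
        have := Finset.mem_erase.1 (hS hkS)
        exact hk k this.2 this.1
      · exact fun S hS => rk_mono v hS
  · have hn : ∀ j ∈ s, ∀ l : A →ₗ[ℤ] ℤ, (∀ k ∈ s, k ≠ j → l (v k) = 0) → l (v j) = 0 := by
      intro j hj l hk
      by_contra hl
      exact hc ⟨j, hj, l, hl, hk⟩
    push Not at h0
    obtain ⟨j0, hj0, hv0⟩ := h0
    let D := {j : s // v j ≠ 0}
    have : Nonempty D := ⟨⟨⟨j0, hj0⟩, hv0⟩⟩
    have : Fintype D := Fintype.ofFinite D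
    choose u w l hu hw hl using fun j : D => exists_content j.2
    have hI : Ideal.span (Set.range fun j => (u j : ℤ)) = ⊤ := by
      rw [Ideal.eq_top_iff_one]
      obtain ⟨u0, w0, l0, -, -, hl0⟩ := exists_content hv0
      rw [← hl0]
      have hle : Submodule.span ℤ (v '' (s : Set ι)) ≤
          Submodule.comap l0 (Ideal.span (Set.range fun j => (u j : ℤ)) : Submodule ℤ ℤ) := by
        rw [Submodule.span_le]
        rintro _ ⟨k, hk, rfl⟩
        change l0 (v k) ∈ Ideal.span (Set.range fun j => (u j : ℤ))
        by_cases hvk : v k = 0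
        · rw [hvk, map_zero]; exact zero_mem _
        · let jj : D := ⟨⟨k, hk⟩, hvk⟩
          have : v k = u jj • w jj := hw jj
          rw [this, map_nsmul, nsmul_eq_mul]
          exact Ideal.mul_mem_right _ _ (Ideal.subset_span ⟨jj, rfl⟩)
      rw [hsp] at hle
      exact hle (x := w0) trivial
    have hac : ∀ (j : D) (k : ι), (if k = (j.1 : ι) then u j else 1) • (Function.update v j.1 (w j) k) = 1 • v k := by
      intro j k
      by_cases hkj : k = (j.1 : ι)
      · rw [if_pos hkj, hkj, Function.update_self, ← hw, one_smul]
      · rw [if_neg hkj, Function.update_of_ne hkj]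
    have hbd : ∀ (j : D) (k : ι), (if k = (j.1 : ι) then 1 else u j) • v k = u j • (Function.update v j.1 (w j) k) := by
      intro j k
      by_cases hkj : k = (j.1 : ι)
      · rw [if_pos hkj, hkj, Function.update_self, ← hw, one_smul]
      · rw [if_neg hkj, Function.update_of_ne hkj]
    refine good_glue (D := D) (fun j => Xo (Function.update v j.1 (w j)) s) (fun j => (u j : ℤ))
      (fun j => by exact_mod_cast hu j) hI ?_
      (fun j => res (pm _ _ (hac j)) (pm_Xo _ _ (hac j) s))
      (fun j => res (pm _ _ (hbd j)) (pm_Xo _ _ (hbd j) s)) ?_ ?_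
    · intro j
      exact good_step j.1.2 (hu j) (hw j) (hl j) (hn j.1 j.1.2) (IH j.1 j.1.2)
    · intro j n
      refine pm_uiso (hac j) (hbd j) (hu j) (fun k => ?_) s n
      split_ifs <;> simp
    · intro j n
      refine pm_uiso (hbd j) (hac j) (hu j) (fun k => ?_) s n
      split_ifs <;> simp

theorem good_main (N : ℕ) : ∀ (s : Finset ι), s.card = N → ∀ (A : Type) [AddCommGroup A] [Module.Free ℤ A] [Module.Finite ℤ A]
    (v : ι → A), Good (Xo v s) (fun n => (PP (rk v) s).coeff n) := by
  induction N with
  | zero =>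
    intro s hs A _ _ _ v
    obtain rfl := Finset.card_eq_zero.1 hs
    refine (good_zero (v := v) ∅ (by simp)).congr fun n => ?_
    rw [PP_zero, Polynomial.coeff_X_pow]
    intro S hS
    rw [Finset.subset_empty.1 hS, rk]
    simp
  | succ N ih =>
    intro s hs A _ _ _ v
    let M := Submodule.span ℤ (v '' (s : Set ι))
    have hm : ∀ k ∈ s, v k ∈ M := fun k hk => Submodule.subset_span ⟨k, hk, rfl⟩
    let v' : ι → M := fun k => if hk : k ∈ s then ⟨v k, hm k hk⟩ else 0
    have hv' : ∀ k ∈ s, ((v' k : M) : A) = v k := by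
      intro k hk
      simp only [v', dif_pos hk]
    have himg : ∀ S ⊆ s, (Submodule.span ℤ (v' '' (S : Set ι))).map M.subtype = Submodule.span ℤ (v '' (S : Set ι)) := by
      intro S hS
      rw [Submodule.map_span, Set.image_image]
      rw [Set.image_congr (f := fun k => M.subtype (v' k)) (g := v) (fun k hk => hv' k (hS hk))]
    have hrk : ∀ S ⊆ s, rk v' S = rk v S := by
      intro S hS
      unfold rk
      rw [← himg S hS]
      exact LinearEquiv.finrank_eq (Submodule.equivMapOfInjective _ M.subtype_injective _)
    have g := good_top (v := v') (s := s) (fun k hk => by simp only [v', dif_neg hk])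
      (by
        apply Submodule.map_injective_of_injective M.subtype_injective
        rw [himg s (Finset.Subset.refl _), Submodule.map_top, Submodule.range_subtype])
      (fun j hj v'' => ih _ (by rw [Finset.card_erase_of_mem hj, hs]; rfl) _ v'')
    rw [PP_congr hrk] at g
    refine good_trunc v' s (fun m => ?_) g
    rw [← Submodule.coe_eq_zero, Submodule.coe_sum]
    simp only [Submodule.coe_smul]
    rw [Finset.sum_congr rfl fun k _ => by rw [hv' k k.2]]
end maininduction
end OSH

namespace OSH
section final
variable {n r : ℕ} (z : Fin r → Fin n → ℤ)

def toQ (r : ℕ) : (Fin r → ℤ) →ₗ[ℤ] (Fin r → ℚ) where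
  toFun a i := (a i : ℚ)
  map_add' a b := by funext i; simp
  map_smul' m a := by funext i; simp

lemma toQ_inj : Function.Injective (toQ r) := by
  intro a b hab
  funext i
  have : ((a i : ℤ) : ℚ) = b i := congrFun hab i
  exact_mod_cast this

lemma colRank_eq (S : Finset (Fin n)) : colRank z ↑S = rk (col z) S := by
  unfold colRank rk
  let N := Submodule.span ℤ (col z '' (S : Set (Fin n)))
  let b := Module.Free.chooseBasis ℤ N
  have h1 : LinearIndependent ℤ fun i => toQ r (b i : Fin r → ℤ) := by
    have h2 := b.linearIndependent.map' (N.subtype) (LinearMap.ker_eq_bot.2 N.subtype_injective)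
    exact h2.map' (toQ r) (LinearMap.ker_eq_bot.2 toQ_inj)
  have h2 := (LinearIndependent.iff_fractionRing ℤ ℚ).1 h1
  have h3 : Submodule.span ℚ ((fun j => fun i => (z i j : ℚ)) '' (S : Set (Fin n))) =
      Submodule.span ℚ (Set.range fun i => toQ r (b i : Fin r → ℤ)) := by
    apply le_antisymm
    · rw [Submodule.span_le]
      rintro _ ⟨j, hj, rfl⟩
      have hm : col z j ∈ N := Submodule.subset_span ⟨j, hj, rfl⟩
      have e : (fun i => (z i j : ℚ)) = ∑ i, (b.repr ⟨_, hm⟩ i) • toQ r (b i : Fin r → ℤ) := by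
        have h4 := congrArg (fun x : N => toQ r (x : Fin r → ℤ)) (b.sum_repr ⟨_, hm⟩)
        simp only [Submodule.coe_sum, Submodule.coe_smul, map_sum, map_smul] at h4
        exact h4.symm
      change (fun i => (z i j : ℚ)) ∈ Submodule.span ℚ (Set.range fun i => toQ r (b i : Fin r → ℤ))
      rw [e]
      exact Submodule.sum_mem _ fun i _ => zsmul_mem (Submodule.subset_span (Set.mem_range_self i)) _
    · rw [Submodule.span_le]
      rintro _ ⟨i, rfl⟩
      have hle : N ≤ ((Submodule.span ℚ ((fun j => fun i => (z i j : ℚ)) '' (S : Set (Fin n)))).restrictScalars ℤ).comap (toQ r) := by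
        rw [Submodule.span_le]
        rintro _ ⟨j, hj, rfl⟩
        exact Submodule.subset_span ⟨j, hj, rfl⟩
      exact hle (b i).2
  rw [h3, finrank_span_eq_card h2, Module.finrank_eq_card_chooseBasisIndex]

theorem main_aux (hn : 1 ≤ n) (hr : 1 ≤ r) 
    (heff : Submodule.span ℤ (Set.range fun j => fun i => z i j) = ⊤) :
    (∀ i : ℕ, Module.Free ℤ (SingularHomology (OrbitSpace z) i) ∧
        Module.Finite ℤ (SingularHomology (OrbitSpace z) i)) ∧
    (∀ i : ℕ, 1 ≤ i →
      (Module.finrank ℤ (SingularHomology (OrbitSpace z) i) : ℤ) =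
        (Polynomial.X ^ (r - 1) *
          ∑ A : Finset (Fin n),
            (-1 : Polynomial ℤ) ^ (r - colRank z ↑A) *
              (Polynomial.X ^ 2 - 1) ^ (A.card - colRank z ↑A)).coeff i) := by
  have g := good_orbit z hn (good_main _ Finset.univ rfl _ (col z))
  have hρ : rk (col z) Finset.univ = r := by
    unfold rk
    rw [Finset.coe_univ, Set.image_univ]
    have : Submodule.span ℤ (Set.range (col z)) = ⊤ := heff
    rw [this, finrank_top]
    simp
  constructor
  · intro i
    cases i with
    | zero =>
      have := (g 1).1
      have := (g 1).2.1
      exact free_homology_zero _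
    | succ i =>
      obtain ⟨e⟩ := homology_succ (OrbitSpace z) i
      have := (g (i + 2)).1
      have := (g (i + 2)).2.1
      have e' : h (OrbitSpace z) (i + 2) ≃ₗ[ℤ] SingularHomology (OrbitSpace z) (i + 1) := e.symm.toIntLinearEquiv
      exact ⟨Module.Free.of_equiv e', Module.Finite.equiv e'⟩
  · intro i hi
    obtain ⟨m, rfl⟩ := Nat.exists_eq_add_of_le' hi
    obtain ⟨e⟩ := homology_succ (OrbitSpace z) m
    have e' : SingularHomology (OrbitSpace z) (m + 1) ≃ₗ[ℤ] h (OrbitSpace z) (m + 2) := e.toIntLinearEquiv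
    rw [e'.finrank_eq, (g (m + 2)).2.2]
    unfold PP
    rw [hρ, Finset.powerset_univ]
    obtain ⟨q, rfl⟩ := Nat.exists_eq_add_of_le' hr
    rw [pow_succ', mul_assoc]
    beta_reduce
    rw [Polynomial.coeff_X_mul, Nat.add_sub_cancel]
    simp only [colRank_eq]
end final
end OSH

/-- If `r ≥ 1` and the action is effective, then every integral singular
homology group of `X_z` is finitely generated free abelian, and for `i ≥ 1` the rank of
`H_i(X_z; ℤ)` is the coefficient of `t^i` in
`t^(r-1) * ∑_{A ⊆ Fin n} (-1)^(r - rk A) (t² - 1)^(|A| - rk A)`,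
i.e. in `t^(r-1) * T(M_z; 0, t²)`. -/
theorem orbitSpace_homology (n r : ℕ) (hn : 1 ≤ n) (hr : 1 ≤ r)
    (z : Fin r → Fin n → ℤ)
    (heff : Submodule.span ℤ (Set.range fun j => fun i => z i j) = ⊤) :
    (∀ i : ℕ, Module.Free ℤ (SingularHomology (OrbitSpace z) i) ∧
        Module.Finite ℤ (SingularHomology (OrbitSpace z) i)) ∧
    (∀ i : ℕ, 1 ≤ i →
      (Module.finrank ℤ (SingularHomology (OrbitSpace z) i) : ℤ) =
        (Polynomial.X ^ (r - 1) *
          ∑ A : Finset (Fin n),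
            (-1 : Polynomial ℤ) ^ (r - colRank z ↑A) *
              (Polynomial.X ^ 2 - 1) ^ (A.card - colRank z ↑A)).coeff i) := by
  exact OSH.main_aux z hn hr heff
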